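/- Let p ≥ 2 and 2 ≤ k ≤ p−1 be integers, M > 0, R > 1; let ω ∈ C^∞(ℝ) satisfy |ω(ξ)| ≤ 1 for all ξ, ω(ξ) = 0 for |ξ| ≤ 1, and ω constant on each of {ξ ≥ R} and {ξ ≤ −R}; let ψ ∈ C₀^∞(ℝ) with 0 ≤ ψ ≤ 1, ψ(y) = 1 for |y| ≤ 1/2 and ψ(y) = 0 for |y| ≥ 1. For h ≥ 1 define λ_{p−k}(x,ξ) := M·ω(ξ/h)·⟨ξ⟩_h^{−k+1}·∫₀ˣ ⟨y⟩^{−(p−k)/(p−1)} ψ(⟨y⟩/⟨ξ⟩_h^{p−1}) dy. Then there exists h_k ≥ 1 (depending on k, p, M, R, ω, ψ) such that for every h ≥ h_k the operator e^{λ_{p−k}}(x,D) : 𝒮(ℝ) → 𝒮(ℝ), defined by e^{λ_{p−k}}(x,D)u(x) = (2π)^{−1} ∫ e^{ixξ} e^{λ_{p−k}(x,ξ)} û(ξ) dξ, is a linear bijection of 𝒮(ℝ) onto itself. -/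

import Mathlib

open MeasureTheory Real

noncomputable section

/-- The Japanese bracket `⟨x⟩ = (1 + x²)^(1/2)`. -/
def jb (x : ℝ) : ℝ := Real.sqrt (1 + x ^ 2)

/-- `⟨ξ⟩ₕ = (h² + ξ²)^(1/2)`. -/
def jbh (h ξ : ℝ) : ℝ := Real.sqrt (h ^ 2 + ξ ^ 2)

/-- The pseudo-differential operator
`a(x,D)u(x) = (2π)⁻¹ ∫ e^{ixξ} a(x,ξ) û(ξ) dξ`, with `û(ξ) = ∫ e^{-iyξ} u(y) dy`. -/
def psdo1 (a : ℝ → ℝ → ℂ) (u : ℝ → ℂ) (x : ℝ) : ℂ :=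
  (((2 * Real.pi)⁻¹ : ℝ) : ℂ) *
    ∫ ξ : ℝ, Complex.exp (Complex.I * (x:ℂ) * (ξ:ℂ)) * a x ξ *
      ∫ y : ℝ, Complex.exp (-Complex.I * (y:ℂ) * (ξ:ℂ)) * u y

section

open Filter Topology Set

/-- Uniform symbol estimates of order up to `n` for a family `f` of functions of one real variable:
the `j`-th derivative is bounded by a constant multiple of `w * g ^ j`. -/
def SymUpTo {ι A : Type*} [NormedCommRing A] [NormedAlgebra ℝ A] (n : ℕ) (g w : ι → ℝ → ℝ)
    (f : ι → ℝ → A) : Prop :=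
  (∀ i, ContDiff ℝ n (f i)) ∧
    ∀ j ≤ n, ∃ C : ℝ, 0 ≤ C ∧ ∀ i x, ‖iteratedDeriv j (f i) x‖ ≤ C * (w i x * g i x ^ j)

/-- Uniform symbol estimates of every order. -/
def SymEst {ι A : Type*} [NormedCommRing A] [NormedAlgebra ℝ A] (g w : ι → ℝ → ℝ)
    (f : ι → ℝ → A) : Prop :=
  ∀ n, SymUpTo n g w f

section SymbolClasses

variable {ι κ A : Type*} [NormedCommRing A] [NormedAlgebra ℝ A] {n : ℕ} {g w w' : ι → ℝ → ℝ}
  {f f' : ι → ℝ → A}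

theorem SymUpTo.mul (hf : SymUpTo n g w f) (hf' : SymUpTo n g w' f') :
    SymUpTo n g (fun i x => w i x * w' i x) (fun i x => f i x * f' i x) := by
  refine ⟨fun i => (hf.1 i).mul (hf'.1 i), fun j hj => ?_⟩
  have h1 : ∀ l : ℕ, ∃ C : ℝ, 0 ≤ C ∧ (l ≤ n → ∀ i x,
      ‖iteratedDeriv l (f i) x‖ ≤ C * (w i x * g i x ^ l)) := by
    intro l
    by_cases hl : l ≤ n
    · obtain ⟨C, h0, hC⟩ := hf.2 l hl
      exact ⟨C, h0, fun _ => hC⟩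
    · exact ⟨0, le_rfl, fun h => absurd h hl⟩
  have h2 : ∀ l : ℕ, ∃ C : ℝ, 0 ≤ C ∧ (l ≤ n → ∀ i x,
      ‖iteratedDeriv l (f' i) x‖ ≤ C * (w' i x * g i x ^ l)) := by
    intro l
    by_cases hl : l ≤ n
    · obtain ⟨C, h0, hC⟩ := hf'.2 l hl
      exact ⟨C, h0, fun _ => hC⟩
    · exact ⟨0, le_rfl, fun h => absurd h hl⟩
  choose C hC0 hC using h1
  choose D hD0 hD using h2
  refine ⟨∑ l ∈ Finset.range (j + 1), (j.choose l : ℝ) * C l * D (j - l),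
    Finset.sum_nonneg fun l _ => mul_nonneg (mul_nonneg (Nat.cast_nonneg _) (hC0 l)) (hD0 _),
    fun i x => ?_⟩
  rw [← norm_iteratedFDeriv_eq_norm_iteratedDeriv]
  refine (norm_iteratedFDeriv_mul_le (N := (n : WithTop ℕ∞)) (hf.1 i) (hf'.1 i) x
    (by exact_mod_cast hj)).trans ?_
  rw [Finset.sum_mul]
  refine Finset.sum_le_sum fun l hl => ?_
  have hlj : l ≤ j := by
    have := Finset.mem_range.1 hl
    omega
  rw [norm_iteratedFDeriv_eq_norm_iteratedDeriv, norm_iteratedFDeriv_eq_norm_iteratedDeriv]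
  have e1 := hC l (hlj.trans hj) i x
  have e2 := hD (j - l) ((Nat.sub_le _ _).trans hj) i x
  have e3 := mul_le_mul e1 e2 (norm_nonneg _) ((norm_nonneg _).trans e1)
  have e4 : g i x ^ j = g i x ^ l * g i x ^ (j - l) := by
    rw [← pow_add]
    congr 1
    omega
  calc (j.choose l : ℝ) * ‖iteratedDeriv l (f i) x‖ * ‖iteratedDeriv (j - l) (f' i) x‖
      = (j.choose l : ℝ) * (‖iteratedDeriv l (f i) x‖ * ‖iteratedDeriv (j - l) (f' i) x‖) := by
        ring
    _ ≤ (j.choose l : ℝ) * (C l * (w i x * g i x ^ l) * (D (j - l) * (w' i x * g i x ^ (j - l)))) :=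
        mul_le_mul_of_nonneg_left e3 (Nat.cast_nonneg _)
    _ = _ := by
        rw [e4]
        ring

theorem SymUpTo.add (hf : SymUpTo n g w f) (hf' : SymUpTo n g w f') :
    SymUpTo n g w (fun i x => f i x + f' i x) := by
  refine ⟨fun i => (hf.1 i).add (hf'.1 i), fun j hj => ?_⟩
  obtain ⟨C, hC0, hC⟩ := hf.2 j hj
  obtain ⟨D, hD0, hD⟩ := hf'.2 j hj
  refine ⟨C + D, add_nonneg hC0 hD0, fun i x => ?_⟩
  have hj' : (j : WithTop ℕ∞) ≤ n := by exact_mod_cast hj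
  have : iteratedDeriv j (fun x => f i x + f' i x) x
      = iteratedDeriv j (f i) x + iteratedDeriv j (f' i) x :=
    iteratedDeriv_fun_add (((hf.1 i).of_le hj').contDiffAt) (((hf'.1 i).of_le hj').contDiffAt)
  rw [this, add_mul]
  exact (norm_add_le _ _).trans (add_le_add (hC i x) (hD i x))

theorem SymUpTo.const_mul (hf : SymUpTo n g w f) (c : A) :
    SymUpTo n g w (fun i x => c * f i x) := by
  refine ⟨fun i => contDiff_const.mul (hf.1 i), fun j hj => ?_⟩
  obtain ⟨C, hC0, hC⟩ := hf.2 j hj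
  have hj' : (j : WithTop ℕ∞) ≤ n := by exact_mod_cast hj
  refine ⟨‖c‖ * C, mul_nonneg (norm_nonneg _) hC0, fun i x => ?_⟩
  have : iteratedDeriv j (fun x => c * f i x) x = c * iteratedDeriv j (f i) x :=
    iteratedDeriv_const_mul c (((hf.1 i).of_le hj').contDiffAt)
  rw [this, mul_assoc]
  exact (norm_mul_le _ _).trans (mul_le_mul_of_nonneg_left (hC i x) (norm_nonneg _))

theorem SymUpTo.mono_weight {K : ℝ} (hf : SymUpTo n g w f) (hK : 0 ≤ K) (hg : ∀ i x, 0 ≤ g i x)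
    (hw : ∀ i x, w i x ≤ K * w' i x) : SymUpTo n g w' f := by
  refine ⟨hf.1, fun j hj => ?_⟩
  obtain ⟨C, hC0, hC⟩ := hf.2 j hj
  refine ⟨C * K, mul_nonneg hC0 hK, fun i x => (hC i x).trans ?_⟩
  rw [mul_assoc, ← mul_assoc K]
  exact mul_le_mul_of_nonneg_left
    (mul_le_mul_of_nonneg_right (hw i x) (pow_nonneg (hg i x) _)) hC0

theorem SymUpTo.mono_gain {g' : ι → ℝ → ℝ} (hf : SymUpTo n g w f) (hg : ∀ i x, 0 ≤ g i x)
    (hw : ∀ i x, 0 ≤ w i x) (hgg : ∀ i x, g i x ≤ g' i x) : SymUpTo n g' w f := by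
  refine ⟨hf.1, fun j hj => ?_⟩
  obtain ⟨C, hC0, hC⟩ := hf.2 j hj
  refine ⟨C, hC0, fun i x => (hC i x).trans ?_⟩
  exact mul_le_mul_of_nonneg_left (mul_le_mul_of_nonneg_left
    (pow_le_pow_left₀ (hg i x) (hgg i x) _) (hw i x)) hC0

theorem SymUpTo.reindex (hf : SymUpTo n g w f) (φ : κ → ι) :
    SymUpTo n (fun i => g (φ i)) (fun i => w (φ i)) (fun i => f (φ i)) :=
  ⟨fun i => hf.1 (φ i), fun j hj => by
    obtain ⟨C, hC0, hC⟩ := hf.2 j hj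
    exact ⟨C, hC0, fun i => hC (φ i)⟩⟩

theorem SymUpTo.bound (hf : SymUpTo n g w f) : ∃ C : ℝ, 0 ≤ C ∧ ∀ i x, ‖f i x‖ ≤ C * w i x := by
  obtain ⟨C, hC0, hC⟩ := hf.2 0 (Nat.zero_le _)
  exact ⟨C, hC0, fun i x => by simpa using hC i x⟩

theorem symUpTo_zero {C : ℝ} (hc : ∀ i, Continuous (f i)) (hC0 : 0 ≤ C)
    (hC : ∀ i x, ‖f i x‖ ≤ C * w i x) : SymUpTo 0 g w f := by
  refine ⟨fun i => contDiff_zero.2 (hc i), fun j hj => ⟨C, hC0, fun i x => ?_⟩⟩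
  obtain rfl : j = 0 := by omega
  simpa using hC i x

theorem symUpTo_succ {C : ℝ} (hC0 : 0 ≤ C) (hC : ∀ i x, ‖f i x‖ ≤ C * w i x)
    (hd : ∀ i x, HasDerivAt (f i) (f' i x) x)
    (hf' : SymUpTo n g (fun i x => w i x * g i x) f') : SymUpTo (n + 1) g w f := by
  have hde : ∀ i, deriv (f i) = f' i := fun i => funext fun x => (hd i x).deriv
  refine ⟨fun i => ?_, fun j hj => ?_⟩
  · have : ((n + 1 : ℕ) : WithTop ℕ∞) = (n : WithTop ℕ∞) + 1 := by push_cast; rfl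
    rw [this, contDiff_succ_iff_deriv]
    refine ⟨fun x => (hd i x).differentiableAt, fun h => ?_, ?_⟩
    · exact absurd h (by simp)
    · rw [hde]
      exact hf'.1 i
  · rcases j with _ | j
    · exact ⟨C, hC0, fun i x => by simpa using hC i x⟩
    · obtain ⟨D, hD0, hD⟩ := hf'.2 j (by omega)
      refine ⟨D, hD0, fun i x => ?_⟩
      rw [iteratedDeriv_succ', hde]
      refine (hD i x).trans (le_of_eq ?_)
      ring

theorem SymUpTo.deriv (hf : SymUpTo (n + 1) g w f) :
    SymUpTo n g (fun i x => w i x * g i x) (fun i => deriv (f i)) := by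
  refine ⟨fun i => ?_, fun j hj => ?_⟩
  · have h := hf.1 i
    have : ((n + 1 : ℕ) : WithTop ℕ∞) = (n : WithTop ℕ∞) + 1 := by push_cast; rfl
    rw [this, contDiff_succ_iff_deriv] at h
    exact h.2.2
  · obtain ⟨D, hD0, hD⟩ := hf.2 (j + 1) (by omega)
    refine ⟨D, hD0, fun i x => ?_⟩
    rw [← iteratedDeriv_succ']
    refine (hD i x).trans (le_of_eq ?_)
    ring

/-- A sequence of families, each of which differentiates to a multiple of the next one, consists of
symbols. -/
theorem sym_of_chain {f e : ℕ → ι → ℝ → A} {C : ℕ → ℝ} (hC0 : ∀ j, 0 ≤ C j)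
    (hC : ∀ j i x, ‖f j i x‖ ≤ C j * w i x)
    (hd : ∀ j i x, HasDerivAt (f j i) (f (j + 1) i x * e j i x) x)
    (he : ∀ j, SymEst g g (e j)) (j : ℕ) : SymEst g w (f j) := by
  intro n
  induction n generalizing j with
  | zero =>
    exact symUpTo_zero (fun i => continuous_iff_continuousAt.2 fun x => (hd j i x).continuousAt)
      (hC0 j) (hC j)
  | succ n ih => exact symUpTo_succ (hC0 j) (hC j) (hd j) ((ih (j + 1)).mul (he j n))

theorem SymEst.bound (hf : SymEst g w f) : ∃ C : ℝ, 0 ≤ C ∧ ∀ i x, ‖f i x‖ ≤ C * w i x :=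
  (hf 0).bound

theorem SymEst.mul (hf : SymEst g w f) (hf' : SymEst g w' f') :
    SymEst g (fun i x => w i x * w' i x) (fun i x => f i x * f' i x) :=
  fun n => (hf n).mul (hf' n)

theorem SymEst.add (hf : SymEst g w f) (hf' : SymEst g w f') : SymEst g w (fun i x => f i x + f' i x) :=
  fun n => (hf n).add (hf' n)

theorem SymEst.const_mul (hf : SymEst g w f) (c : A) : SymEst g w (fun i x => c * f i x) :=
  fun n => (hf n).const_mul c

theorem SymEst.deriv (hf : SymEst g w f) : SymEst g (fun i x => w i x * g i x) (fun i => deriv (f i)) :=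
  fun n => (hf (n + 1)).deriv

theorem SymEst.reindex (hf : SymEst g w f) (φ : κ → ι) :
    SymEst (fun i => g (φ i)) (fun i => w (φ i)) (fun i => f (φ i)) :=
  fun n => (hf n).reindex φ

theorem SymEst.mono_weight {K : ℝ} (hf : SymEst g w f) (hK : 0 ≤ K) (hg : ∀ i x, 0 ≤ g i x)
    (hw : ∀ i x, w i x ≤ K * w' i x) : SymEst g w' f :=
  fun n => (hf n).mono_weight hK hg hw

theorem SymEst.mono_gain {g' : ι → ℝ → ℝ} (hf : SymEst g w f) (hg : ∀ i x, 0 ≤ g i x)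
    (hw : ∀ i x, 0 ≤ w i x) (hgg : ∀ i x, g i x ≤ g' i x) : SymEst g' w f :=
  fun n => (hf n).mono_gain hg hw hgg

theorem SymEst.contDiff (hf : SymEst g w f) (i : ι) : ContDiff ℝ (⊤ : ℕ∞) (f i) :=
  contDiff_infty.2 fun n => (hf n).1 i

theorem SymEst.hasDerivAt (hf : SymEst g w f) (i : ι) (x : ℝ) :
    HasDerivAt (f i) (_root_.deriv (f i) x) x :=
  (((hf 1).1 i).differentiable (by simp) x).hasDerivAt

/-- The exponential of a symbol of order zero is a symbol of order zero. -/
theorem SymEst.exp {f : ι → ℝ → ℝ} (hf : SymEst g (fun _ _ => 1) f) :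
    SymEst g (fun _ _ => 1) (fun i x => Real.exp (f i x)) := by
  obtain ⟨C, hC0, hC⟩ := hf.bound
  have hb : ∀ i x, ‖Real.exp (f i x)‖ ≤ Real.exp C * 1 := fun i x => by
    rw [Real.norm_eq_abs, Real.abs_exp, mul_one]
    exact Real.exp_le_exp.2 ((le_abs_self _).trans (by simpa using hC i x))
  intro n
  induction n with
  | zero =>
    exact symUpTo_zero (fun i => Real.continuous_exp.comp (hf.contDiff i).continuous)
      (Real.exp_pos C).le hb
  | succ n ih =>
    refine symUpTo_succ (Real.exp_pos C).le hb (fun i x => (hf.hasDerivAt i x).exp) ?_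
    have := ih.mul (hf.deriv n)
    simpa using this

theorem SymEst.ofReal {f : ι → ℝ → ℝ} (hf : SymEst g w f) :
    SymEst g w (fun i x => (f i x : ℂ)) := by
  have key : ∀ i j x, iteratedDeriv j (fun x => (f i x : ℂ)) x =
      ((iteratedDeriv j (f i) x : ℝ) : ℂ) := by
    intro i j
    induction j with
    | zero => intro x; simp
    | succ j ih =>
      intro x
      rw [iteratedDeriv_succ, iteratedDeriv_succ, funext ih]
      exact ((((hf (j + 1)).1 i).differentiable_iteratedDeriv j
        (by exact_mod_cast Nat.lt_succ_self j) x).hasDerivAt.ofReal_comp).deriv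
  intro n
  refine ⟨fun i => Complex.ofRealCLM.contDiff.comp ((hf n).1 i), fun j hj => ?_⟩
  obtain ⟨C, hC0, hC⟩ := (hf n).2 j hj
  exact ⟨C, hC0, fun i x => by rw [key, Complex.norm_real]; exact hC i x⟩

end SymbolClasses

/-- Rapid decay of a function of one real variable, without any condition on its derivatives. -/
def RapidDecay (w : ℝ → ℂ) : Prop :=
  ∀ N : ℕ, ∃ C : ℝ, ∀ x, (1 + |x|) ^ N * ‖w x‖ ≤ C

theorem one_add_sq_le_one_add_abs_sq (x : ℝ) : 1 + x ^ 2 ≤ (1 + |x|) ^ 2 := by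
  nlinarith [abs_nonneg x, sq_abs x]

theorem RapidDecay.norm_le {w : ℝ → ℂ} (hw : RapidDecay w) (N : ℕ) :
    ∃ C : ℝ, 0 ≤ C ∧ ∀ x, (1 + |x|) ^ N * ‖w x‖ ≤ C * (1 + x ^ 2)⁻¹ := by
  obtain ⟨C, hC⟩ := hw (N + 2)
  refine ⟨C, le_trans (by positivity) (hC 0), fun x => ?_⟩
  rw [← div_eq_mul_inv, le_div_iff₀ (by positivity)]
  refine le_trans ?_ (hC x)
  rw [pow_add]
  calc (1 + |x|) ^ N * ‖w x‖ * (1 + x ^ 2)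
      ≤ (1 + |x|) ^ N * ‖w x‖ * (1 + |x|) ^ 2 :=
        mul_le_mul_of_nonneg_left (one_add_sq_le_one_add_abs_sq x) (by positivity)
    _ = _ := by ring

theorem RapidDecay.integrable {w : ℝ → ℂ} (hw : RapidDecay w) (hc : Continuous w) :
    Integrable w := by
  obtain ⟨C, -, hC⟩ := hw.norm_le 0
  refine (integrable_inv_one_add_sq.const_mul C).mono' hc.aestronglyMeasurable
    (Eventually.of_forall fun x => ?_)
  simpa using hC x

theorem RapidDecay.mul_ofReal {w : ℝ → ℂ} (hw : RapidDecay w) (z : ℂ) :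
    RapidDecay (fun x => z * x * w x) := by
  intro N
  obtain ⟨C, hC⟩ := hw (N + 1)
  refine ⟨‖z‖ * C, fun x => ?_⟩
  rw [norm_mul, norm_mul, Complex.norm_real, Real.norm_eq_abs]
  calc (1 + |x|) ^ N * (‖z‖ * |x| * ‖w x‖) ≤ (1 + |x|) ^ N * (‖z‖ * (1 + |x|) * ‖w x‖) := by
        gcongr
        linarith
    _ = ‖z‖ * ((1 + |x|) ^ (N + 1) * ‖w x‖) := by ring
    _ ≤ _ := mul_le_mul_of_nonneg_left (hC x) (norm_nonneg _)

theorem one_add_abs_pow_le (x : ℝ) (N : ℕ) : (1 + |x|) ^ N ≤ 2 ^ N * (|x| ^ N + 1) := by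
  rcases le_total |x| 1 with h | h
  · calc (1 + |x|) ^ N ≤ 2 ^ N := pow_le_pow_left₀ (by positivity) (by linarith) _
      _ ≤ _ := le_mul_of_one_le_right (by positivity) (by linarith [pow_nonneg (abs_nonneg x) N])
  · calc (1 + |x|) ^ N ≤ (2 * |x|) ^ N := pow_le_pow_left₀ (by positivity) (by linarith) _
      _ = 2 ^ N * |x| ^ N := mul_pow _ _ _
      _ ≤ _ := mul_le_mul_of_nonneg_left (by linarith) (by positivity)

theorem SchwartzMap.rapidDecay (u : SchwartzMap ℝ ℂ) : RapidDecay u := by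
  intro N
  obtain ⟨C, -, hC⟩ := u.decay N 0
  obtain ⟨D, -, hD⟩ := u.decay 0 0
  refine ⟨2 ^ N * (C + D), fun x => ?_⟩
  have h1 : |x| ^ N * ‖u x‖ ≤ C := by simpa using hC x
  have h2 : ‖u x‖ ≤ D := by simpa using hD x
  have h3 := one_add_abs_pow_le x N
  calc (1 + |x|) ^ N * ‖u x‖ ≤ 2 ^ N * (|x| ^ N + 1) * ‖u x‖ :=
        mul_le_mul_of_nonneg_right h3 (norm_nonneg _)
    _ = 2 ^ N * (|x| ^ N * ‖u x‖ + ‖u x‖) := by ring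
    _ ≤ _ := mul_le_mul_of_nonneg_left (add_le_add h1 h2) (by positivity)

/-- If `f` decays rapidly and `f''` is bounded, then `f'` decays rapidly. -/
theorem RapidDecay.deriv_of_bounded {f : ℝ → ℂ} (hf : RapidDecay f) (h1 : Differentiable ℝ f)
    (h2 : Differentiable ℝ (deriv f)) {M : ℝ} (hM : ∀ x, ‖deriv (deriv f) x‖ ≤ M) :
    RapidDecay (deriv f) := by
  have hM0 : 0 ≤ M := (norm_nonneg _).trans (hM 0)
  intro N
  obtain ⟨C, hC⟩ := hf (2 * N)
  have hC0 : 0 ≤ C := le_trans (by positivity) (hC 0)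
  refine ⟨(2 ^ (2 * N) * C + C) + M, fun x => ?_⟩
  set X : ℝ := 1 + |x| with hX
  have hX1 : 1 ≤ X := by linarith [abs_nonneg x]
  have hXN : 1 ≤ X ^ N := one_le_pow₀ hX1
  set δ : ℝ := (X ^ N)⁻¹ with hδ
  have hδ0 : 0 < δ := by positivity
  have hδ1 : δ ≤ 1 := inv_le_one_of_one_le₀ hXN
  have hXδ : X ^ N * δ = 1 := mul_inv_cancel₀ (by positivity)
  have hlip : ∀ t ∈ Icc x (x + δ), ‖deriv f t - deriv f x‖ ≤ M * δ := by
    intro t ht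
    have := Convex.norm_image_sub_le_of_norm_deriv_le (𝕜 := ℝ) (s := univ) (f := deriv f)
      (fun y _ => h2 y) (fun y _ => hM y) convex_univ (mem_univ x) (mem_univ t)
    refine this.trans (mul_le_mul_of_nonneg_left ?_ hM0)
    rw [Real.norm_eq_abs, abs_of_nonneg (by linarith [ht.1])]
    linarith [ht.2]
  have htay : ‖(f (x + δ) - (x + δ) • deriv f x) - (f x - x • deriv f x)‖ ≤ M * δ * ‖x + δ - x‖ := by
    have hd : ∀ y, HasDerivAt (fun y : ℝ => f y - y • deriv f x) (deriv f y - deriv f x) y := by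
      intro y
      have := (h1 y).hasDerivAt.fun_sub ((hasDerivAt_id' y).smul_const (deriv f x))
      simpa using this
    exact Convex.norm_image_sub_le_of_norm_hasDerivWithin_le (s := Icc x (x + δ))
      (fun y _ => (hd y).hasDerivWithinAt) hlip (convex_Icc _ _)
      (left_mem_Icc.2 (by linarith)) (right_mem_Icc.2 (by linarith))
  have e1 : δ * ‖deriv f x‖ ≤ ‖f (x + δ)‖ + ‖f x‖ + M * δ * δ := by
    have e : δ • deriv f x = (f (x + δ) - f x) -
        ((f (x + δ) - (x + δ) • deriv f x) - (f x - x • deriv f x)) := by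
      rw [add_smul]
      abel
    have e' : δ * ‖deriv f x‖ = ‖δ • deriv f x‖ := by
      rw [norm_smul, Real.norm_eq_abs, abs_of_pos hδ0]
    rw [e', e]
    refine (norm_sub_le _ _).trans (add_le_add (norm_sub_le _ _) (htay.trans (le_of_eq ?_)))
    rw [add_sub_cancel_left, Real.norm_eq_abs, abs_of_pos hδ0]
  have e2 : X ^ (2 * N) * ‖f (x + δ)‖ ≤ 2 ^ (2 * N) * C := by
    have hX2 : X ≤ 2 * (1 + |x + δ|) := by
      have := abs_sub_abs_le_abs_sub x (x + δ)
      rw [show x - (x + δ) = -δ by ring, abs_neg, abs_of_pos hδ0] at this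
      linarith [abs_nonneg (x + δ)]
    calc X ^ (2 * N) * ‖f (x + δ)‖ ≤ (2 * (1 + |x + δ|)) ^ (2 * N) * ‖f (x + δ)‖ := by gcongr
      _ = 2 ^ (2 * N) * ((1 + |x + δ|) ^ (2 * N) * ‖f (x + δ)‖) := by rw [mul_pow]; ring
      _ ≤ _ := mul_le_mul_of_nonneg_left (hC _) (by positivity)
  have e3 : X ^ (2 * N) = X ^ N * X ^ N := by rw [two_mul, pow_add]
  calc X ^ N * ‖deriv f x‖ = X ^ N * X ^ N * (δ * ‖deriv f x‖) := by
        linear_combination (-(X ^ N * ‖deriv f x‖)) * hXδ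
    _ ≤ X ^ N * X ^ N * (‖f (x + δ)‖ + ‖f x‖ + M * δ * δ) :=
        mul_le_mul_of_nonneg_left e1 (by positivity)
    _ = (X ^ (2 * N) * ‖f (x + δ)‖ + X ^ (2 * N) * ‖f x‖) + M * (X ^ N * δ) * (X ^ N * δ) := by
        rw [e3]; ring
    _ ≤ _ := by
        rw [hXδ, mul_one, mul_one]
        exact add_le_add (add_le_add e2 (hC x)) le_rfl

theorem rapidDecay_iteratedDeriv {f : ℝ → ℂ} (hf : RapidDecay f) (hs : ContDiff ℝ (⊤ : ℕ∞) f)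
    (hb : ∀ n, ∃ C : ℝ, ∀ x, ‖iteratedDeriv n f x‖ ≤ C) (n : ℕ) :
    RapidDecay (iteratedDeriv n f) := by
  induction n with
  | zero => simpa using hf
  | succ n ih =>
    have hd : ∀ j, Differentiable ℝ (iteratedDeriv j f) := fun j =>
      hs.differentiable_iteratedDeriv j (by exact_mod_cast WithTop.coe_lt_top j)
    obtain ⟨M, hM⟩ := hb (n + 2)
    rw [iteratedDeriv_succ]
    refine ih.deriv_of_bounded (hd n) ?_ (M := M) fun x => ?_
    · rw [← iteratedDeriv_succ]
      exact hd _
    · rw [← iteratedDeriv_succ, ← iteratedDeriv_succ]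
      exact hM x

/-- A rapidly decaying smooth function with bounded derivatives is a Schwartz function. -/
def schwartzOfRapidDecay (f : ℝ → ℂ) (hf : RapidDecay f) (hs : ContDiff ℝ (⊤ : ℕ∞) f)
    (hb : ∀ n, ∃ C : ℝ, ∀ x, ‖iteratedDeriv n f x‖ ≤ C) : SchwartzMap ℝ ℂ where
  toFun := f
  smooth' := hs
  decay' := fun k n => by
    obtain ⟨C, hC⟩ := rapidDecay_iteratedDeriv hf hs hb n k
    refine ⟨C, fun x => le_trans ?_ (hC x)⟩
    rw [norm_iteratedFDeriv_eq_norm_iteratedDeriv, Real.norm_eq_abs]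
    gcongr
    linarith

/-- The unimodular phase `exp (i t)`. -/
def phase (t : ℝ) : ℂ := Complex.exp (t * Complex.I)

theorem norm_phase (t : ℝ) : ‖phase t‖ = 1 := Complex.norm_exp_ofReal_mul_I t

theorem continuous_phase : Continuous phase := by
  unfold phase
  fun_prop

theorem phase_add (s t : ℝ) : phase (s + t) = phase s * phase t := by
  simp [phase, add_mul, Complex.exp_add]

theorem hasDerivAt_phase (t x : ℝ) :
    HasDerivAt (fun x => phase (t * x)) (t * Complex.I * phase (t * x)) x := by
  have h : HasDerivAt (fun x : ℝ => ((t * x : ℝ) : ℂ) * Complex.I) (((t * 1 : ℝ) : ℂ) * Complex.I) x :=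
    (((hasDerivAt_id x).const_mul t).ofReal_comp).mul_const Complex.I
  have := h.cexp
  unfold phase
  convert this using 1
  push_cast
  ring

/-- Repeated integration by parts in a Fourier integral. -/
theorem abs_pow_mul_norm_integral_phase_le (t : ℝ) (N : ℕ) {f : ℝ → ℂ} (hf : ContDiff ℝ N f)
    (hi : ∀ j ≤ N, Integrable (iteratedDeriv j f)) :
    |t| ^ N * ‖∫ b, phase (t * b) * f b‖ ≤ ∫ b, ‖iteratedDeriv N f b‖ := by
  induction N generalizing f with
  | zero =>
    simp only [pow_zero, one_mul, iteratedDeriv_zero]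
    refine (norm_integral_le_integral_norm _).trans (le_of_eq ?_)
    simp [norm_phase]
  | succ N ih =>
    have hsucc : ((N + 1 : ℕ) : WithTop ℕ∞) = (N : WithTop ℕ∞) + 1 := by push_cast; rfl
    rw [hsucc, contDiff_succ_iff_deriv] at hf
    have hmul : ∀ g : ℝ → ℂ, Integrable g → Integrable (fun b => phase (t * b) * g b) := by
      intro g hg
      refine hg.bdd_mul (c := 1)
        (continuous_phase.comp (by fun_prop : Continuous fun b => t * b)).aestronglyMeasurable ?_
      exact Eventually.of_forall fun b => (norm_phase _).le
    have h0 : Integrable f := by simpa using hi 0 (Nat.zero_le _)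
    have h1 : Integrable (deriv f) := by simpa [iteratedDeriv_one] using hi 1 (by omega)
    have ibp : ∫ b, phase (t * b) * deriv f b = -∫ b, t * Complex.I * phase (t * b) * f b := by
      refine integral_mul_deriv_eq_deriv_mul_of_integrable (fun x _ => hasDerivAt_phase t x)
        (fun x _ => (hf.1 x).hasDerivAt) (hmul _ h1) ?_ (hmul _ h0)
      have := (hmul _ h0).const_mul ((t : ℂ) * Complex.I)
      refine this.congr (Eventually.of_forall fun b => ?_)
      simp only [Pi.mul_apply]
      ring
    have e : |t| * ‖∫ b, phase (t * b) * f b‖ = ‖∫ b, phase (t * b) * deriv f b‖ := by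
      rw [ibp, norm_neg]
      simp_rw [mul_assoc]
      rw [integral_const_mul, integral_const_mul, norm_mul, norm_mul, Complex.norm_I,
        Complex.norm_real, Real.norm_eq_abs, one_mul]
    have := ih (f := deriv f) hf.2.2 (fun j hj => by
      rw [← iteratedDeriv_succ']
      exact hi (j + 1) (by omega))
    rw [← iteratedDeriv_succ'] at this
    calc |t| ^ (N + 1) * ‖∫ b, phase (t * b) * f b‖
        = |t| ^ N * (|t| * ‖∫ b, phase (t * b) * f b‖) := by ring
      _ ≤ _ := by rw [e]; exact this

/-- The oscillatory integral operator with phase `s a b` and amplitude `c`. -/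
def osc (s : ℝ) (c : ℝ → ℝ → ℂ) (w : ℝ → ℂ) (a : ℝ) : ℂ :=
  ∫ b, phase (s * a * b) * (c a b * w b)

theorem integrable_osc (s : ℝ) {c : ℝ → ℝ → ℂ} {C : ℝ} (hC : ∀ a b, ‖c a b‖ ≤ C)
    (hm : ∀ a, Measurable (c a)) {w : ℝ → ℂ} (hw : Integrable w) (a : ℝ) :
    Integrable (fun b => phase (s * a * b) * (c a b * w b)) := by
  have h1 : Integrable (fun b => c a b * w b) :=
    hw.bdd_mul (hm a).aestronglyMeasurable (Eventually.of_forall (hC a))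
  refine h1.bdd_mul (c := 1)
    (continuous_phase.comp (by fun_prop : Continuous fun b => s * a * b)).aestronglyMeasurable ?_
  exact Eventually.of_forall fun b => (norm_phase _).le

theorem norm_osc_le (s : ℝ) {c : ℝ → ℝ → ℂ} {C : ℝ} (hC : ∀ a b, ‖c a b‖ ≤ C)
    {w : ℝ → ℂ} (hw : Integrable w) (a : ℝ) : ‖osc s c w a‖ ≤ C * ∫ b, ‖w b‖ := by
  rw [← integral_const_mul]
  refine norm_integral_le_of_norm_le (hw.norm.const_mul C) (Eventually.of_forall fun b => ?_)
  rw [norm_mul, norm_phase, one_mul, norm_mul]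
  exact mul_le_mul_of_nonneg_right (hC a b) (norm_nonneg _)

theorem measurable_deriv_of_param {c : ℝ → ℝ → ℂ} (hm : ∀ a, Measurable (c a))
    (hd : ∀ a b, DifferentiableAt ℝ (fun a => c a b) a) (a : ℝ) :
    Measurable (fun b => deriv (fun a => c a b) a) := by
  refine measurable_of_tendsto_metrizable
    (f := fun (n : ℕ) b => ((1 / ((n : ℝ) + 1))⁻¹ : ℝ) • (c (a + 1 / ((n : ℝ) + 1)) b - c a b))
    (fun n => ?_) ?_
  · exact ((hm _).sub (hm _)).const_smul ((1 / ((n : ℝ) + 1))⁻¹ : ℝ)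
  rw [tendsto_pi_nhds]
  intro b
  have h := (hd a b).hasDerivAt.tendsto_slope_zero
  refine h.comp (tendsto_nhdsWithin_iff.2 ⟨tendsto_one_div_add_atTop_nhds_zero_nat, ?_⟩)
  exact Eventually.of_forall fun n => (by positivity : (0 : ℝ) < 1 / ((n : ℝ) + 1)).ne'

theorem hasDerivAt_osc (s : ℝ) {c : ℝ → ℝ → ℂ}
    (hc : SymEst (fun _ _ => 1) (fun _ _ => 1) (fun b a => c a b)) (hm : ∀ a, Measurable (c a))
    {w : ℝ → ℂ} (hw : RapidDecay w) (hwc : Continuous w) (a : ℝ) :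
    HasDerivAt (osc s c w) (osc s c (fun b => (s * Complex.I) * b * w b) a +
      osc s (fun a b => deriv (fun a => c a b) a) w a) a := by
  obtain ⟨C, hC0, hC⟩ := hc.bound
  obtain ⟨D, hD0, hD⟩ := hc.deriv.bound
  simp only [mul_one] at hC hD
  have hm' := measurable_deriv_of_param hm fun a b => (hc.hasDerivAt b a).differentiableAt
  have hwi := hw.integrable hwc
  have hw' := hw.mul_ofReal (s * Complex.I)
  have hwc' : Continuous (fun b : ℝ => (s * Complex.I) * (b : ℂ) * w b) := by fun_prop
  have hwi' := hw'.integrable hwc'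
  unfold osc
  rw [← integral_add (integrable_osc s (fun a b => hC b a) hm hwi' a)
    (integrable_osc s (fun a b => hD b a) hm' hwi a)]
  refine (hasDerivAt_integral_of_dominated_loc_of_deriv_le (s := univ)
    (F := fun a b => phase (s * a * b) * (c a b * w b))
    (F' := fun a b => phase (s * a * b) * (c a b * ((s * Complex.I) * b * w b)) +
      phase (s * a * b) * (deriv (fun a => c a b) a * w b))
    (bound := fun b => C * ‖(s * Complex.I) * b * w b‖ + D * ‖w b‖) univ_mem ?_ ?_ ?_ ?_ ?_ ?_).2
  · exact Eventually.of_forall fun a =>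
      (integrable_osc s (fun a b => hC b a) hm hwi a).aestronglyMeasurable
  · exact integrable_osc s (fun a b => hC b a) hm hwi a
  · exact ((integrable_osc s (fun a b => hC b a) hm hwi' a).add
      (integrable_osc s (fun a b => hD b a) hm' hwi a)).aestronglyMeasurable
  · refine Eventually.of_forall fun b x _ => (norm_add_le _ _).trans (add_le_add ?_ ?_)
    · rw [norm_mul, norm_phase, one_mul, norm_mul]
      exact mul_le_mul_of_nonneg_right (hC b x) (norm_nonneg _)
    · rw [norm_mul, norm_phase, one_mul, norm_mul]
      exact mul_le_mul_of_nonneg_right (hD b x) (norm_nonneg _)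
  · exact (hwi'.norm.const_mul C).add (hwi.norm.const_mul D)
  · refine Eventually.of_forall fun b x _ => ?_
    have h1 : HasDerivAt (fun a => phase (s * a * b)) ((s * b : ℝ) * Complex.I * phase (s * x * b)) x := by
      have := hasDerivAt_phase (s * b) x
      simp only [show ∀ y, s * b * y = s * y * b from fun y => by ring] at this
      exact this
    refine (h1.fun_mul ((hc.hasDerivAt b x).mul_const (w b))).congr_deriv ?_
    push_cast
    ring

/-- Oscillatory integrals of rapidly decaying functions are smooth with bounded derivatives. -/
theorem symUpTo_osc (s : ℝ) (n : ℕ) {c : ℝ → ℝ → ℂ}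
    (hc : SymEst (fun _ _ => 1) (fun _ _ => 1) (fun b a => c a b)) (hm : ∀ a, Measurable (c a))
    {w : ℝ → ℂ} (hw : RapidDecay w) (hwc : Continuous w) :
    SymUpTo n (fun _ _ => 1) (fun _ _ => 1) (fun _ : Unit => osc s c w) := by
  induction n generalizing c w with
  | zero =>
    obtain ⟨C, hC0, hC⟩ := hc.bound
    simp only [mul_one] at hC
    refine symUpTo_zero (C := C * ∫ b, ‖w b‖) (fun _ => continuous_iff_continuousAt.2 fun a =>
      (hasDerivAt_osc s hc hm hw hwc a).continuousAt) (by positivity) fun _ a => ?_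
    rw [mul_one]
    exact norm_osc_le s (fun a b => hC b a) (hw.integrable hwc) a
  | succ n ih =>
    obtain ⟨C, hC0, hC⟩ := hc.bound
    simp only [mul_one] at hC
    refine symUpTo_succ (C := C * ∫ b, ‖w b‖) (by positivity) (fun _ a => ?_)
      (fun _ a => hasDerivAt_osc s hc hm hw hwc a) ?_
    · rw [mul_one]
      exact norm_osc_le s (fun a b => hC b a) (hw.integrable hwc) a
    · simp only [mul_one]
      refine (ih hc hm (hw.mul_ofReal _) (by fun_prop)).add (ih ?_ ?_ hw hwc)
      · simpa using hc.deriv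
      · exact measurable_deriv_of_param hm fun a b => (hc.hasDerivAt b a).differentiableAt

/-- Amplitudes all of whose pure derivatives in either variable are bounded. -/
structure IsAmplitude (c : ℝ → ℝ → ℂ) : Prop where
  left : SymEst (fun _ _ => 1) (fun _ _ => 1) (fun b a => c a b)
  right : SymEst (fun _ _ => 1) (fun _ _ => 1) (fun a b => c a b)

namespace IsAmplitude

variable {c : ℝ → ℝ → ℂ}

theorem measurable (hc : IsAmplitude c) (a : ℝ) : Measurable (c a) :=
  (hc.right.contDiff a).continuous.measurable

theorem bound (hc : IsAmplitude c) : ∃ C : ℝ, 0 ≤ C ∧ ∀ a b, ‖c a b‖ ≤ C := by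
  simpa using hc.right.bound

theorem swap (hc : IsAmplitude c) : IsAmplitude (fun b a => c a b) := ⟨hc.right, hc.left⟩

theorem contDiff_osc (hc : IsAmplitude c) (s : ℝ) {w : ℝ → ℂ} (hw : RapidDecay w)
    (hwc : Continuous w) : ContDiff ℝ (⊤ : ℕ∞) (osc s c w) :=
  contDiff_infty.2 fun n => (symUpTo_osc s n hc.left hc.measurable hw hwc).1 ()

theorem iteratedDeriv_osc_bound (hc : IsAmplitude c) (s : ℝ) {w : ℝ → ℂ} (hw : RapidDecay w)
    (hwc : Continuous w) (n : ℕ) : ∃ C : ℝ, ∀ x, ‖iteratedDeriv n (osc s c w) x‖ ≤ C := by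
  obtain ⟨C, -, hC⟩ := (symUpTo_osc s n hc.left hc.measurable hw hwc).2 n le_rfl
  exact ⟨C, fun x => by simpa using hC () x⟩

theorem rapidDecay_osc (hc : IsAmplitude c) {s : ℝ} (hs : |s| = 1) (w : SchwartzMap ℝ ℂ) :
    RapidDecay (osc s c w) := by
  have hw : SymEst (fun _ _ => 1) (fun _ x => (1 + x ^ 2)⁻¹) (fun (_ : ℝ) x => w x) := by
    intro n
    refine ⟨fun _ => (w.smooth ⊤).of_le (by exact_mod_cast le_top), fun j _ => ?_⟩
    obtain ⟨C, hC0, hC⟩ := w.decay 0 j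
    obtain ⟨D, hD0, hD⟩ := w.decay 2 j
    refine ⟨C + D, by positivity, fun _ x => ?_⟩
    have h1 := hC x
    have h2 := hD x
    rw [norm_iteratedFDeriv_eq_norm_iteratedDeriv] at h1 h2
    rw [one_pow, mul_one, ← div_eq_mul_inv, le_div_iff₀ (by positivity)]
    rw [Real.norm_eq_abs, sq_abs] at h2
    rw [pow_zero] at h1
    linarith
  have hcw := hc.right.mul hw
  intro N
  have hmass : ∀ j a, Integrable (iteratedDeriv j (fun b => c a b * w b)) := by
    intro j a
    obtain ⟨C, hC0, hC⟩ := (hcw j).2 j le_rfl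
    refine (integrable_inv_one_add_sq.const_mul C).mono' ?_ (Eventually.of_forall fun x => ?_)
    · exact ((hcw.contDiff a).continuous_iteratedDeriv j
        (by exact_mod_cast le_top)).aestronglyMeasurable
    · simpa using hC a x
  have hbd : ∀ j, ∃ K : ℝ, ∀ a, |a| ^ j * ‖osc s c w a‖ ≤ K := by
    intro j
    obtain ⟨C, hC0, hC⟩ := (hcw j).2 j le_rfl
    refine ⟨∫ x : ℝ, C * (1 + x ^ 2)⁻¹, fun a => ?_⟩
    have := abs_pow_mul_norm_integral_phase_le (s * a) j (f := fun b => c a b * w b)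
      ((hcw j).1 a) (fun i _ => hmass i a)
    rw [abs_mul, hs, one_mul] at this
    refine this.trans (integral_mono_of_nonneg (Eventually.of_forall fun _ => norm_nonneg _)
      (integrable_inv_one_add_sq.const_mul C) (Eventually.of_forall fun x => ?_))
    simpa using hC a x
  choose K hK using hbd
  refine ⟨∑ j ∈ Finset.range (N + 1), K j * (N.choose j : ℝ), fun a => ?_⟩
  rw [add_comm 1 |a|, add_pow, Finset.sum_mul]
  refine Finset.sum_le_sum fun j _ => ?_
  rw [one_pow, mul_one, mul_right_comm]
  exact mul_le_mul_of_nonneg_right (hK j a) (Nat.cast_nonneg _)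

end IsAmplitude

/-- The oscillatory integral operator as a linear map on the Schwartz space. -/
def oscS (s : ℝ) (hs : |s| = 1) (c : ℝ → ℝ → ℂ) (hc : IsAmplitude c) :
    SchwartzMap ℝ ℂ →ₗ[ℂ] SchwartzMap ℝ ℂ where
  toFun w := schwartzOfRapidDecay (osc s c w) (hc.rapidDecay_osc hs w)
    (hc.contDiff_osc s w.rapidDecay w.continuous)
    (hc.iteratedDeriv_osc_bound s w.rapidDecay w.continuous)
  map_add' u v := by
    obtain ⟨C, -, hC⟩ := hc.bound
    ext a
    change osc s c (u + v : SchwartzMap ℝ ℂ) a = osc s c u a + osc s c v a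
    unfold osc
    rw [← integral_add (integrable_osc s hC hc.measurable u.integrable a)
      (integrable_osc s hC hc.measurable v.integrable a)]
    congr 1
    ext b
    simp only [add_apply]
    ring
  map_smul' z u := by
    ext a
    change osc s c (z • u : SchwartzMap ℝ ℂ) a = z • osc s c u a
    unfold osc
    rw [smul_eq_mul, ← integral_const_mul]
    congr 1
    ext b
    simp only [smul_apply, smul_eq_mul]
    ring

theorem oscS_apply (s : ℝ) (hs : |s| = 1) (c : ℝ → ℝ → ℂ) (hc : IsAmplitude c)
    (w : SchwartzMap ℝ ℂ) (a : ℝ) : oscS s hs c hc w a = osc s c w a := rfl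

theorem Integrable.phase_mul {g : ℝ → ℂ} (hg : Integrable g) (t : ℝ) :
    Integrable (fun b => phase (t * b) * g b) := by
  refine hg.bdd_mul (c := 1)
    (continuous_phase.comp (by fun_prop : Continuous fun b => t * b)).aestronglyMeasurable ?_
  exact Eventually.of_forall fun b => (norm_phase _).le

theorem integral_phase_mul_deriv {f f' : ℝ → ℂ} (hd : ∀ b, HasDerivAt f (f' b) b)
    (hf : Integrable f) (hf' : Integrable f') (t : ℝ) :
    (t * Complex.I) * ∫ b, phase (t * b) * f b = -∫ b, phase (t * b) * f' b := by
  have ibp : ∫ b, phase (t * b) * f' b = -∫ b, t * Complex.I * phase (t * b) * f b := by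
    refine integral_mul_deriv_eq_deriv_mul_of_integrable (fun x _ => hasDerivAt_phase t x)
      (fun x _ => hd x) (Integrable.phase_mul hf' t) ?_ (Integrable.phase_mul hf t)
    have := (Integrable.phase_mul hf t).const_mul ((t : ℂ) * Complex.I)
    refine this.congr (Eventually.of_forall fun b => ?_)
    simp only [Pi.mul_apply]
    ring
  rw [ibp, neg_neg, ← integral_const_mul]
  simp_rw [mul_assoc]

theorem norm_integral_phase_mul_le (t : ℝ) (g : ℝ → ℂ) :
    ‖∫ b, phase (t * b) * g b‖ ≤ ∫ b, ‖g b‖ := by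
  refine (norm_integral_le_integral_norm _).trans (le_of_eq ?_)
  simp [norm_phase]

section Truncation

variable {χ : ℝ → ℝ} {q q' : ℝ → ℂ} {Q S : ℝ}

theorem hasDerivAt_cutoff_mul (hχ : ContDiff ℝ 1 χ) (hq : ∀ b, HasDerivAt q (q' b) b) (δ b : ℝ) :
    HasDerivAt (fun b => (χ (δ * b) : ℂ) * q b)
      (δ * (deriv χ (δ * b) * q b) + χ (δ * b) * q' b) b := by
  have h1 : HasDerivAt (fun b => χ (δ * b)) (deriv χ (δ * b) * (δ * 1)) b :=
    ((hχ.differentiable (by simp) (δ * b)).hasDerivAt).comp b ((hasDerivAt_id' b).const_mul δ)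
  refine (h1.ofReal_comp.fun_mul (hq b)).congr_deriv ?_
  push_cast
  ring

theorem integrable_cutoff (hχ : Continuous χ) (hc : HasCompactSupport χ) {δ : ℝ} (hδ : 0 < δ) :
    Integrable (fun b => χ (δ * b)) :=
  (hχ.integrable_of_hasCompactSupport hc).comp_mul_left' hδ.ne'

theorem integrable_cutoff_mul (hχ : Continuous χ) (hc : HasCompactSupport χ) {δ : ℝ} (hδ : 0 < δ)
    (hq : Continuous q) (hQ : ∀ b, ‖q b‖ ≤ Q) : Integrable (fun b => (χ (δ * b) : ℂ) * q b) :=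
  (integrable_cutoff hχ hc hδ).ofReal.mul_bdd (c := Q) hq.aestronglyMeasurable
    (Eventually.of_forall hQ)

theorem norm_integral_cutoff_mul_le (hχ : Continuous χ) (hc : HasCompactSupport χ) {δ : ℝ}
    (hδ : 0 < δ) (hQ : ∀ b, ‖q b‖ ≤ Q) :
    ∫ b, ‖(χ (δ * b) : ℂ) * q b‖ ≤ δ⁻¹ * (Q * ∫ b, |χ b|) := by
  have h1 : ∫ b, |χ (δ * b)| = δ⁻¹ * ∫ b, |χ b| := by
    rw [Measure.integral_comp_mul_left (fun b => |χ b|), abs_of_pos (inv_pos.2 hδ), smul_eq_mul]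
  rw [mul_left_comm, ← h1, ← integral_const_mul]
  refine integral_mono_of_nonneg (Eventually.of_forall fun _ => norm_nonneg _)
    ((integrable_cutoff hχ hc hδ).abs.const_mul Q) (Eventually.of_forall fun b => ?_)
  dsimp only
  rw [norm_mul, Complex.norm_real, Real.norm_eq_abs, mul_comm]
  exact mul_le_mul_of_nonneg_right (hQ b) (abs_nonneg _)

theorem integrable_cutoff_mul' (hχ : Continuous χ) (hS : ∀ b, |χ b| ≤ S) (hq : Integrable q)
    (δ : ℝ) : Integrable (fun b => (χ (δ * b) : ℂ) * q b) :=
  hq.bdd_mul (c := S) (by fun_prop) (Eventually.of_forall fun b => by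
    rw [Complex.norm_real]; exact hS _)

theorem integral_phase_cutoff (hχ : ContDiff ℝ 1 χ) (hc : HasCompactSupport χ)
    (hS : ∀ b, |χ b| ≤ S) (hq : ∀ b, HasDerivAt q (q' b) b) (hQ : ∀ b, ‖q b‖ ≤ Q)
    (hq' : Integrable q') {δ : ℝ} (hδ : 0 < δ) (z : ℝ) :
    (z * Complex.I) * ∫ b, phase (z * b) * (χ (δ * b) * q b) =
      -(δ * (∫ b, phase (z * b) * (deriv χ (δ * b) * q b)) +
        ∫ b, phase (z * b) * (χ (δ * b) * q' b)) := by
  have hqc : Continuous q := continuous_iff_continuousAt.2 fun b => (hq b).continuousAt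
  have hχ' : Continuous (deriv χ) := hχ.continuous_deriv le_rfl
  have i1 := integrable_cutoff_mul hχ' hc.deriv hδ hqc hQ
  have i2 := integrable_cutoff_mul' hχ.continuous hS hq' δ
  rw [integral_phase_mul_deriv (fun b => hasDerivAt_cutoff_mul hχ hq δ b)
    (integrable_cutoff_mul hχ.continuous hc hδ hqc hQ) ((i1.const_mul _).add i2),
    ← integral_const_mul, ← integral_add ((Integrable.phase_mul i1 z).const_mul _)
      (Integrable.phase_mul i2 z)]
  congr 2
  ext b
  ring

theorem abs_mul_norm_integral_phase_cutoff_le (hχ : ContDiff ℝ 1 χ) (hc : HasCompactSupport χ)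
    (hS : ∀ b, |χ b| ≤ S) (hq : ∀ b, HasDerivAt q (q' b) b) (hQ : ∀ b, ‖q b‖ ≤ Q)
    (hq' : Integrable q') {δ : ℝ} (hδ : 0 < δ) (z : ℝ) :
    |z| * ‖∫ b, phase (z * b) * (χ (δ * b) * q b)‖ ≤
      Q * (∫ b, |deriv χ b|) + S * ∫ b, ‖q' b‖ := by
  have e : |z| * ‖∫ b, phase (z * b) * (χ (δ * b) * q b)‖ =
      ‖(z * Complex.I) * ∫ b, phase (z * b) * (χ (δ * b) * q b)‖ := by
    rw [norm_mul, norm_mul, Complex.norm_I, Complex.norm_real, mul_one, Real.norm_eq_abs]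
  rw [e, integral_phase_cutoff hχ hc hS hq hQ hq' hδ, norm_neg]
  refine (norm_add_le _ _).trans (add_le_add ?_ ?_)
  · rw [norm_mul, Complex.norm_real, Real.norm_eq_abs, abs_of_pos hδ]
    refine (mul_le_mul_of_nonneg_left ((norm_integral_phase_mul_le z _).trans
      (norm_integral_cutoff_mul_le (hχ.continuous_deriv le_rfl) hc.deriv hδ hQ)) hδ.le).trans
      (le_of_eq ?_)
    rw [← mul_assoc, mul_inv_cancel₀ hδ.ne', one_mul]
  · refine (norm_integral_phase_mul_le z _).trans ?_
    rw [← integral_const_mul]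
    refine integral_mono_of_nonneg (Eventually.of_forall fun _ => norm_nonneg _)
      (hq'.norm.const_mul S) (Eventually.of_forall fun b => ?_)
    dsimp only
    rw [norm_mul, Complex.norm_real]
    exact mul_le_mul_of_nonneg_right (hS _) (norm_nonneg _)

theorem tendsto_integral_cutoff_mul (hχ : Continuous χ) (hS : ∀ b, |χ b| ≤ S) (h0 : χ 0 = 1)
    (hq : Integrable q) :
    Tendsto (fun n : ℕ => ∫ b, (χ (1 / ((n : ℝ) + 1) * b) : ℂ) * q b) atTop (𝓝 (∫ b, q b)) := by
  refine tendsto_integral_of_dominated_convergence (fun b => S * ‖q b‖)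
    (fun n => (integrable_cutoff_mul' hχ hS hq _).aestronglyMeasurable) (hq.norm.const_mul S)
    (fun n => Eventually.of_forall fun b => ?_) (Eventually.of_forall fun b => ?_)
  · rw [norm_mul, Complex.norm_real]
    exact mul_le_mul_of_nonneg_right (hS _) (norm_nonneg _)
  · have h1 : Tendsto (fun n : ℕ => 1 / ((n : ℝ) + 1) * b) atTop (𝓝 (0 * b)) :=
      tendsto_one_div_add_atTop_nhds_zero_nat.mul_const b
    rw [zero_mul] at h1
    have h2 := (hχ.tendsto 0).comp h1
    rw [h0] at h2
    have h3 := ((Complex.continuous_ofReal.tendsto 1).comp h2).mul_const (q b)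
    simpa using h3

/-- Abel-type summation of the Fourier transform of a function whose derivative is integrable. -/
theorem tendsto_integral_phase_cutoff (hχ : ContDiff ℝ 2 χ) (hc : HasCompactSupport χ)
    (hS : ∀ b, |χ b| ≤ S) (h0 : χ 0 = 1) (hq : ∀ b, HasDerivAt q (q' b) b) (hQ : ∀ b, ‖q b‖ ≤ Q)
    (hq' : Integrable q') {z : ℝ} (hz : z ≠ 0) :
    Tendsto (fun n : ℕ => ∫ b, phase (z * b) * (χ (1 / ((n : ℝ) + 1) * b) * q b)) atTop
      (𝓝 (-(z * Complex.I)⁻¹ * ∫ b, phase (z * b) * q' b)) := by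
  have hχ1 : ContDiff ℝ 1 χ := hχ.of_le (by norm_num)
  have hχ' : ContDiff ℝ 1 (deriv χ) := by
    have : ContDiff ℝ (1 + 1) χ := by simpa [one_add_one_eq_two] using hχ
    exact (contDiff_succ_iff_deriv.1 this).2.2
  obtain ⟨S', hS'⟩ := hχ'.continuous.bounded_above_of_compact_support hc.deriv
  have hzI : (z : ℂ) * Complex.I ≠ 0 := mul_ne_zero (by exact_mod_cast hz) Complex.I_ne_zero
  have hδ : ∀ n : ℕ, (0 : ℝ) < 1 / ((n : ℝ) + 1) := fun n => by positivity
  have e : ∀ n : ℕ, ∫ b, phase (z * b) * (χ (1 / ((n : ℝ) + 1) * b) * q b) =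
      -(z * Complex.I)⁻¹ * (((1 / ((n : ℝ) + 1) : ℝ) : ℂ) *
        (∫ b, phase (z * b) * (deriv χ (1 / ((n : ℝ) + 1) * b) * q b)) +
          ∫ b, (χ (1 / ((n : ℝ) + 1) * b) : ℂ) * (phase (z * b) * q' b)) := by
    intro n
    have := integral_phase_cutoff hχ1 hc hS hq hQ hq' (hδ n) z
    rw [neg_mul, ← mul_neg, eq_inv_mul_iff_mul_eq₀ hzI, this]
    congr 3
    ext b
    ring
  simp_rw [e]
  refine Tendsto.const_mul _ ?_
  rw [← zero_add (∫ b, phase (z * b) * q' b)]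
  refine Tendsto.add ?_ (tendsto_integral_cutoff_mul hχ.continuous hS h0
    (Integrable.phase_mul hq' z))
  refine squeeze_zero_norm (a := fun n : ℕ => 1 / ((n : ℝ) + 1) *
    (|z|⁻¹ * (Q * (∫ b, |deriv (deriv χ) b|) + S' * ∫ b, ‖q' b‖))) (fun n => ?_) ?_
  · rw [norm_mul, Complex.norm_real, Real.norm_eq_abs, abs_of_pos (hδ n)]
    refine mul_le_mul_of_nonneg_left ?_ (hδ n).le
    rw [← div_eq_inv_mul, le_div_iff₀ (abs_pos.2 hz), mul_comm]
    exact abs_mul_norm_integral_phase_cutoff_le hχ' hc.deriv hS' hq hQ hq' (hδ n) z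
  · simpa using tendsto_one_div_add_atTop_nhds_zero_nat.mul_const
      (|z|⁻¹ * (Q * (∫ b, |deriv (deriv χ) b|) + S' * ∫ b, ‖q' b‖))

end Truncation

/-- Phases which vary little in their second variable, with an integrable weight `m`. -/
structure SmallPhase (m : ℝ → ℝ) (C₀ ε L : ℝ) (σ : ℝ → ℝ → ℝ) : Prop where
  cont : Continuous (Function.uncurry σ)
  amp : IsAmplitude (fun a b => (Real.exp (σ a b) : ℂ))
  ampNeg : IsAmplitude (fun a b => (Real.exp (-σ a b) : ℂ))
  bdd : ∀ a b, |σ a b| ≤ C₀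
  smooth : ∀ a, ContDiff ℝ (⊤ : ℕ∞) (σ a)
  m_nonneg : ∀ b, 0 ≤ m b
  m_int : Integrable m
  ε_nonneg : 0 ≤ ε
  ε_le : ε ≤ 1
  L_nonneg : 0 ≤ L
  d1_sym : SymEst (fun _ _ => 1) (fun _ b => √(m b)) (fun a => deriv (σ a))
  d2_sym : SymEst (fun _ _ => 1) (fun _ b => m b) (fun a => deriv (deriv (σ a)))
  d1 : ∀ a b, |deriv (σ a) b| ≤ ε * √(m b)
  d2 : ∀ a b, |deriv (deriv (σ a)) b| ≤ ε * m b
  lip0 : ∀ a a' b, |σ a b - σ a' b| ≤ L * |a - a'|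
  lip1 : ∀ a a' b, |deriv (σ a) b - deriv (σ a') b| ≤ ε * |a - a'| * m b

namespace SmallPhase

variable {m : ℝ → ℝ} {C₀ ε L : ℝ} {σ : ℝ → ℝ → ℝ}

/-- The derivative of `exp (σ a - σ a')`. -/
def kerDeriv (σ : ℝ → ℝ → ℝ) (i : ℝ × ℝ) (b : ℝ) : ℂ :=
  ((deriv (σ i.1) b - deriv (σ i.2) b : ℝ) : ℂ) *
    ((Real.exp (σ i.1 b) : ℂ) * (Real.exp (-σ i.2 b) : ℂ))

/-- The second derivative of `exp (σ a - σ a')`. -/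
def kerDeriv2 (σ : ℝ → ℝ → ℝ) (i : ℝ × ℝ) (b : ℝ) : ℂ :=
  (((deriv (deriv (σ i.1)) b - deriv (deriv (σ i.2)) b) +
    (deriv (σ i.1) b - deriv (σ i.2) b) * (deriv (σ i.1) b - deriv (σ i.2) b) : ℝ) : ℂ) *
    ((Real.exp (σ i.1 b) : ℂ) * (Real.exp (-σ i.2 b) : ℂ))

theorem C₀_nonneg (h : SmallPhase m C₀ ε L σ) : 0 ≤ C₀ := (abs_nonneg _).trans (h.bdd 0 0)

theorem hasDerivAt (h : SmallPhase m C₀ ε L σ) (a b : ℝ) :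
    HasDerivAt (σ a) (deriv (σ a) b) b :=
  ((h.smooth a).differentiable (by simp) b).hasDerivAt

theorem hasDerivAt_deriv (h : SmallPhase m C₀ ε L σ) (a b : ℝ) :
    HasDerivAt (deriv (σ a)) (deriv (deriv (σ a)) b) b := h.d1_sym.hasDerivAt a b

theorem hasDerivAt_exp_mul (h : SmallPhase m C₀ ε L σ) (i : ℝ × ℝ) (b : ℝ) :
    HasDerivAt (fun b => (Real.exp (σ i.1 b) : ℂ) * (Real.exp (-σ i.2 b) : ℂ))
      (kerDeriv σ i b) b := by
  refine ((h.hasDerivAt i.1 b).exp.ofReal_comp.fun_mul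
    (h.hasDerivAt i.2 b).fun_neg.exp.ofReal_comp).congr_deriv ?_
  unfold kerDeriv
  push_cast
  ring

theorem hasDerivAt_kerDeriv (h : SmallPhase m C₀ ε L σ) (i : ℝ × ℝ) (b : ℝ) :
    HasDerivAt (kerDeriv σ i) (kerDeriv2 σ i b) b := by
  have h1 := ((h.hasDerivAt_deriv i.1 b).fun_sub (h.hasDerivAt_deriv i.2 b)).ofReal_comp
  refine (h1.fun_mul (h.hasDerivAt_exp_mul i b)).congr_deriv ?_
  unfold kerDeriv kerDeriv2
  push_cast
  ring

theorem norm_exp_mul_le (h : SmallPhase m C₀ ε L σ) (i : ℝ × ℝ) (b : ℝ) :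
    ‖(Real.exp (σ i.1 b) : ℂ) * (Real.exp (-σ i.2 b) : ℂ)‖ ≤ Real.exp (2 * C₀) := by
  rw [norm_mul, Complex.norm_real, Complex.norm_real, Real.norm_eq_abs, Real.norm_eq_abs,
    Real.abs_exp, Real.abs_exp, ← Real.exp_add]
  refine Real.exp_le_exp.2 ?_
  have h1 := (abs_le.1 (h.bdd i.1 b)).2
  have h2 := (abs_le.1 (h.bdd i.2 b)).1
  linarith

theorem norm_exp_mul_sub_one_le (h : SmallPhase m C₀ ε L σ) (i : ℝ × ℝ) (b : ℝ) :
    ‖(Real.exp (σ i.1 b) : ℂ) * (Real.exp (-σ i.2 b) : ℂ) - 1‖ ≤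
      Real.exp (2 * C₀) * L * |i.1 - i.2| := by
  have e : (Real.exp (σ i.1 b) : ℂ) * (Real.exp (-σ i.2 b) : ℂ) - 1 =
      ((Real.exp (σ i.1 b - σ i.2 b) - Real.exp 0 : ℝ) : ℂ) := by
    rw [sub_eq_add_neg (σ i.1 b), Real.exp_add, Real.exp_zero]
    push_cast
    ring
  rw [e, Complex.norm_real]
  have key := Convex.norm_image_sub_le_of_norm_deriv_le (𝕜 := ℝ) (s := Iic (2 * C₀)) (f := Real.exp)
    (C := Real.exp (2 * C₀)) (x := 0) (y := σ i.1 b - σ i.2 b) (fun y _ => Real.differentiableAt_exp)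
    (fun y hy => by
      rw [Real.deriv_exp, Real.norm_eq_abs, Real.abs_exp]
      exact Real.exp_le_exp.2 hy) (convex_Iic _) (by simpa using h.C₀_nonneg) (by
      have h1 := (abs_le.1 (h.bdd i.1 b)).2
      have h2 := (abs_le.1 (h.bdd i.2 b)).1
      simp only [mem_Iic]
      linarith)
  refine key.trans ?_
  rw [sub_zero, Real.norm_eq_abs, mul_assoc]
  exact mul_le_mul_of_nonneg_left (h.lip0 _ _ _) (Real.exp_pos _).le

theorem norm_kerDeriv_le (h : SmallPhase m C₀ ε L σ) (i : ℝ × ℝ) (b : ℝ) :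
    ‖kerDeriv σ i b‖ ≤ Real.exp (2 * C₀) * ε * |i.1 - i.2| * m b := by
  unfold kerDeriv
  rw [norm_mul, Complex.norm_real, Real.norm_eq_abs]
  refine (mul_le_mul (h.lip1 i.1 i.2 b) (h.norm_exp_mul_le i b) (norm_nonneg _) ?_).trans
    (le_of_eq (by ring))
  have := h.m_nonneg b
  have := h.ε_nonneg
  positivity

theorem norm_kerDeriv2_le (h : SmallPhase m C₀ ε L σ) (i : ℝ × ℝ) (b : ℝ) :
    ‖kerDeriv2 σ i b‖ ≤ 6 * Real.exp (2 * C₀) * ε * m b := by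
  unfold kerDeriv2
  have hm := h.m_nonneg b
  have hε := h.ε_nonneg
  have hε1 := h.ε_le
  rw [norm_mul, Complex.norm_real, Real.norm_eq_abs]
  have h1 : |deriv (σ i.1) b - deriv (σ i.2) b| ≤ 2 * ε * √(m b) :=
    (abs_sub _ _).trans (by linarith [h.d1 i.1 b, h.d1 i.2 b])
  have h2 : |deriv (deriv (σ i.1)) b - deriv (deriv (σ i.2)) b| ≤ 2 * ε * m b :=
    (abs_sub _ _).trans (by linarith [h.d2 i.1 b, h.d2 i.2 b])
  have h3 : |(deriv (σ i.1) b - deriv (σ i.2) b) * (deriv (σ i.1) b - deriv (σ i.2) b)| ≤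
      4 * ε * m b := by
    rw [abs_mul]
    refine (mul_le_mul h1 h1 (abs_nonneg _) (by positivity)).trans ?_
    have : 2 * ε * √(m b) * (2 * ε * √(m b)) = 4 * (ε * ε) * (√(m b) * √(m b)) := by ring
    rw [this, Real.mul_self_sqrt hm]
    have : ε * ε ≤ ε := by nlinarith
    gcongr
  have h4 := (abs_add_le _ _).trans (add_le_add h2 h3)
  refine (mul_le_mul h4 (h.norm_exp_mul_le i b) (norm_nonneg _) (by positivity)).trans
    (le_of_eq (by ring))

theorem kerDeriv2_sym (h : SmallPhase m C₀ ε L σ) :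
    SymEst (fun _ _ => 1) (fun _ b => m b) (kerDeriv2 σ) := by
  have e1 : SymEst (fun _ _ => 1) (fun _ _ => 1) (fun (i : ℝ × ℝ) b =>
      (Real.exp (σ i.1 b) : ℂ) * (Real.exp (-σ i.2 b) : ℂ)) := by
    simpa using (h.amp.right.reindex (Prod.fst : ℝ × ℝ → ℝ)).mul
      (h.ampNeg.right.reindex (Prod.snd : ℝ × ℝ → ℝ))
  have d1 : SymEst (fun _ _ => 1) (fun _ b => √(m b)) (fun (i : ℝ × ℝ) b =>
      deriv (σ i.1) b - deriv (σ i.2) b) := by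
    simpa [sub_eq_add_neg] using (h.d1_sym.reindex (Prod.fst : ℝ × ℝ → ℝ)).add
      ((h.d1_sym.reindex (Prod.snd : ℝ × ℝ → ℝ)).const_mul (-1))
  have d2 : SymEst (fun _ _ => 1) (fun _ b => m b) (fun (i : ℝ × ℝ) b =>
      deriv (deriv (σ i.1)) b - deriv (deriv (σ i.2)) b) := by
    simpa [sub_eq_add_neg] using (h.d2_sym.reindex (Prod.fst : ℝ × ℝ → ℝ)).add
      ((h.d2_sym.reindex (Prod.snd : ℝ × ℝ → ℝ)).const_mul (-1))
  have d1' := d1.mul d1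
  simp only [fun b => Real.mul_self_sqrt (h.m_nonneg b)] at d1'
  have := (d2.add d1').ofReal.mul e1
  simp only [mul_one] at this
  exact this

theorem integrable_kerDeriv (h : SmallPhase m C₀ ε L σ) (i : ℝ × ℝ) :
    Integrable (kerDeriv σ i) :=
  (h.m_int.const_mul _).mono' (continuous_iff_continuousAt.2 fun b =>
    (h.hasDerivAt_kerDeriv i b).continuousAt).aestronglyMeasurable
    (Eventually.of_forall (h.norm_kerDeriv_le i))

theorem norm_integral_kerDeriv_le (h : SmallPhase m C₀ ε L σ) (i : ℝ × ℝ) (t : ℝ) :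
    ‖∫ b, phase (t * b) * kerDeriv σ i b‖ ≤
      Real.exp (2 * C₀) * ε * (∫ b, m b) * |i.1 - i.2| := by
  refine (norm_integral_phase_mul_le _ _).trans ?_
  refine (integral_mono_of_nonneg (Eventually.of_forall fun _ => norm_nonneg _)
    (h.m_int.const_mul _) (Eventually.of_forall (h.norm_kerDeriv_le i))).trans ?_
  rw [integral_const_mul]
  exact le_of_eq (by ring)

theorem integrable_iteratedDeriv_kerDeriv2 (h : SmallPhase m C₀ ε L σ) (i : ℝ × ℝ) (j : ℕ) :
    Integrable (iteratedDeriv j (kerDeriv2 σ i)) := by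
  obtain ⟨C, -, hC⟩ := (h.kerDeriv2_sym j).2 j le_rfl
  refine (h.m_int.const_mul C).mono' ?_ (Eventually.of_forall fun x => ?_)
  · exact ((h.kerDeriv2_sym.contDiff i).continuous_iteratedDeriv j
      (by exact_mod_cast le_top)).aestronglyMeasurable
  · simpa using hC i x

theorem abs_mul_norm_integral_kerDeriv (h : SmallPhase m C₀ ε L σ) (i : ℝ × ℝ) (t : ℝ) :
    |t| * ‖∫ b, phase (t * b) * kerDeriv σ i b‖ = ‖∫ b, phase (t * b) * kerDeriv2 σ i b‖ := by
  have h2 : Integrable (kerDeriv2 σ i) := by simpa using h.integrable_iteratedDeriv_kerDeriv2 i 0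
  have := congrArg norm (integral_phase_mul_deriv (h.hasDerivAt_kerDeriv i)
    (h.integrable_kerDeriv i) h2 t)
  rwa [norm_mul, norm_mul, Complex.norm_I, Complex.norm_real, mul_one, Real.norm_eq_abs,
    norm_neg] at this

theorem abs_mul_norm_integral_kerDeriv_le (h : SmallPhase m C₀ ε L σ) (i : ℝ × ℝ) (t : ℝ) :
    |t| * ‖∫ b, phase (t * b) * kerDeriv σ i b‖ ≤ 6 * Real.exp (2 * C₀) * ε * ∫ b, m b := by
  rw [h.abs_mul_norm_integral_kerDeriv, ← integral_const_mul]
  exact (norm_integral_phase_mul_le _ _).trans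
    (integral_mono_of_nonneg (Eventually.of_forall fun _ => norm_nonneg _)
      (h.m_int.const_mul _) (Eventually.of_forall (h.norm_kerDeriv2_le i)))

theorem abs_pow_mul_norm_integral_kerDeriv_le (h : SmallPhase m C₀ ε L σ) (N : ℕ) :
    ∃ C : ℝ, 0 ≤ C ∧ ∀ i t, |t| ^ (N + 1) * ‖∫ b, phase (t * b) * kerDeriv σ i b‖ ≤ C := by
  obtain ⟨C, hC0, hC⟩ := (h.kerDeriv2_sym N).2 N le_rfl
  have hm : 0 ≤ ∫ b, m b := integral_nonneg h.m_nonneg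
  refine ⟨C * ∫ b, m b, by positivity, fun i t => ?_⟩
  rw [pow_succ, mul_assoc, h.abs_mul_norm_integral_kerDeriv, ← integral_const_mul]
  refine (abs_pow_mul_norm_integral_phase_le t N ((h.kerDeriv2_sym N).1 i)
    fun j _ => h.integrable_iteratedDeriv_kerDeriv2 i j).trans ?_
  exact integral_mono_of_nonneg (Eventually.of_forall fun _ => norm_nonneg _)
    (h.m_int.const_mul _) (Eventually.of_forall fun b => by simpa using hC i b)

/-- The limiting kernel is small and decays rapidly off the diagonal. -/
theorem kernel_bound (h : SmallPhase m C₀ ε L σ) (N : ℕ) :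
    ∃ C : ℝ, 0 ≤ C ∧ ∀ s : ℝ, |s| = 1 → ∀ a a' : ℝ, a ≠ a' →
      (2 * π)⁻¹ * ‖-((s * (a - a') : ℝ) * Complex.I)⁻¹ *
        ∫ b, phase (s * (a - a') * b) * kerDeriv σ (a, a') b‖ ≤
      min (2 * Real.exp (2 * C₀) * (∫ b, m b) * ε * (1 + (a - a') ^ 2)⁻¹)
        (C * ((1 + |a - a'|) ^ N)⁻¹) := by
  obtain ⟨C, hC0, hC⟩ := h.abs_pow_mul_norm_integral_kerDeriv_le N
  have hm : 0 ≤ ∫ b, m b := integral_nonneg h.m_nonneg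
  have hε := h.ε_nonneg
  set E := Real.exp (2 * C₀) with hE
  have hE0 : 0 < E := Real.exp_pos _
  refine ⟨2 ^ (N + 2) * (C + E * ε * ∫ b, m b), by positivity, fun s hs a a' haa => ?_⟩
  have b1 := h.norm_integral_kerDeriv_le (a, a') (s * (a - a'))
  have b2 := h.abs_mul_norm_integral_kerDeriv_le (a, a') (s * (a - a'))
  have b3 := hC (a, a') (s * (a - a'))
  rw [← hE] at b1 b2
  rw [abs_mul, hs, one_mul] at b2 b3
  set J := ‖∫ b, phase (s * (a - a') * b) * kerDeriv σ (a, a') b‖ with hJ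
  have hJ0 : 0 ≤ J := norm_nonneg _
  dsimp only at b1
  set z := |a - a'| with hz
  have hz0 : 0 < z := abs_pos.2 (sub_ne_zero.2 haa)
  have e : ‖-((s * (a - a') : ℝ) * Complex.I)⁻¹ *
      ∫ b, phase (s * (a - a') * b) * kerDeriv σ (a, a') b‖ = z⁻¹ * J := by
    rw [norm_mul, norm_neg, norm_inv, norm_mul, Complex.norm_I, Complex.norm_real, mul_one,
      Real.norm_eq_abs, abs_mul, hs, one_mul]
  rw [e]
  have c1 : z⁻¹ * J ≤ E * ε * ∫ b, m b := by
    rw [← div_eq_inv_mul, div_le_iff₀ hz0]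
    exact b1
  have c2 : z ^ 2 * (z⁻¹ * J) ≤ 6 * E * ε * ∫ b, m b := by
    refine le_trans (le_of_eq ?_) b2
    field_simp
  have c3 : z ^ (N + 2) * (z⁻¹ * J) ≤ C := by
    refine le_trans (le_of_eq ?_) b3
    field_simp
    ring
  have hπ : (2 * π)⁻¹ * 7 ≤ 2 := by
    rw [← div_eq_inv_mul, div_le_iff₀ (by positivity)]
    linarith [Real.pi_gt_three]
  have hzJ : 0 ≤ z⁻¹ * J := by positivity
  refine le_min ?_ ?_
  · rw [← div_eq_mul_inv, le_div_iff₀ (by positivity), ← sq_abs, ← hz]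
    calc (2 * π)⁻¹ * (z⁻¹ * J) * (1 + z ^ 2)
        = (2 * π)⁻¹ * (z⁻¹ * J + z ^ 2 * (z⁻¹ * J)) := by ring
      _ ≤ (2 * π)⁻¹ * (E * ε * (∫ b, m b) + 6 * E * ε * ∫ b, m b) := by gcongr
      _ = (2 * π)⁻¹ * 7 * (E * ε * ∫ b, m b) := by ring
      _ ≤ 2 * (E * ε * ∫ b, m b) := by gcongr
      _ = _ := by ring
  · rw [← div_eq_mul_inv, le_div_iff₀ (by positivity)]
    have hπ1 : (2 * π)⁻¹ ≤ 1 := inv_le_one_of_one_le₀ (by linarith [Real.pi_gt_three])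
    have p1 : (1 + z) ^ N ≤ 2 ^ (N + 2) * (z ^ (N + 2) + 1) := by
      refine (pow_le_pow_right₀ (by linarith) (by omega : N ≤ N + 2)).trans ?_
      have := one_add_abs_pow_le (a - a') (N + 2)
      rwa [← hz] at this
    calc (2 * π)⁻¹ * (z⁻¹ * J) * (1 + z) ^ N
        ≤ 1 * (z⁻¹ * J) * (2 ^ (N + 2) * (z ^ (N + 2) + 1)) := by gcongr
      _ = 2 ^ (N + 2) * (z ^ (N + 2) * (z⁻¹ * J) + z⁻¹ * J) := by ring
      _ ≤ _ := by gcongr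

end SmallPhase

theorem isAmplitude_one : IsAmplitude (fun _ _ => 1) := by
  have : SymEst (fun _ _ => 1) (fun _ _ => 1) (fun (_ _ : ℝ) => (1 : ℂ)) := by
    refine fun n => ⟨fun _ => contDiff_const, fun j _ => ⟨1, zero_le_one, fun _ x => ?_⟩⟩
    rw [iteratedDeriv_const]
    split_ifs <;> simp
  exact ⟨this, this⟩

/-- Fourier inversion on the Schwartz space. -/
theorem integral_phase_mul_osc_one {s : ℝ} (hs : |s| = 1) (v : SchwartzMap ℝ ℂ) (a : ℝ) :
    ∫ b, phase (s * a * b) * ((((2 * π)⁻¹ : ℝ) : ℂ) * osc (-s) (fun _ _ => 1) v b) = v a := by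
  have hss : s * s = 1 := by rw [← abs_mul_abs_self, hs, one_mul]
  have h1 : FourierTransformInv.fourierInv (FourierTransform.fourier (v : ℝ → ℂ)) a = v a := by
    have := congrFun (Continuous.fourierInv_fourier_eq v.continuous v.integrable (by
      rw [← SchwartzMap.fourier_coe]
      exact (FourierTransform.fourier v).integrable)) a
    exact this
  rw [← h1, Real.fourierInv_eq']
  have key : ∀ ξ : ℝ, FourierTransform.fourier (v : ℝ → ℂ) ξ =
      osc (-s) (fun _ _ => 1) v (2 * π * s * ξ) := by
    intro ξ
    rw [Real.fourier_eq']
    unfold osc phase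
    refine integral_congr_ae (Eventually.of_forall fun y => ?_)
    simp only [smul_eq_mul, one_mul]
    congr 3
    push_cast
    simp only [RCLike.inner_apply, conj_trivial]
    have : (s : ℂ) * s = 1 := by exact_mod_cast hss
    push_cast
    linear_combination (2 * π * ξ * y) * this
  have hc : (2 * π * s) ≠ 0 := by
    have : s ≠ 0 := by rintro rfl; simp at hs
    positivity
  have := Measure.integral_comp_mul_left (fun b => phase (s * a * b) *
    ((((2 * π)⁻¹ : ℝ) : ℂ) * osc (-s) (fun _ _ => 1) v b)) (2 * π * s)
  have habs : |(2 * π * s)⁻¹| = (2 * π)⁻¹ := by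
    rw [abs_inv, abs_mul, hs, mul_one, abs_of_pos (by positivity)]
  rw [habs, eq_comm, inv_smul_eq_iff₀ (by positivity), ← integral_smul] at this
  rw [this]
  refine integral_congr_ae (Eventually.of_forall fun ξ => ?_)
  simp only [key, smul_eq_mul, Complex.real_smul]
  have e : phase (s * a * (2 * π * s * ξ)) = Complex.exp ((2 * π * inner ℝ ξ a : ℝ) * Complex.I) := by
    unfold phase
    congr 3
    simp only [RCLike.inner_apply, conj_trivial]
    linear_combination (2 * π * a * ξ) * hss
  rw [e]
  have hπ : (π : ℂ) ≠ 0 := by exact_mod_cast Real.pi_ne_zero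
  push_cast
  field_simp

namespace SmallPhase

variable {m : ℝ → ℝ} {C₀ ε L : ℝ} {σ : ℝ → ℝ → ℝ}

theorem norm_integral_truncation_le (h : SmallPhase m C₀ ε L σ) {χ : ℝ → ℝ} {S : ℝ}
    (hχ : ContDiff ℝ 1 χ) (hc : HasCompactSupport χ) (hS : ∀ b, |χ b| ≤ S)
    {s : ℝ} (hs : |s| = 1) {δ : ℝ} (hδ : 0 < δ) (a a' : ℝ) :
    ‖∫ b, phase (s * (a - a') * b) * (χ (δ * b) *
      ((Real.exp (σ a b) : ℂ) * (Real.exp (-σ a' b) : ℂ) - 1))‖ ≤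
      Real.exp (2 * C₀) * L * (∫ b, |deriv χ b|) + S * (Real.exp (2 * C₀) * ε * ∫ b, m b) := by
  have hS0 : 0 ≤ S := (abs_nonneg _).trans (hS 0)
  rcases eq_or_ne a a' with rfl | haa
  · have e : ∀ b, (Real.exp (σ a b) : ℂ) * (Real.exp (-σ a b) : ℂ) - 1 = 0 := by
      intro b
      rw [← Complex.ofReal_mul, ← Real.exp_add]
      simp
    simp only [e, mul_zero, integral_zero, norm_zero]
    have hm : 0 ≤ ∫ b, m b := integral_nonneg h.m_nonneg
    have h1 : 0 ≤ ∫ b, |deriv χ b| := integral_nonneg fun _ => abs_nonneg _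
    have := h.L_nonneg
    have := h.ε_nonneg
    positivity
  · have hz : 0 < |a - a'| := abs_pos.2 (sub_ne_zero.2 haa)
    have key := abs_mul_norm_integral_phase_cutoff_le hχ hc hS
      (fun b => (h.hasDerivAt_exp_mul (a, a') b).sub_const 1)
      (h.norm_exp_mul_sub_one_le (a, a')) (h.integrable_kerDeriv (a, a')) hδ (s * (a - a'))
    rw [abs_mul, hs, one_mul] at key
    have h2 : ∫ b, ‖kerDeriv σ (a, a') b‖ ≤ Real.exp (2 * C₀) * ε * |a - a'| * ∫ b, m b := by
      rw [← integral_const_mul]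
      exact integral_mono_of_nonneg (Eventually.of_forall fun _ => norm_nonneg _)
        (h.m_int.const_mul _) (Eventually.of_forall (h.norm_kerDeriv_le (a, a')))
    refine le_of_mul_le_mul_left (key.trans ((add_le_add le_rfl
      (mul_le_mul_of_nonneg_left h2 hS0)).trans (le_of_eq ?_))) hz
    ring

/-- The composition of the two oscillatory integral operators differs from the identity by an
operator with a small kernel. -/
theorem norm_defect_le (h : SmallPhase m C₀ ε L σ) (N : ℕ) :
    ∃ C : ℝ, 0 ≤ C ∧ ∀ s : ℝ, |s| = 1 → ∀ (v : SchwartzMap ℝ ℂ) (a : ℝ),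
      ‖osc s (fun a b => (Real.exp (σ a b) : ℂ)) (fun b => (((2 * π)⁻¹ : ℝ) : ℂ) *
        osc (-s) (fun b a => (Real.exp (-σ a b) : ℂ)) v b) a - v a‖ ≤
      ∫ a', min (2 * Real.exp (2 * C₀) * (∫ b, m b) * ε * (1 + (a - a') ^ 2)⁻¹)
        (C * ((1 + |a - a'|) ^ N)⁻¹) * ‖v a'‖ := by
  obtain ⟨C, hC0, hC⟩ := h.kernel_bound N
  refine ⟨C, hC0, fun s hs v a => ?_⟩
  have hms : |(-s)| = 1 := by rwa [abs_neg]
  let bump : ContDiffBump (0 : ℝ) := ⟨1, 2, zero_lt_one, one_lt_two⟩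
  set χ : ℝ → ℝ := fun x => bump x with hχdef
  have hχ : ContDiff ℝ 2 χ := bump.contDiff
  have hχ1 : ContDiff ℝ 1 χ := bump.contDiff
  have hc : HasCompactSupport χ := bump.hasCompactSupport
  have hS : ∀ b, |χ b| ≤ 1 := fun b => by
    rw [abs_of_nonneg bump.nonneg]
    exact bump.le_one
  have h0 : χ 0 = 1 := bump.one_of_mem_closedBall (by simp [bump])
  have hσa : Continuous (σ a) := (h.smooth a).continuous
  have hσc : Continuous (fun x : ℝ × ℝ => σ x.2 x.1) := h.cont.comp continuous_swap
  have hE0 : 0 < Real.exp C₀ := Real.exp_pos _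
  have hEb : ∀ a b, ‖(Real.exp (σ a b) : ℂ)‖ ≤ Real.exp C₀ := fun a b => by
    rw [Complex.norm_real, Real.norm_eq_abs, Real.abs_exp]
    exact Real.exp_le_exp.2 ((le_abs_self _).trans (h.bdd a b))
  have hEb' : ∀ a b, ‖(Real.exp (-σ a b) : ℂ)‖ ≤ Real.exp C₀ := fun a b => by
    rw [Complex.norm_real, Real.norm_eq_abs, Real.abs_exp]
    exact Real.exp_le_exp.2 ((neg_le_abs _).trans (h.bdd a b))
  -- the two oscillatory integrals are Schwartz functions
  set V : SchwartzMap ℝ ℂ := oscS (-s) hms _ h.ampNeg.swap v with hV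
  set W : SchwartzMap ℝ ℂ := oscS (-s) hms _ isAmplitude_one v with hW
  have hVi : Integrable (fun b => phase (s * a * b) * ((Real.exp (σ a b) : ℂ) * V b)) :=
    integrable_osc s hEb h.amp.measurable V.integrable a
  have hWi : Integrable (fun b => phase (s * a * b) * W b) := Integrable.phase_mul W.integrable _
  set q : ℝ → ℝ → ℂ := fun a' b =>
    (Real.exp (σ a b) : ℂ) * (Real.exp (-σ a' b) : ℂ) - 1 with hq
  have hqQ : ∀ a' b, ‖q a' b‖ ≤ Real.exp (2 * C₀) + 1 := fun a' b =>
    (norm_sub_le _ _).trans (add_le_add (h.norm_exp_mul_le (a, a') b) (by simp))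
  set H : ℝ → ℂ := fun b => ∫ a', phase (s * (a - a') * b) * (q a' b * v a') with hH
  have hHe : ∀ b, H b = phase (s * a * b) * ((Real.exp (σ a b) : ℂ) * V b) -
      phase (s * a * b) * W b := by
    intro b
    have i1 := integrable_osc (-s) (fun b a => hEb' a b) h.ampNeg.swap.measurable v.integrable b
    have i2 := integrable_osc (-s) (C := 1) (fun _ _ => by simp) isAmplitude_one.measurable
      v.integrable b
    rw [hV, hW, oscS_apply, oscS_apply]
    unfold osc
    rw [← mul_assoc, ← integral_const_mul, ← integral_const_mul, ← integral_sub
      (i1.const_mul _) (i2.const_mul _)]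
    refine integral_congr_ae (Eventually.of_forall fun a' => ?_)
    have : phase (s * (a - a') * b) = phase (s * a * b) * phase (-s * b * a') := by
      rw [← phase_add]
      congr 1
      ring
    simp only [this, hq]
    ring
  have hHi : Integrable H := (hVi.sub hWi).congr (Eventually.of_forall fun b => (hHe b).symm)
  have hdef : osc s (fun a b => (Real.exp (σ a b) : ℂ)) (fun b => (((2 * π)⁻¹ : ℝ) : ℂ) *
        osc (-s) (fun b a => (Real.exp (-σ a b) : ℂ)) v b) a - v a =
      (((2 * π)⁻¹ : ℝ) : ℂ) * ∫ b, H b := by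
    have e1 : osc s (fun a b => (Real.exp (σ a b) : ℂ)) (fun b => (((2 * π)⁻¹ : ℝ) : ℂ) *
        osc (-s) (fun b a => (Real.exp (-σ a b) : ℂ)) v b) a =
        (((2 * π)⁻¹ : ℝ) : ℂ) * ∫ b, phase (s * a * b) * ((Real.exp (σ a b) : ℂ) * V b) := by
      rw [← integral_const_mul]
      refine integral_congr_ae (Eventually.of_forall fun b => ?_)
      simp only [hV, oscS_apply]
      ring
    have e2 : v a = (((2 * π)⁻¹ : ℝ) : ℂ) * ∫ b, phase (s * a * b) * W b := by
      rw [← integral_const_mul, ← integral_phase_mul_osc_one hs v a]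
      refine integral_congr_ae (Eventually.of_forall fun b => ?_)
      simp only [hW, oscS_apply]
      ring
    rw [e1, e2, ← mul_sub, ← integral_sub hVi hWi]
    simp only [hHe]
  have hδ : ∀ n : ℕ, (0 : ℝ) < 1 / ((n : ℝ) + 1) := fun n => by positivity
  set k : ℕ → ℝ → ℂ := fun n a' =>
    ∫ b, phase (s * (a - a') * b) * (χ (1 / ((n : ℝ) + 1) * b) * q a' b) with hk
  set r : ℝ → ℂ := fun a' => -((s * (a - a') : ℝ) * Complex.I)⁻¹ *
        ∫ b, phase (s * (a - a') * b) * kerDeriv σ (a, a') b with hr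
  have hvn : Integrable (fun x => ‖v x‖) volume := v.integrable.norm
  have hprod : ∀ n : ℕ, Integrable (Function.uncurry fun b a' => (χ (1 / ((n : ℝ) + 1) * b) : ℂ) *
      (phase (s * (a - a') * b) * (q a' b * v a'))) (volume.prod volume) := by
    intro n
    have hdom := ((integrable_cutoff hχ.continuous hc (hδ n)).abs.const_mul
      (Real.exp (2 * C₀) + 1)).mul_prod hvn
    refine hdom.mono' (Continuous.aestronglyMeasurable ?_) (Eventually.of_forall fun x => ?_)
    · have c1 : Continuous fun x : ℝ × ℝ => (χ (1 / ((n : ℝ) + 1) * x.1) : ℂ) :=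
        Complex.continuous_ofReal.comp (hχ.continuous.comp (by fun_prop))
      have c2 : Continuous fun x : ℝ × ℝ => phase (s * (a - x.2) * x.1) :=
        continuous_phase.comp (by fun_prop)
      have c3 : Continuous fun x : ℝ × ℝ => (Real.exp (σ a x.1) : ℂ) :=
        Complex.continuous_ofReal.comp (Real.continuous_exp.comp (hσa.comp continuous_fst))
      have c4 : Continuous fun x : ℝ × ℝ => (Real.exp (-σ x.2 x.1) : ℂ) :=
        Complex.continuous_ofReal.comp (Real.continuous_exp.comp hσc.neg)
      have c5 : Continuous fun x : ℝ × ℝ => v x.2 := v.continuous.comp continuous_snd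
      exact c1.mul (c2.mul (((c3.mul c4).sub continuous_const).mul c5))
    · simp only [Function.uncurry_def]
      rw [norm_mul, norm_mul, norm_phase, one_mul, norm_mul, Complex.norm_real, Real.norm_eq_abs]
      have := mul_le_mul_of_nonneg_left (hqQ x.2 x.1)
        (mul_nonneg (abs_nonneg (χ (1 / ((n : ℝ) + 1) * x.1))) (norm_nonneg (v x.2)))
      nlinarith [this]
  have hswap : ∀ n : ℕ, ∫ b, (χ (1 / ((n : ℝ) + 1) * b) : ℂ) * H b = ∫ a', k n a' * v a' := by
    intro n
    simp only [hH, hk, ← integral_const_mul, ← integral_mul_const]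
    rw [integral_integral_swap (hprod n)]
    refine integral_congr_ae (Eventually.of_forall fun a' =>
      integral_congr_ae (Eventually.of_forall fun b => ?_))
    ring
  have hmeas : ∀ n : ℕ, AEStronglyMeasurable (fun a' => ‖k n a' * v a'‖) volume := by
    intro n
    have := (hprod n).integral_prod_right.aestronglyMeasurable
    refine (this.congr (Eventually.of_forall fun a' => ?_)).norm
    simp only [hk, ← integral_mul_const, Function.uncurry_def]
    refine integral_congr_ae (Eventually.of_forall fun b => ?_)
    ring
  have hlim1 : Tendsto (fun n => ‖∫ a', k n a' * v a'‖) atTop (𝓝 ‖∫ b, H b‖) := by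
    simp only [← hswap]
    exact (tendsto_integral_cutoff_mul hχ.continuous hS h0 hHi).norm
  have hne : ∀ᵐ a' : ℝ, a ≠ a' := by
    filter_upwards [(Set.countable_singleton a).ae_notMem volume] with a' ha' e
    exact ha' (by simp [e])
  set B := Real.exp (2 * C₀) * L * (∫ b, |deriv χ b|) + 1 * (Real.exp (2 * C₀) * ε * ∫ b, m b)
  have hlim2 : Tendsto (fun n => ∫ a', ‖k n a' * v a'‖) atTop (𝓝 (∫ a', ‖r a' * v a'‖)) := by
    refine tendsto_integral_of_dominated_convergence (fun a' => B * ‖v a'‖) hmeas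
      (hvn.const_mul B) (fun n => Eventually.of_forall fun a' => ?_) ?_
    · rw [norm_norm, norm_mul]
      exact mul_le_mul_of_nonneg_right
        (h.norm_integral_truncation_le hχ1 hc hS hs (hδ n) a a') (norm_nonneg _)
    · filter_upwards [hne] with a' ha'
      have hz : s * (a - a') ≠ 0 := by
        refine mul_ne_zero ?_ (sub_ne_zero.2 ha')
        rintro rfl
        simp at hs
      exact ((tendsto_integral_phase_cutoff hχ hc hS h0
        (fun b => (h.hasDerivAt_exp_mul (a, a') b).sub_const 1) (hqQ a')
        (h.integrable_kerDeriv (a, a')) hz).mul_const (v a')).norm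
  have hle : ‖∫ b, H b‖ ≤ ∫ a', ‖r a' * v a'‖ :=
    le_of_tendsto_of_tendsto' hlim1 hlim2 fun n => norm_integral_le_integral_norm _
  rw [hdef, norm_mul, Complex.norm_real, Real.norm_eq_abs, abs_of_pos (by positivity)]
  refine (mul_le_mul_of_nonneg_left hle (by positivity)).trans ?_
  rw [← integral_const_mul]
  have hm : 0 ≤ ∫ b, m b := integral_nonneg h.m_nonneg
  have hε := h.ε_nonneg
  refine integral_mono_of_nonneg (Eventually.of_forall fun _ => by positivity) ?_ ?_
  · refine hvn.bdd_mul
      (c := 2 * Real.exp (2 * C₀) * (∫ b, m b) * ε) (Continuous.aestronglyMeasurable ?_)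
      (Eventually.of_forall fun a' => ?_)
    · refine Continuous.min (continuous_const.mul (Continuous.inv₀ (by fun_prop) fun x => ?_))
        (continuous_const.mul (Continuous.inv₀ (by fun_prop) fun x => ?_))
      · positivity
      · positivity
    · rw [Real.norm_eq_abs, abs_of_nonneg (by positivity)]
      refine (min_le_left _ _).trans (mul_le_of_le_one_right (by positivity) ?_)
      exact inv_le_one_of_one_le₀ (by nlinarith [sq_nonneg (a - a')])
  · filter_upwards [hne] with a' ha'
    rw [norm_mul, ← mul_assoc]
    exact mul_le_mul_of_nonneg_right (hC s hs a a' ha') (norm_nonneg _)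

end SmallPhase

/-- A convolution kernel of small mass, with polynomial decay of order `N`. -/
def smallKer (θ C : ℝ) (N : ℕ) (z : ℝ) : ℝ := min (θ * (1 + z ^ 2)⁻¹) (C * ((1 + |z|) ^ N)⁻¹)

section SmallKernel

variable {θ C : ℝ} {N : ℕ}

theorem smallKer_nonneg (hθ : 0 ≤ θ) (hC : 0 ≤ C) (z : ℝ) : 0 ≤ smallKer θ C N z :=
  le_min (by positivity) (by positivity)

theorem continuous_smallKer (θ C : ℝ) (N : ℕ) : Continuous (smallKer θ C N) := by
  refine Continuous.min (continuous_const.mul (Continuous.inv₀ (by fun_prop) fun x => ?_))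
    (continuous_const.mul (Continuous.inv₀ (by fun_prop) fun x => ?_)) <;> positivity

theorem norm_smallKer_mul_le (hθ : 0 ≤ θ) (hC : 0 ≤ C) {δ : ℝ} (hδ : 0 ≤ δ) (hδ1 : δ ≤ 1) (z : ℝ) :
    ‖smallKer θ C (N + 2) z * (1 + δ * |z|) ^ N‖ ≤ C * (1 + z ^ 2)⁻¹ := by
  rw [Real.norm_eq_abs, abs_of_nonneg (mul_nonneg (smallKer_nonneg hθ hC z) (by positivity))]
  have h1 : (1 + δ * |z|) ^ N ≤ (1 + |z|) ^ N := by
    gcongr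
    exact mul_le_of_le_one_left (abs_nonneg z) hδ1
  calc smallKer θ C (N + 2) z * (1 + δ * |z|) ^ N
      ≤ C * ((1 + |z|) ^ (N + 2))⁻¹ * (1 + |z|) ^ N :=
        mul_le_mul (min_le_right _ _) h1 (by positivity) (by positivity)
    _ = C * ((1 + |z|) ^ 2)⁻¹ := by
        rw [pow_add, mul_inv]
        field_simp
    _ ≤ C * (1 + z ^ 2)⁻¹ := mul_le_mul_of_nonneg_left
        (inv_anti₀ (by positivity) (one_add_sq_le_one_add_abs_sq z)) hC

theorem integrable_smallKer_mul (hθ : 0 ≤ θ) (hC : 0 ≤ C) {δ : ℝ} (hδ : 0 ≤ δ) (hδ1 : δ ≤ 1) :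
    Integrable (fun z => smallKer θ C (N + 2) z * (1 + δ * |z|) ^ N) := by
  have := continuous_smallKer θ C (N + 2)
  exact (integrable_inv_one_add_sq.const_mul C).mono'
    (Continuous.aestronglyMeasurable (by fun_prop))
    (Eventually.of_forall (norm_smallKer_mul_le hθ hC hδ hδ1))

theorem exists_integral_smallKer_mul_le (hθ : 0 ≤ θ) (hθπ : π * θ ≤ 1 / 4) (hC : 0 ≤ C) (N : ℕ) :
    ∃ δ : ℝ, 0 < δ ∧ δ ≤ 1 ∧ ∫ z, smallKer θ C (N + 2) z * (1 + δ * |z|) ^ N ≤ 1 / 2 := by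
  have hpos : ∀ n : ℕ, (0 : ℝ) < 1 / ((n : ℝ) + 1) := fun n => by positivity
  have hle : ∀ n : ℕ, 1 / ((n : ℝ) + 1) ≤ 1 := fun n =>
    div_le_one_of_le₀ (by linarith [Nat.cast_nonneg (α := ℝ) n]) (by positivity)
  have hlim : Tendsto (fun n : ℕ => ∫ z, smallKer θ C (N + 2) z * (1 + 1 / ((n : ℝ) + 1) * |z|) ^ N)
      atTop (𝓝 (∫ z, smallKer θ C (N + 2) z)) := by
    refine tendsto_integral_of_dominated_convergence (fun z => C * (1 + z ^ 2)⁻¹)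
      (fun n => (integrable_smallKer_mul hθ hC (hpos n).le (hle n)).aestronglyMeasurable)
      (integrable_inv_one_add_sq.const_mul C)
      (fun n => Eventually.of_forall (norm_smallKer_mul_le hθ hC (hpos n).le (hle n)))
      (Eventually.of_forall fun z => ?_)
    have h1 := (((tendsto_one_div_add_atTop_nhds_zero_nat (𝕜 := ℝ)).mul_const |z|).const_add 1).pow N
    simpa using h1.const_mul (smallKer θ C (N + 2) z)
  have hmass : ∫ z, smallKer θ C (N + 2) z < 1 / 2 := by
    refine lt_of_le_of_lt ?_ (by norm_num : (1 / 4 : ℝ) < 1 / 2)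
    have h1 : ∫ z : ℝ, θ * (1 + z ^ 2)⁻¹ = θ * π := by
      rw [integral_const_mul, integral_univ_inv_one_add_sq]
    calc ∫ z, smallKer θ C (N + 2) z ≤ ∫ z : ℝ, θ * (1 + z ^ 2)⁻¹ :=
          integral_mono_of_nonneg (Eventually.of_forall (smallKer_nonneg hθ hC))
            (integrable_inv_one_add_sq.const_mul θ) (Eventually.of_forall fun z => min_le_left _ _)
      _ ≤ 1 / 4 := by rw [h1, mul_comm]; exact hθπ
  obtain ⟨n, hn⟩ := (hlim.eventually (gt_mem_nhds hmass)).exists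
  exact ⟨_, hpos n, hle n, hn.le⟩

theorem weight_mul_conv_le (hθ : 0 ≤ θ) (hC : 0 ≤ C) {δ : ℝ} (hδ : 0 < δ) (hδ1 : δ ≤ 1)
    (hmass : ∫ z, smallKer θ C (N + 2) z * (1 + δ * |z|) ^ N ≤ 1 / 2) {V G : ℝ → ℝ} {B : ℝ}
    (hV : ∀ a, 0 ≤ V a) (hVV : ∀ a a', V a ≤ V a' * (1 + δ * |a - a'|) ^ N) (hG : ∀ a, 0 ≤ G a)
    (hB0 : 0 ≤ B) (hB : ∀ a, V a * G a ≤ B) (a : ℝ) :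
    V a * ∫ a', smallKer θ C (N + 2) (a - a') * G a' ≤ B / 2 := by
  rw [← integral_const_mul]
  have hi := (integrable_smallKer_mul (N := N) hθ hC hδ.le hδ1).const_mul B
  calc ∫ a', V a * (smallKer θ C (N + 2) (a - a') * G a')
      ≤ ∫ a', B * (smallKer θ C (N + 2) (a - a') * (1 + δ * |a - a'|) ^ N) := by
        refine integral_mono_of_nonneg (Eventually.of_forall fun a' =>
          mul_nonneg (hV a) (mul_nonneg (smallKer_nonneg hθ hC _) (hG a')))
          (hi.comp_sub_left a) (Eventually.of_forall fun a' => ?_)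
        have h1 := smallKer_nonneg (N := N + 2) hθ hC (a - a')
        have h2 := mul_le_mul_of_nonneg_right (hVV a a') (hG a')
        have h3 : (0 : ℝ) ≤ (1 + δ * |a - a'|) ^ N := by positivity
        have h4 := mul_le_mul_of_nonneg_right (hB a') h3
        have h5 : V a * G a' ≤ B * (1 + δ * |a - a'|) ^ N := by
          refine h2.trans (le_trans (le_of_eq ?_) h4)
          ring
        have h6 := mul_le_mul_of_nonneg_left h5 h1
        dsimp only
        linarith
    _ = B * ∫ z, smallKer θ C (N + 2) z * (1 + δ * |z|) ^ N := by
        rw [← integral_const_mul]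
        exact integral_sub_left_eq_self
          (fun z => B * (smallKer θ C (N + 2) z * (1 + δ * |z|) ^ N)) volume a
    _ ≤ B / 2 := by nlinarith

theorem pow_weight_le {δ : ℝ} (hδ : 0 < δ) (N : ℕ) (a a' : ℝ) :
    (1 + δ * |a|) ^ N ≤ (1 + δ * |a'|) ^ N * (1 + δ * |a - a'|) ^ N := by
  rw [← mul_pow]
  refine pow_le_pow_left₀ (by positivity) ?_ N
  have h1 : |a| ≤ |a'| + |a - a'| := by
    have := abs_add_le a' (a - a')
    rwa [add_sub_cancel] at this
  have h2 := mul_le_mul_of_nonneg_left h1 hδ.le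
  have h3 : 0 ≤ δ * |a'| * (δ * |a - a'|) := by positivity
  nlinarith

/-- A weighted a priori estimate for subsolutions of a convolution inequality. -/
theorem weight_mul_le_of_subsolution (hθ : 0 ≤ θ) (hC : 0 ≤ C) {δ : ℝ} (hδ : 0 < δ) (hδ1 : δ ≤ 1)
    (hmass : ∫ z, smallKer θ C (N + 2) z * (1 + δ * |z|) ^ N ≤ 1 / 2) {F G : ℝ → ℝ} {B B₀ : ℝ}
    (hG : ∀ a, 0 ≤ G a) (hGb : ∀ a, G a ≤ B₀) (hB0 : 0 ≤ B) (hB : ∀ a, (1 + δ * |a|) ^ N * F a ≤ B)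
    (hF : ∀ a, 0 ≤ F a)
    (hFG : ∀ a, G a ≤ F a + ∫ a', smallKer θ C (N + 2) (a - a') * G a') (a : ℝ) :
    (1 + δ * |a|) ^ N * G a ≤ 2 * B := by
  set L : ℝ := (1 + δ * |a|) ^ N with hL
  have hL0 : 0 < L := by positivity
  set V : ℝ → ℝ := fun x => min ((1 + δ * |x|) ^ N) L with hVdef
  have hV : ∀ x, 0 ≤ V x := fun x => le_min (by positivity) hL0.le
  have hVV : ∀ x x', V x ≤ V x' * (1 + δ * |x - x'|) ^ N := by
    intro x x'
    have h1 : (1 : ℝ) ≤ (1 + δ * |x - x'|) ^ N :=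
      one_le_pow₀ (by linarith [mul_nonneg hδ.le (abs_nonneg (x - x'))])
    rw [hVdef, min_mul_of_nonneg _ _ (by positivity)]
    exact min_le_min (pow_weight_le hδ N x x') (le_mul_of_one_le_right hL0.le h1)
  have hB₀ : 0 ≤ B₀ := (hG 0).trans (hGb 0)
  have hn : ∀ n : ℕ, ∀ x, V x * G x ≤ 2 * B + L * B₀ * (1 / 2) ^ n := by
    intro n
    induction n with
    | zero =>
      intro x
      have := mul_le_mul (min_le_right ((1 + δ * |x|) ^ N) L) (hGb x) (hG x) hL0.le
      simp only [pow_zero, mul_one]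
      linarith
    | succ n ih =>
      intro x
      have h1 := weight_mul_conv_le hθ hC hδ hδ1 hmass hV hVV hG (by positivity) ih x
      have h2 := mul_le_mul_of_nonneg_left (hFG x) (hV x)
      have h3 : V x * F x ≤ B :=
        (mul_le_mul_of_nonneg_right (min_le_left _ _) (hF x)).trans (hB x)
      rw [mul_add] at h2
      rw [pow_succ]
      linarith
  have hlim : Tendsto (fun n : ℕ => 2 * B + L * B₀ * (1 / 2 : ℝ) ^ n) atTop (𝓝 (2 * B)) := by
    have := ((tendsto_pow_atTop_nhds_zero_of_lt_one (by norm_num : (0 : ℝ) ≤ 1 / 2)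
      (by norm_num)).const_mul (L * B₀)).const_add (2 * B)
    simpa using this
  have := ge_of_tendsto' hlim fun n => hn n a
  simpa [hVdef, hL] using this

end SmallKernel

/-- The operator `P` differs from the identity by an operator with a small kernel. -/
def SmallDefect (θ : ℝ) (P : SchwartzMap ℝ ℂ →ₗ[ℂ] SchwartzMap ℝ ℂ) : Prop :=
  ∀ N, ∃ C : ℝ, 0 ≤ C ∧ ∀ (v : SchwartzMap ℝ ℂ) (a : ℝ),
    ‖P v a - v a‖ ≤ ∫ a', smallKer θ C N (a - a') * ‖v a'‖

namespace SmallDefect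

variable {θ : ℝ} {P : SchwartzMap ℝ ℂ →ₗ[ℂ] SchwartzMap ℝ ℂ}

theorem eq_zero (h : SmallDefect θ P) (hθ : 0 ≤ θ) (hθπ : π * θ ≤ 1 / 4) {v : SchwartzMap ℝ ℂ}
    (hv : P v = 0) : v = 0 := by
  obtain ⟨C, hC, hP⟩ := h (0 + 2)
  obtain ⟨δ, hδ, hδ1, hmass⟩ := exists_integral_smallKer_mul_le hθ hθπ hC 0
  obtain ⟨B, hB⟩ := v.rapidDecay 0
  ext a
  have := weight_mul_le_of_subsolution hθ hC hδ hδ1 hmass (F := fun _ => 0) (G := fun a => ‖v a‖)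
    (B := 0) (B₀ := B) (fun _ => norm_nonneg _) (fun a => by simpa using hB a) le_rfl (by simp)
    (fun _ => le_rfl) (fun a => by
      have := hP v a
      rw [hv] at this
      simpa using this) a
  simp only [pow_zero, one_mul, mul_zero] at this
  simpa using this

theorem exists_geometric_bound (h : SmallDefect θ P) (hθ : 0 ≤ θ) (hθπ : π * θ ≤ 1 / 4)
    {v : ℕ → SchwartzMap ℝ ℂ} (hv : ∀ n, v (n + 1) = v n - P (v n)) (N : ℕ) :
    ∃ B : ℝ, 0 ≤ B ∧ ∀ n a, (1 + |a|) ^ N * ‖v n a‖ ≤ B * (1 / 2) ^ n := by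
  obtain ⟨C, hC, hP⟩ := h (N + 2)
  obtain ⟨δ, hδ, hδ1, hmass⟩ := exists_integral_smallKer_mul_le hθ hθπ hC N
  obtain ⟨B, hB⟩ := (v 0).rapidDecay N
  have hB0 : 0 ≤ B := le_trans (by positivity) (hB 0)
  have key : ∀ n a, (1 + δ * |a|) ^ N * ‖v n a‖ ≤ B * (1 / 2) ^ n := by
    intro n
    induction n with
    | zero =>
      intro a
      refine le_trans ?_ ((hB a).trans (by simp))
      gcongr
      exact mul_le_of_le_one_left (abs_nonneg a) hδ1
    | succ n ih =>
      intro a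
      have h1 := weight_mul_conv_le hθ hC hδ hδ1 hmass (fun a => by positivity)
        (pow_weight_le hδ N) (fun _ => norm_nonneg _) (by positivity) ih a
      have h2 := hP (v n) a
      have h3 : ‖v (n + 1) a‖ = ‖P (v n) a - v n a‖ := by
        rw [hv, norm_sub_rev]
        rfl
      rw [h3, pow_succ]
      calc (1 + δ * |a|) ^ N * ‖P (v n) a - v n a‖ ≤ _ :=
            mul_le_mul_of_nonneg_left h2 (by positivity)
        _ ≤ _ := h1
        _ = _ := by ring
  refine ⟨(δ ^ N)⁻¹ * B, by positivity, fun n a => ?_⟩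
  have h1 : δ ^ N * (1 + |a|) ^ N ≤ (1 + δ * |a|) ^ N := by
    rw [← mul_pow]
    refine pow_le_pow_left₀ (by positivity) ?_ N
    rw [mul_add, mul_one]
    linarith
  rw [mul_assoc, ← div_eq_inv_mul, le_div_iff₀ (by positivity)]
  refine le_trans ?_ (key n a)
  calc (1 + |a|) ^ N * ‖v n a‖ * δ ^ N = δ ^ N * (1 + |a|) ^ N * ‖v n a‖ := by ring
    _ ≤ _ := mul_le_mul_of_nonneg_right h1 (norm_nonneg _)

/-- Sup-norm bound for an operator with small defect. -/
theorem norm_le (h : SmallDefect θ P) (hθ : 0 ≤ θ) (hθπ : π * θ ≤ 1 / 4) {w : SchwartzMap ℝ ℂ}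
    {B : ℝ} (hB : ∀ a, ‖w a‖ ≤ B) (a : ℝ) : ‖P w a‖ ≤ 2 * B := by
  obtain ⟨C, hC, hP⟩ := h (0 + 2)
  obtain ⟨δ, hδ, hδ1, hmass⟩ := exists_integral_smallKer_mul_le hθ hθπ hC 0
  have hB0 : 0 ≤ B := (norm_nonneg _).trans (hB 0)
  have h1 := weight_mul_conv_le hθ hC hδ hδ1 hmass (V := fun _ => 1) (G := fun a => ‖w a‖)
    (fun _ => zero_le_one) (by simp) (fun _ => norm_nonneg _) hB0 (by simpa using hB) a
  rw [one_mul] at h1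
  have h2 := hP w a
  have h3 : ‖P w a‖ ≤ ‖P w a - w a‖ + ‖w a‖ := by
    simpa using norm_add_le (P w a - w a) (w a)
  linarith [hB a]

end SmallDefect

/-- A parametrix argument: if `T T'` and `T' T` are both close to the identity, and `T'` is an
oscillatory integral operator, then `T` is bijective on the Schwartz space. -/
theorem bijective_of_smallDefect {θ : ℝ} (hθ : 0 ≤ θ) (hθπ : π * θ ≤ 1 / 4)
    {T T' : SchwartzMap ℝ ℂ →ₗ[ℂ] SchwartzMap ℝ ℂ} {c : ℝ → ℝ → ℂ} (hc : IsAmplitude c) {z : ℂ}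
    {t : ℝ} (hT' : ∀ v a, T' v a = z * osc t c v a) (h1 : SmallDefect θ (T ∘ₗ T'))
    (h2 : SmallDefect θ (T' ∘ₗ T)) : Function.Bijective T := by
  have inj : ∀ v, T v = 0 → v = 0 := fun v hv => h2.eq_zero hθ hθπ (by simp [hv])
  have inj' : ∀ v, T' v = 0 → v = 0 := fun v hv => h1.eq_zero hθ hθπ (by simp [hv])
  refine ⟨(injective_iff_map_eq_zero T).2 inj, fun f => ?_⟩
  obtain ⟨K, hK0, hK⟩ := hc.bound
  -- the Neumann series
  let v : ℕ → SchwartzMap ℝ ℂ := fun n => Nat.rec f (fun _ w => w - T (T' w)) n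
  have hv0 : v 0 = f := rfl
  have hvs : ∀ n, v (n + 1) = v n - (T ∘ₗ T') (v n) := fun n => rfl
  have hgeo := h1.exists_geometric_bound hθ hθπ hvs
  let S : ℕ → SchwartzMap ℝ ℂ := fun n => ∑ j ∈ Finset.range n, v j
  have hS : ∀ n, T (T' (S n)) = f - v n := by
    intro n
    induction n with
    | zero => simp [S, hv0]
    | succ n ih =>
      have : S (n + 1) = S n + v n := Finset.sum_range_succ _ _
      rw [this, map_add, map_add, ih, hvs]
      simp only [LinearMap.comp_apply]
      abel
  let u : ℝ → ℂ := fun a => ∑' n, v n a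
  have hgs : ∀ n, HasSum (fun k : ℕ => (1 / 2 : ℝ) ^ (k + n)) (2 * (1 / 2) ^ n) := by
    intro n
    simpa [pow_add] using hasSum_geometric_two.mul_right ((1 / 2 : ℝ) ^ n)
  have htail : ∀ N, ∃ B : ℝ, 0 ≤ B ∧ ∀ n a, (1 + |a|) ^ N * ‖u a - S n a‖ ≤ B * (1 / 2) ^ n := by
    intro N
    obtain ⟨B, hB0, hB⟩ := hgeo N
    refine ⟨2 * B, by positivity, fun n a => ?_⟩
    have hX : 0 < (1 + |a|) ^ N := by positivity
    have hB' : ∀ n, ‖v n a‖ ≤ ((1 + |a|) ^ N)⁻¹ * B * (1 / 2) ^ n := fun n => by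
      rw [mul_assoc, ← div_eq_inv_mul, le_div_iff₀ hX, mul_comm]
      exact hB n a
    have hsum : Summable (fun n => v n a) :=
      Summable.of_norm_bounded (summable_geometric_two.mul_left _) hB'
    have e : u a - S n a = ∑' k, v (k + n) a := by
      have h3 := hsum.sum_add_tsum_nat_add n
      have h4 : S n a = ∑ j ∈ Finset.range n, v j a := by
        simp only [S]
        rw [sum_apply]
      rw [h4, sub_eq_iff_eq_add', h3]
    have h5 : ‖∑' k, v (k + n) a‖ ≤ ((1 + |a|) ^ N)⁻¹ * B * (2 * (1 / 2) ^ n) :=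
      tsum_of_norm_bounded ((hgs n).mul_left _) fun k => hB' (k + n)
    rw [e]
    calc (1 + |a|) ^ N * ‖∑' k, v (k + n) a‖
        ≤ (1 + |a|) ^ N * (((1 + |a|) ^ N)⁻¹ * B * (2 * (1 / 2) ^ n)) :=
          mul_le_mul_of_nonneg_left h5 hX.le
      _ = _ := by field_simp
  have hu : RapidDecay u := by
    intro N
    obtain ⟨B, -, hB⟩ := htail N
    exact ⟨B, fun a => by simpa [S] using hB 0 a⟩
  have huc : Continuous u := by
    obtain ⟨B, -, hB⟩ := hgeo 0
    exact continuous_tsum (fun n => (v n).continuous) (summable_geometric_two.mul_left B)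
      fun n a => by simpa using hB n a
  -- the candidate preimage
  set g : ℝ → ℂ := fun a => z * osc t c u a with hg
  obtain ⟨D, hD0, hD⟩ : ∃ D : ℝ, 0 ≤ D ∧ ∀ n a, ‖g a - T' (S n) a‖ ≤ D * (1 / 2) ^ n := by
    obtain ⟨B, hB0, hB⟩ := htail 2
    refine ⟨‖z‖ * (K * (B * π)), by positivity, fun n a => ?_⟩
    have i1 := integrable_osc t hK hc.measurable (hu.integrable huc) a
    have i2 := integrable_osc t hK hc.measurable (S n).integrable a
    have e : g a - T' (S n) a = z * osc t c (fun b => u b - S n b) a := by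
      rw [hg, hT']
      simp only [osc]
      rw [← mul_sub, ← integral_sub i1 i2]
      congr 2
      ext b
      ring
    have i3 : Integrable (fun b => u b - S n b) := (hu.integrable huc).sub (S n).integrable
    rw [e, norm_mul, mul_assoc]
    refine mul_le_mul_of_nonneg_left ((norm_osc_le t hK i3 a).trans ?_) (norm_nonneg z)
    rw [mul_assoc]
    refine mul_le_mul_of_nonneg_left ?_ hK0
    calc ∫ b, ‖u b - S n b‖ ≤ ∫ b : ℝ, B * (1 / 2) ^ n * (1 + b ^ 2)⁻¹ := by
          refine integral_mono_of_nonneg (Eventually.of_forall fun _ => norm_nonneg _)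
            (integrable_inv_one_add_sq.const_mul _) (Eventually.of_forall fun b => ?_)
          dsimp only
          rw [← div_eq_mul_inv, le_div_iff₀ (by positivity), mul_comm]
          exact (mul_le_mul_of_nonneg_right (one_add_sq_le_one_add_abs_sq b)
            (norm_nonneg _)).trans (hB n b)
      _ = _ := by
          rw [integral_const_mul, integral_univ_inv_one_add_sq]
          ring
  have hhalf : Tendsto (fun n : ℕ => (1 / 2 : ℝ) ^ n) atTop (𝓝 0) :=
    tendsto_pow_atTop_nhds_zero_of_lt_one (by norm_num) (by norm_num)
  have hTv : ∀ a, Tendsto (fun n => T' (v n) a) atTop (𝓝 0) := by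
    intro a
    have hx : ∀ n, T' (v n) a = (g a - T' (S n) a) - (g a - T' (S (n + 1)) a) := by
      intro n
      have : S (n + 1) = S n + v n := Finset.sum_range_succ _ _
      rw [this, map_add, add_apply]
      ring
    refine squeeze_zero_norm (a := fun n => 2 * D * (1 / 2) ^ n) (fun n => ?_)
      (by simpa using hhalf.const_mul (2 * D))
    rw [hx]
    have h3 := hD (n + 1) a
    have h4 : D * (1 / 2 : ℝ) ^ (n + 1) ≤ D * (1 / 2) ^ n := by
      rw [pow_succ]
      nlinarith [mul_nonneg hD0 (pow_nonneg (by norm_num : (0 : ℝ) ≤ 1 / 2) n)]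
    linarith [norm_sub_le (g a - T' (S n) a) (g a - T' (S (n + 1)) a), hD n a]
  have hPg : ∀ n a, T' (T (T' (S n))) a = T' f a - T' (v n) a := by
    intro n a
    rw [hS, map_sub]
    rfl
  have hgs' := hc.contDiff_osc t hu huc
  have hgsmooth : ContDiff ℝ (⊤ : ℕ∞) g := contDiff_const.mul hgs'
  have hgb : ∀ n, ∃ C : ℝ, ∀ x, ‖iteratedDeriv n g x‖ ≤ C := by
    intro n
    obtain ⟨C, hC⟩ := hc.iteratedDeriv_osc_bound t hu huc n
    refine ⟨‖z‖ * C, fun x => ?_⟩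
    have : iteratedDeriv n g x = z * iteratedDeriv n (osc t c u) x :=
      iteratedDeriv_const_mul z ((hgs'.of_le (by exact_mod_cast le_top)).contDiffAt)
    rw [this, norm_mul]
    exact mul_le_mul_of_nonneg_left (hC x) (norm_nonneg z)
  have hgr : RapidDecay g := by
    intro N
    obtain ⟨C, hC, hP⟩ := h2 (N + 2)
    obtain ⟨δ, hδ, hδ1, hmass⟩ := exists_integral_smallKer_mul_le hθ hθπ hC N
    obtain ⟨B₀, hB₀⟩ := hgb 0
    simp only [iteratedDeriv_zero] at hB₀
    obtain ⟨B, hB⟩ := (T' f).rapidDecay N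
    have hB0 : 0 ≤ B := le_trans (by positivity) (hB 0)
    have hker : Integrable (smallKer θ C (N + 2)) := by
      have := integrable_smallKer_mul (N := N) hθ hC le_rfl (zero_le_one' ℝ)
      simpa using this
    have hkg : ∀ a, Integrable (fun a' => smallKer θ C (N + 2) (a - a') * ‖g a'‖) := fun a =>
      (hker.comp_sub_left a).mul_bdd (c := B₀) hgsmooth.continuous.norm.aestronglyMeasurable
        (Eventually.of_forall fun a' => by rw [norm_norm]; exact hB₀ a')
    have hsub : ∀ a, ‖g a‖ ≤ ‖T' f a‖ + ∫ a', smallKer θ C (N + 2) (a - a') * ‖g a'‖ := by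
      intro a
      have hn : ∀ n : ℕ, ‖g a‖ ≤ (‖T' f a‖ + ∫ a', smallKer θ C (N + 2) (a - a') * ‖g a'‖) +
          (‖T' (v n) a‖ + D * (1 / 2) ^ n * (1 + ∫ a', smallKer θ C (N + 2) (a - a'))) := by
        intro n
        have e1 := hP (T' (S n)) a
        rw [LinearMap.comp_apply, hPg] at e1
        have e2 : ∫ a', smallKer θ C (N + 2) (a - a') * ‖T' (S n) a'‖ ≤
            (∫ a', smallKer θ C (N + 2) (a - a') * ‖g a'‖) +
              D * (1 / 2) ^ n * ∫ a', smallKer θ C (N + 2) (a - a') := by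
          rw [← integral_const_mul, ← integral_add (hkg a)
            ((hker.comp_sub_left a).const_mul _)]
          refine integral_mono_of_nonneg (Eventually.of_forall fun a' =>
            mul_nonneg (smallKer_nonneg hθ hC _) (norm_nonneg _))
            ((hkg a).add ((hker.comp_sub_left a).const_mul _)) (Eventually.of_forall fun a' => ?_)
          have h3 : ‖T' (S n) a'‖ ≤ ‖g a'‖ + D * (1 / 2) ^ n := by
            have := norm_sub_norm_le (T' (S n) a') (g a')
            rw [norm_sub_rev] at this
            linarith [hD n a']
          have h4 := mul_le_mul_of_nonneg_left h3 (smallKer_nonneg (N := N + 2) hθ hC (a - a'))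
          dsimp only
          linarith
        have e3 : ‖g a‖ ≤ ‖g a - T' (S n) a‖ + ‖T' f a - T' (v n) a - T' (S n) a‖ +
            (‖T' f a‖ + ‖T' (v n) a‖) := by
          have e : g a = (g a - T' (S n) a) - (T' f a - T' (v n) a - T' (S n) a) +
            (T' f a - T' (v n) a) := by ring
          calc ‖g a‖ = ‖(g a - T' (S n) a) - (T' f a - T' (v n) a - T' (S n) a) +
            (T' f a - T' (v n) a)‖ := by rw [← e]
            _ ≤ _ := (norm_add_le _ _).trans (add_le_add (norm_sub_le _ _) (norm_sub_le _ _))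
        linarith [hD n a]
      have hlim := (((hTv a).norm).add ((hhalf.const_mul D).mul_const
        (1 + ∫ a', smallKer θ C (N + 2) (a - a')))).const_add
        (‖T' f a‖ + ∫ a', smallKer θ C (N + 2) (a - a') * ‖g a'‖)
      simp only [norm_zero, mul_zero, zero_mul, add_zero] at hlim
      exact ge_of_tendsto' hlim hn
    have hfin := weight_mul_le_of_subsolution hθ hC hδ hδ1 hmass (fun _ => norm_nonneg _) hB₀ hB0
      (F := fun a => ‖T' f a‖) (fun a => by
        refine le_trans ?_ (hB a)
        gcongr
        exact mul_le_of_le_one_left (abs_nonneg a) hδ1) (fun _ => norm_nonneg _) hsub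
    refine ⟨(δ ^ N)⁻¹ * (2 * B), fun a => ?_⟩
    have h3 : δ ^ N * (1 + |a|) ^ N ≤ (1 + δ * |a|) ^ N := by
      rw [← mul_pow]
      refine pow_le_pow_left₀ (by positivity) ?_ N
      rw [mul_add, mul_one]
      linarith
    rw [← div_eq_inv_mul, le_div_iff₀ (by positivity)]
    refine le_trans ?_ (hfin a)
    calc (1 + |a|) ^ N * ‖g a‖ * δ ^ N = δ ^ N * (1 + |a|) ^ N * ‖g a‖ := by ring
      _ ≤ _ := mul_le_mul_of_nonneg_right h3 (norm_nonneg _)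
  let G : SchwartzMap ℝ ℂ := schwartzOfRapidDecay g hgr hgsmooth hgb
  refine ⟨G, ?_⟩
  have hG : T' (T G) = T' f := by
    ext a
    have hlim1 : Tendsto (fun n => T' (T (T' (S n))) a) atTop (𝓝 (T' f a)) := by
      simp only [hPg]
      simpa using (hTv a).const_sub (T' f a)
    have hlim2 : Tendsto (fun n => T' (T (T' (S n))) a) atTop (𝓝 (T' (T G) a)) := by
      rw [tendsto_iff_norm_sub_tendsto_zero]
      refine squeeze_zero (fun _ => norm_nonneg _) (g := fun n => 2 * (D * (1 / 2) ^ n))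
        (fun n => ?_) (by simpa using (hhalf.const_mul D).const_mul 2)
      have h3 := h2.norm_le hθ hθπ (w := G - T' (S n)) (hD n) a
      rw [map_sub, LinearMap.comp_apply, LinearMap.comp_apply, sub_apply] at h3
      rwa [norm_sub_rev]
    exact tendsto_nhds_unique hlim2 hlim1
  have := inj' (T G - f) (by rw [map_sub, hG, sub_self])
  exact sub_eq_zero.1 this

section Brackets

theorem le_jbh (h ξ : ℝ) : h ≤ jbh h ξ := Real.le_sqrt_of_sq_le (by nlinarith [sq_nonneg ξ])

theorem abs_le_jbh (h ξ : ℝ) : |ξ| ≤ jbh h ξ :=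
  Real.abs_le_sqrt (by nlinarith [sq_nonneg h])

theorem jbh_pos {h : ℝ} (hh : 1 ≤ h) (ξ : ℝ) : 0 < jbh h ξ := by
  linarith [le_jbh h ξ]

theorem one_le_jbh {h : ℝ} (hh : 1 ≤ h) (ξ : ℝ) : 1 ≤ jbh h ξ := hh.trans (le_jbh h ξ)

theorem jb_eq_jbh (x : ℝ) : jb x = jbh 1 x := by rw [jb, jbh, one_pow]

theorem one_le_jb (x : ℝ) : 1 ≤ jb x := by
  rw [jb_eq_jbh]
  exact one_le_jbh le_rfl x

theorem jb_pos (x : ℝ) : 0 < jb x := zero_lt_one.trans_le (one_le_jb x)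

theorem abs_le_jb (x : ℝ) : |x| ≤ jb x := by
  rw [jb_eq_jbh]
  exact abs_le_jbh 1 x

theorem jb_le_jbh {h : ℝ} (hh : 1 ≤ h) (ξ : ℝ) : jb ξ ≤ jbh h ξ :=
  Real.sqrt_le_sqrt (by nlinarith)

theorem continuous_jb : Continuous jb := by
  unfold jb
  fun_prop

theorem hasDerivAt_jbh {h : ℝ} (hh : 1 ≤ h) (ξ : ℝ) :
    HasDerivAt (jbh h) (ξ * (jbh h ξ)⁻¹) ξ := by
  have h0 : h ^ 2 + ξ ^ 2 ≠ 0 := by positivity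
  have h1 : HasDerivAt (fun ξ : ℝ => h ^ 2 + ξ ^ 2) (2 * ξ) ξ := by
    simpa using (hasDerivAt_pow 2 ξ).const_add (h ^ 2)
  refine (h1.sqrt h0).congr_deriv ?_
  change 2 * ξ / (2 * jbh h ξ) = _
  have := (jbh_pos hh ξ).ne'
  field_simp

theorem hasDerivAt_jb (x : ℝ) : HasDerivAt jb (x * (jb x)⁻¹) x := by
  have : jb = jbh 1 := funext jb_eq_jbh
  rw [this]
  exact hasDerivAt_jbh le_rfl x

/-- The reciprocal bracket. -/
def recip (h : {h : ℝ // 1 ≤ h}) (ξ : ℝ) : ℝ := (jbh h ξ)⁻¹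

theorem recip_nonneg (h : {h : ℝ // 1 ≤ h}) (ξ : ℝ) : 0 ≤ recip h ξ :=
  inv_nonneg.2 (jbh_pos h.2 ξ).le

theorem recip_le_one (h : {h : ℝ // 1 ≤ h}) (ξ : ℝ) : recip h ξ ≤ 1 :=
  inv_le_one_of_one_le₀ (one_le_jbh h.2 ξ)

/-- The derivative of the bracket. -/
def unitSlope (h : {h : ℝ // 1 ≤ h}) (ξ : ℝ) : ℝ := ξ * recip h ξ

theorem abs_unitSlope_le (h : {h : ℝ // 1 ≤ h}) (ξ : ℝ) : |unitSlope h ξ| ≤ 1 := by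
  rw [unitSlope, recip, abs_mul, abs_inv, abs_of_pos (jbh_pos h.2 ξ), ← div_eq_mul_inv,
    div_le_one (jbh_pos h.2 ξ)]
  exact abs_le_jbh _ _

theorem hasDerivAt_recip (h : {h : ℝ // 1 ≤ h}) (ξ : ℝ) :
    HasDerivAt (recip h) (-1 * (unitSlope h ξ * (recip h ξ * recip h ξ))) ξ := by
  refine ((hasDerivAt_jbh h.2 ξ).inv (jbh_pos h.2 ξ).ne').congr_deriv ?_
  rw [unitSlope, recip]
  have := (jbh_pos h.2 ξ).ne'
  field_simp

theorem hasDerivAt_unitSlope (h : {h : ℝ // 1 ≤ h}) (ξ : ℝ) :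
    HasDerivAt (unitSlope h) (recip h ξ + -1 * (unitSlope h ξ * (unitSlope h ξ * recip h ξ))) ξ := by
  refine ((hasDerivAt_id ξ).mul (hasDerivAt_recip h ξ)).congr_deriv ?_
  simp only [id, unitSlope]
  ring

theorem symEst_recip_and_unitSlope :
    SymEst recip recip recip ∧ SymEst recip (fun _ _ => 1) unitSlope := by
  rw [SymEst, SymEst, ← forall_and]
  intro n
  have b1 : ∀ i x, ‖recip i x‖ ≤ 1 * recip i x := fun i x => by
    rw [one_mul, Real.norm_eq_abs, abs_of_nonneg (recip_nonneg i x)]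
  have b2 : ∀ i x, ‖unitSlope i x‖ ≤ 1 * 1 := fun i x => by
    rw [one_mul]
    exact abs_unitSlope_le i x
  induction n with
  | zero =>
    exact ⟨symUpTo_zero (fun i => continuous_iff_continuousAt.2 fun x =>
      (hasDerivAt_recip i x).continuousAt) zero_le_one b1,
      symUpTo_zero (fun i => continuous_iff_continuousAt.2 fun x =>
      (hasDerivAt_unitSlope i x).continuousAt) zero_le_one b2⟩
  | succ n ih =>
    obtain ⟨i1, i2⟩ := ih
    refine ⟨symUpTo_succ zero_le_one b1 hasDerivAt_recip ?_,
      symUpTo_succ zero_le_one b2 hasDerivAt_unitSlope ?_⟩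
    · simpa only [one_mul] using (i2.mul (i1.mul i1)).const_mul (-1)
    · have := (i2.mul (i2.mul i1)).const_mul (-1)
      simp only [one_mul] at this ⊢
      exact i1.add this

/-- The logarithmic derivative of a power of the bracket. -/
theorem symEst_slope_mul_recip (c : ℝ) :
    SymEst recip recip (fun h ξ => c * (unitSlope h ξ * recip h ξ)) := by
  have := (symEst_recip_and_unitSlope.2.mul symEst_recip_and_unitSlope.1).const_mul c
  simpa only [one_mul] using this

theorem hasDerivAt_jbh_rpow {h : {h : ℝ // 1 ≤ h}} (r ξ : ℝ) :
    HasDerivAt (fun ξ => jbh h ξ ^ r) (jbh h ξ ^ r * (r * (unitSlope h ξ * recip h ξ))) ξ := by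
  refine ((hasDerivAt_jbh h.2 ξ).rpow_const (p := r) (Or.inl (jbh_pos h.2 ξ).ne')).congr_deriv ?_
  rw [unitSlope, recip, Real.rpow_sub_one (jbh_pos h.2 ξ).ne']
  ring

theorem symEst_jbh_rpow (r : ℝ) :
    SymEst recip (fun h ξ => jbh h ξ ^ r) (fun h ξ => jbh h ξ ^ r) :=
  sym_of_chain (f := fun _ (h : {h : ℝ // 1 ≤ h}) ξ => jbh h ξ ^ r) (C := fun _ => 1) (fun _ => zero_le_one)
    (fun _ i x => by
      rw [one_mul, Real.norm_eq_abs, abs_of_nonneg (Real.rpow_nonneg (jbh_pos i.2 x).le r)])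
    (fun _ i x => hasDerivAt_jbh_rpow r x) (fun _ => symEst_slope_mul_recip r) 0

theorem symEst_of_index {ι : Type*} {g : ι → ℝ → ℝ} (hg : ∀ i x, 0 ≤ g i x) {c w : ι → ℝ}
    (hw : ∀ i, |c i| ≤ w i) : SymEst g (fun i _ => w i) (fun i _ => c i) := by
  refine fun n => ⟨fun i => contDiff_const, fun j _ => ⟨1, zero_le_one, fun i x => ?_⟩⟩
  rw [iteratedDeriv_const, one_mul]
  have := (abs_nonneg _).trans (hw i)
  split_ifs with hj
  · subst hj
    simpa using hw i
  · rw [norm_zero]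
    exact mul_nonneg this (pow_nonneg (hg i x) j)

end Brackets

section EulerDerivatives

/-- The iterates of `t · d/dt`. -/
def eulerIter (ψ : ℝ → ℝ) : ℕ → ℝ → ℝ
  | 0 => ψ
  | j + 1 => fun t => t * deriv (eulerIter ψ j) t

theorem contDiff_deriv_infty {f : ℝ → ℝ} (hf : ContDiff ℝ (⊤ : ℕ∞) f) :
    ContDiff ℝ (⊤ : ℕ∞) (deriv f) :=
  ContDiff.iterate_deriv 1 hf

variable {ψ : ℝ → ℝ}

theorem contDiff_eulerIter (hψ : ContDiff ℝ (⊤ : ℕ∞) ψ) (j : ℕ) :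
    ContDiff ℝ (⊤ : ℕ∞) (eulerIter ψ j) := by
  induction j with
  | zero => exact hψ
  | succ j ih => exact contDiff_id.mul (contDiff_deriv_infty ih)

theorem eulerIter_eq_zero (hψ : ContDiff ℝ (⊤ : ℕ∞) ψ) (hψ0 : ∀ y, 1 ≤ |y| → ψ y = 0) (j : ℕ) (y : ℝ)
    (hy : 1 ≤ |y|) : eulerIter ψ j y = 0 := by
  induction j generalizing y with
  | zero => exact hψ0 y hy
  | succ j ih =>
    have hz : ∀ y : ℝ, 1 < |y| → deriv (eulerIter ψ j) y = 0 := by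
      intro y hy
      have : eulerIter ψ j =ᶠ[𝓝 y] fun _ => 0 := by
        filter_upwards [(isOpen_lt continuous_const continuous_abs).mem_nhds hy] with z hz
        exact ih z (le_of_lt hz)
      rw [this.deriv_eq, deriv_const]
    have hcl : ({y : ℝ | 1 ≤ |y|}) ⊆ closure {y : ℝ | 1 < |y|} := by
      intro y hy
      rw [mem_ofPred_eq] at hy
      rw [Metric.mem_closure_iff]
      intro ε hε
      have hy0 : 0 < |y| := by linarith
      refine ⟨y + ε / 2 * SignType.sign y, ?_, ?_⟩
      · rcases abs_cases y with ⟨h1, h2⟩ | ⟨h1, h2⟩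
        · have : 0 < y := by linarith
          simp only [sign_pos this, SignType.coe_one, mem_ofPred_eq]
          rw [abs_of_pos (by linarith)]
          linarith
        · simp only [sign_neg h2, SignType.coe_neg_one, mem_ofPred_eq]
          rw [abs_of_neg (by linarith)]
          linarith
      · rw [dist_eq_norm, sub_add_cancel_left, norm_neg, norm_mul, Real.norm_eq_abs, Real.norm_eq_abs,
          abs_of_pos (by linarith : (0 : ℝ) < ε / 2)]
        rcases abs_cases y with ⟨h1, h2⟩ | ⟨h1, h2⟩
        · have : 0 < y := by linarith
          simp [sign_pos this, hε]
        · simp [sign_neg h2, hε]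
    have : ∀ y ∈ closure {y : ℝ | 1 < |y|}, deriv (eulerIter ψ j) y = 0 := fun y hy =>
      closure_minimal (s := {y : ℝ | 1 < |y|}) (t := {y | deriv (eulerIter ψ j) y = 0}) hz
        (isClosed_eq ((contDiff_deriv_infty (contDiff_eulerIter hψ j)).continuous) continuous_const) hy
    change y * deriv (eulerIter ψ j) y = 0
    rw [this y (hcl hy), mul_zero]

theorem exists_bound_of_eq_zero {f : ℝ → ℝ} (hf : Continuous f) (r : ℝ)
    (h0 : ∀ y, r ≤ |y| → f y = 0) : ∃ C : ℝ, 0 ≤ C ∧ ∀ y, |f y| ≤ C := by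
  obtain ⟨C, hC⟩ := (isCompact_Icc (a := -r) (b := r)).exists_bound_of_continuousOn hf.continuousOn
  refine ⟨max C 0, le_max_right _ _, fun y => ?_⟩
  by_cases hy : |y| ≤ r
  · exact (hC y (abs_le.1 hy)).trans (le_max_left _ _)
  · rw [h0 y (not_le.1 hy).le, abs_zero]
    exact le_max_right _ _

/-- The iterates of `⟨ζ⟩ · d/dζ`. -/
def bracketIter (ω : ℝ → ℝ) : ℕ → ℝ → ℝ
  | 0 => ω
  | j + 1 => fun t => jb t * deriv (bracketIter ω j) t

theorem contDiff_jb : ContDiff ℝ (⊤ : ℕ∞) jb := by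
  refine ContDiff.sqrt (by fun_prop) fun x => ?_
  positivity

variable {ω : ℝ → ℝ}

theorem contDiff_bracketIter (hω : ContDiff ℝ (⊤ : ℕ∞) ω) (j : ℕ) :
    ContDiff ℝ (⊤ : ℕ∞) (bracketIter ω j) := by
  induction j with
  | zero => exact hω
  | succ j ih => exact contDiff_jb.mul (contDiff_deriv_infty ih)

theorem bracketIter_succ_eq_zero {R : ℝ} (hωcp : ∀ ξ₁ ξ₂ : ℝ, R ≤ ξ₁ → R ≤ ξ₂ → ω ξ₁ = ω ξ₂)
    (hωcm : ∀ ξ₁ ξ₂ : ℝ, ξ₁ ≤ -R → ξ₂ ≤ -R → ω ξ₁ = ω ξ₂) (j : ℕ) (y : ℝ) (hy : R < |y|) :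
    bracketIter ω (j + 1) y = 0 := by
  have key : ∀ f : ℝ → ℝ, (∀ z, R < |z| → f =ᶠ[𝓝 z] fun _ => f z) →
      ∀ y, R < |y| → jb y * deriv f y = 0 := by
    intro f hf y hy
    rw [(hf y hy).deriv_eq, deriv_const, mul_zero]
  induction j generalizing y with
  | zero =>
    refine key ω (fun z hz => ?_) y hy
    rcases lt_abs.1 hz with h | h
    · filter_upwards [lt_mem_nhds h] with x hx
      exact hωcp _ _ hx.le h.le
    · filter_upwards [gt_mem_nhds (show z < -R by linarith)] with x hx
      exact hωcm _ _ hx.le (by linarith)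
  | succ j ih =>
    refine key (bracketIter ω (j + 1)) (fun z hz => ?_) y hy
    filter_upwards [(isOpen_lt continuous_const continuous_abs).mem_nhds hz] with x hx
    rw [ih x hx, ih z hz]

theorem exists_bound_bracketIter {R : ℝ} (hω : ContDiff ℝ (⊤ : ℕ∞) ω) (hωb : ∀ ξ : ℝ, |ω ξ| ≤ 1)
    (hωcp : ∀ ξ₁ ξ₂ : ℝ, R ≤ ξ₁ → R ≤ ξ₂ → ω ξ₁ = ω ξ₂)
    (hωcm : ∀ ξ₁ ξ₂ : ℝ, ξ₁ ≤ -R → ξ₂ ≤ -R → ω ξ₁ = ω ξ₂) (j : ℕ) :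
    ∃ C : ℝ, 0 ≤ C ∧ ∀ y, |bracketIter ω j y| ≤ C := by
  rcases j with _ | j
  · exact ⟨1, zero_le_one, hωb⟩
  · refine exists_bound_of_eq_zero (contDiff_bracketIter hω _).continuous (R + 1) fun y hy =>
      bracketIter_succ_eq_zero hωcp hωcm j y (by linarith)

theorem hasDerivAt_bracketIter_div (hω : ContDiff ℝ (⊤ : ℕ∞) ω) (j : ℕ) (h : {h : ℝ // 1 ≤ h})
    (ξ : ℝ) : HasDerivAt (fun ξ => bracketIter ω j (ξ / h))
      (bracketIter ω (j + 1) (ξ / h) * recip h ξ) ξ := by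
  have h0 : (0 : ℝ) < h := zero_lt_one.trans_le h.2
  have h1 := ((contDiff_bracketIter hω j).differentiable (by simp) (ξ / h)).hasDerivAt
  refine (h1.comp ξ ((hasDerivAt_id ξ).div_const (h : ℝ))).congr_deriv ?_
  change _ = jb (ξ / h) * deriv (bracketIter ω j) (ξ / h) * recip h ξ
  have h2 : jbh h ξ = h * jb (ξ / h) := by
    rw [jbh, jb, ← Real.sqrt_sq h0.le, ← Real.sqrt_mul (sq_nonneg _), Real.sqrt_sq h0.le]
    congr 1
    field_simp
  have h3 := (jb_pos (ξ / h)).ne'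
  rw [recip, h2]
  field_simp

theorem symEst_freq_cutoff {R : ℝ} (hω : ContDiff ℝ (⊤ : ℕ∞) ω) (hωb : ∀ ξ : ℝ, |ω ξ| ≤ 1)
    (hωcp : ∀ ξ₁ ξ₂ : ℝ, R ≤ ξ₁ → R ≤ ξ₂ → ω ξ₁ = ω ξ₂)
    (hωcm : ∀ ξ₁ ξ₂ : ℝ, ξ₁ ≤ -R → ξ₂ ≤ -R → ω ξ₁ = ω ξ₂) :
    SymEst recip (fun _ _ => 1) (fun h ξ => ω (ξ / h)) := by
  choose C hC0 hC using exists_bound_bracketIter hω hωb hωcp hωcm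
  exact sym_of_chain (f := fun j (h : {h : ℝ // 1 ≤ h}) ξ => bracketIter ω j (ξ / h)) hC0
    (fun j i x => by
      rw [mul_one]
      exact hC j _)
    (hasDerivAt_bracketIter_div hω) (fun _ => symEst_recip_and_unitSlope.1) 0

end EulerDerivatives

section TruncatedIntegral

variable {ψ : ℝ → ℝ} {q s : ℝ}

/-- The truncated weight `⟨y⟩^(-s) χ(⟨y⟩ / ⟨ξ⟩ₕ^q)` with `χ` an Euler iterate of `ψ`. -/
def truncWeight (ψ : ℝ → ℝ) (s q : ℝ) (j : ℕ) (h : {h : ℝ // 1 ≤ h}) (y ξ : ℝ) : ℝ :=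
  jb y ^ (-s) * eulerIter ψ j (jb y / jbh h ξ ^ q)

theorem continuous_truncWeight (hψ : ContDiff ℝ (⊤ : ℕ∞) ψ) (j : ℕ) (h : {h : ℝ // 1 ≤ h}) (ξ : ℝ) :
    Continuous fun y => truncWeight ψ s q j h y ξ :=
  (continuous_jb.rpow_const fun y => Or.inl (jb_pos y).ne').mul
    ((contDiff_eulerIter hψ j).continuous.comp (continuous_jb.div_const _))

theorem hasDerivAt_eulerIter_comp {f : ℝ → ℝ} {f' x : ℝ} (hψ : ContDiff ℝ (⊤ : ℕ∞) ψ) (j : ℕ)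
    (hf : HasDerivAt f (f x * f') x) :
    HasDerivAt (fun x => eulerIter ψ j (f x)) (eulerIter ψ (j + 1) (f x) * f') x := by
  have h1 := ((contDiff_eulerIter hψ j).differentiable (by simp) (f x)).hasDerivAt
  refine (h1.comp x hf).congr_deriv ?_
  rw [eulerIter]
  ring

theorem hasDerivAt_truncWeight (hψ : ContDiff ℝ (⊤ : ℕ∞) ψ) (j : ℕ) (h : {h : ℝ // 1 ≤ h})
    (y ξ : ℝ) : HasDerivAt (truncWeight ψ s q j h y)
      (truncWeight ψ s q (j + 1) h y ξ * (-q * (unitSlope h ξ * recip h ξ))) ξ := by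
  have hp := jbh_pos h.2 ξ
  have h1 : HasDerivAt (fun ξ => jb y / jbh h ξ ^ q)
      (jb y / jbh h ξ ^ q * (-q * (unitSlope h ξ * recip h ξ))) ξ := by
    refine ((hasDerivAt_const ξ (jb y)).div (hasDerivAt_jbh_rpow (h := h) q ξ)
      (Real.rpow_pos_of_pos hp q).ne').congr_deriv ?_
    have := (Real.rpow_pos_of_pos hp q).ne'
    field_simp
    ring
  refine ((hasDerivAt_eulerIter_comp hψ j h1).const_mul (jb y ^ (-s))).congr_deriv ?_
  rw [truncWeight]
  ring

theorem jb_rpow_neg_le_one (hs : 0 ≤ s) (y : ℝ) : jb y ^ (-s) ≤ 1 :=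
  Real.rpow_le_one_of_one_le_of_nonpos (one_le_jb y) (by linarith)

theorem exists_bound_eulerIter (hψ : ContDiff ℝ (⊤ : ℕ∞) ψ) (hψ0 : ∀ y, 1 ≤ |y| → ψ y = 0) (j : ℕ) :
    ∃ C : ℝ, 0 ≤ C ∧ ∀ y, |eulerIter ψ j y| ≤ C :=
  exists_bound_of_eq_zero (contDiff_eulerIter hψ j).continuous 1 (eulerIter_eq_zero hψ hψ0 j)

theorem abs_truncWeight_le {C : ℝ} {j : ℕ} (hC : ∀ y, |eulerIter ψ j y| ≤ C) (h : {h : ℝ // 1 ≤ h})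
    (y ξ : ℝ) : |truncWeight ψ s q j h y ξ| ≤ C * jb y ^ (-s) := by
  rw [truncWeight, abs_mul, abs_of_nonneg (Real.rpow_nonneg (jb_pos y).le _), mul_comm]
  exact mul_le_mul_of_nonneg_right (hC _) (Real.rpow_nonneg (jb_pos y).le _)

theorem truncWeight_eq_zero (hψ : ContDiff ℝ (⊤ : ℕ∞) ψ) (hψ0 : ∀ y, 1 ≤ |y| → ψ y = 0) (j : ℕ)
    (h : {h : ℝ // 1 ≤ h}) {y ξ : ℝ} (hy : jbh h ξ ^ q ≤ jb y) : truncWeight ψ s q j h y ξ = 0 := by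
  have hp := Real.rpow_pos_of_pos (jbh_pos h.2 ξ) q
  rw [truncWeight, eulerIter_eq_zero hψ hψ0, mul_zero]
  rw [abs_of_pos (div_pos (jb_pos y) hp), one_le_div hp]
  exact hy

/-- The primitive of the truncated weight. -/
def truncInt (ψ : ℝ → ℝ) (s q : ℝ) (j : ℕ) (h : {h : ℝ // 1 ≤ h}) (x ξ : ℝ) : ℝ :=
  ∫ y in (0:ℝ)..x, truncWeight ψ s q j h y ξ

theorem hasDerivAt_truncInt_left (hψ : ContDiff ℝ (⊤ : ℕ∞) ψ) (j : ℕ) (h : {h : ℝ // 1 ≤ h})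
    (x ξ : ℝ) : HasDerivAt (fun x => truncInt ψ s q j h x ξ) (truncWeight ψ s q j h x ξ) x :=
  (continuous_truncWeight hψ j h ξ).integral_hasStrictDerivAt 0 x |>.hasDerivAt

theorem hasDerivAt_truncInt (hs : 0 ≤ s) (hψ : ContDiff ℝ (⊤ : ℕ∞) ψ) (hψ0 : ∀ y, 1 ≤ |y| → ψ y = 0)
    (j : ℕ) (h : {h : ℝ // 1 ≤ h}) (x ξ : ℝ) : HasDerivAt (truncInt ψ s q j h x)
      (truncInt ψ s q (j + 1) h x ξ * (-q * (unitSlope h ξ * recip h ξ))) ξ := by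
  obtain ⟨C, hC0, hC⟩ := exists_bound_eulerIter hψ hψ0 (j + 1)
  have hc := fun j ξ => continuous_truncWeight (s := s) (q := q) hψ j h ξ
  have := (intervalIntegral.hasDerivAt_integral_of_dominated_loc_of_deriv_le (𝕜 := ℝ) (μ := volume)
    (F := fun ξ y => truncWeight ψ s q j h y ξ) (a := 0) (b := x) (x₀ := ξ) (s := univ)
    (bound := fun _ => C * |q|)
    (F' := fun ξ y => truncWeight ψ s q (j + 1) h y ξ * (-q * (unitSlope h ξ * recip h ξ)))
    univ_mem (Eventually.of_forall fun ξ => (hc j ξ).aestronglyMeasurable)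
    ((hc j ξ).intervalIntegrable _ _) ((hc (j + 1) ξ).mul_const _).aestronglyMeasurable
    (Eventually.of_forall fun y _ ξ _ => ?_) (by simp)
    (Eventually.of_forall fun y _ ξ _ => hasDerivAt_truncWeight hψ j h y ξ)).2
  · refine this.congr_deriv ?_
    rw [intervalIntegral.integral_mul_const]
    rfl
  · rw [norm_mul, norm_mul, norm_mul, norm_neg]
    simp only [Real.norm_eq_abs]
    have h1 := (abs_truncWeight_le (s := s) (q := q) hC h y ξ).trans
      (mul_le_of_le_one_right hC0 (jb_rpow_neg_le_one hs y))
    have h2 : |unitSlope h ξ| * |recip h ξ| ≤ 1 := by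
      rw [abs_of_nonneg (recip_nonneg h ξ)]
      exact mul_le_one₀ (abs_unitSlope_le h ξ) (recip_nonneg h ξ) (recip_le_one h ξ)
    exact mul_le_mul h1 (mul_le_of_le_one_right (abs_nonneg q) h2) (by positivity) hC0

theorem abs_truncInt_le (hs : 0 < s) (hs1 : s < 1) (hψ : ContDiff ℝ (⊤ : ℕ∞) ψ)
    (hψ0 : ∀ y, 1 ≤ |y| → ψ y = 0) (j : ℕ) : ∃ C : ℝ, 0 ≤ C ∧ ∀ (h : {h : ℝ // 1 ≤ h}) (x ξ : ℝ),
      |truncInt ψ s q j h x ξ| ≤ C * jbh h ξ ^ (q * (1 - s)) := by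
  obtain ⟨C, hC0, hC⟩ := exists_bound_eulerIter hψ hψ0 j
  refine ⟨C / (1 - s), div_nonneg hC0 (by linarith), fun h x ξ => ?_⟩
  have hodd : truncInt ψ s q j h (-x) ξ = -truncInt ψ s q j h x ξ := by
    have he : ∀ y, truncWeight ψ s q j h (-y) ξ = truncWeight ψ s q j h y ξ := by
      intro y
      rw [truncWeight, truncWeight, jb, jb, neg_sq]
    have h1 := intervalIntegral.integral_comp_neg (fun y => truncWeight ψ s q j h y ξ)
      (a := 0) (b := x)
    simp only [he, neg_zero] at h1
    rw [truncInt, truncInt, h1, intervalIntegral.integral_symm]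
  set Y := jbh h ξ ^ q with hY
  have hY0 : 0 < Y := Real.rpow_pos_of_pos (jbh_pos h.2 ξ) q
  have hYs : jbh h ξ ^ (q * (1 - s)) = Y ^ (1 - s) := by
    rw [hY, ← Real.rpow_mul (jbh_pos h.2 ξ).le]
  have hsmall : ∀ x, 0 ≤ x → x ≤ Y → |truncInt ψ s q j h x ξ| ≤ C / (1 - s) * Y ^ (1 - s) := by
    intro x hx hxY
    have hmass : IntervalIntegrable (fun y : ℝ => C * y ^ (-s)) volume 0 x :=
      (intervalIntegral.intervalIntegrable_rpow' (by linarith)).const_mul C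
    have h1 := intervalIntegral.norm_integral_le_of_norm_le (μ := volume) (a := 0) (b := x)
      (f := fun y => truncWeight ψ s q j h y ξ) (g := fun y : ℝ => C * y ^ (-s)) hx
      (Eventually.of_forall fun y hy => by
        refine (abs_truncWeight_le hC h y ξ).trans (mul_le_mul_of_nonneg_left ?_ hC0)
        exact Real.rpow_le_rpow_of_nonpos hy.1 ((le_abs_self y).trans (abs_le_jb y)) (by linarith))
      hmass
    refine h1.trans ?_
    rw [intervalIntegral.integral_const_mul, integral_rpow (Or.inl (by linarith)),
      Real.zero_rpow (by linarith), sub_zero, show -s + 1 = 1 - s by ring, div_mul_eq_mul_div,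
      mul_div_assoc]
    exact mul_le_mul_of_nonneg_left (div_le_div_of_nonneg_right
      (Real.rpow_le_rpow hx hxY (by linarith)) (by linarith)) hC0
  have hpos : ∀ x, 0 ≤ x → |truncInt ψ s q j h x ξ| ≤ C / (1 - s) * Y ^ (1 - s) := by
    intro x hx
    rcases le_total x Y with hxY | hxY
    · exact hsmall x hx hxY
    · have hc := continuous_truncWeight (s := s) (q := q) hψ j h ξ
      have h1 : ∫ y in Y..x, truncWeight ψ s q j h y ξ = 0 := by
        refine intervalIntegral.integral_zero_ae (Eventually.of_forall fun y hy => ?_)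
        rw [uIoc_of_le hxY] at hy
        exact truncWeight_eq_zero hψ hψ0 j h (hy.1.le.trans ((le_abs_self y).trans (abs_le_jb y)))
      have h2 : truncInt ψ s q j h x ξ = truncInt ψ s q j h Y ξ := by
        rw [truncInt, ← intervalIntegral.integral_add_adjacent_intervals
          (hc.intervalIntegrable 0 Y) (hc.intervalIntegrable Y x), h1, add_zero, truncInt]
      rw [h2]
      exact hsmall Y hY0.le le_rfl
  rw [hYs]
  rcases le_total 0 x with hx | hx
  · exact hpos x hx
  · have := hpos (-x) (by linarith)
    rwa [hodd, abs_neg] at this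

end TruncatedIntegral

/-- The data entering the symbol: the cutoffs `ω`, `ψ` and the exponents. -/
structure SymbolData (ω ψ : ℝ → ℝ) (R s q κ : ℝ) : Prop where
  ω_smooth : ContDiff ℝ (⊤ : ℕ∞) ω
  ω_le : ∀ ξ, |ω ξ| ≤ 1
  ω_right : ∀ ξ₁ ξ₂ : ℝ, R ≤ ξ₁ → R ≤ ξ₂ → ω ξ₁ = ω ξ₂
  ω_left : ∀ ξ₁ ξ₂ : ℝ, ξ₁ ≤ -R → ξ₂ ≤ -R → ω ξ₁ = ω ξ₂
  ψ_smooth : ContDiff ℝ (⊤ : ℕ∞) ψ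
  ψ_eq_zero : ∀ y, 1 ≤ |y| → ψ y = 0
  one_le : 1 ≤ κ
  lt : κ < q
  exponents : q * s = q - κ

/-- The symbol `M ω(ξ/h) ⟨ξ⟩ₕ^(-κ) ∫₀ˣ ⟨y⟩^(-s) ψ(⟨y⟩ / ⟨ξ⟩ₕ^q) dy`. -/
def lam (M : ℝ) (ω ψ : ℝ → ℝ) (s q κ : ℝ) (h : {h : ℝ // 1 ≤ h}) (x ξ : ℝ) : ℝ :=
  M * ω (ξ / h) * jbh h ξ ^ (-κ) * truncInt ψ s q 0 h x ξ

/-- The `x`-derivative of the symbol. -/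
def lamDx (M : ℝ) (ω ψ : ℝ → ℝ) (s q κ : ℝ) (h : {h : ℝ // 1 ≤ h}) (x ξ : ℝ) : ℝ :=
  M * ω (ξ / h) * jbh h ξ ^ (-κ) * truncWeight ψ s q 0 h x ξ

/-- The order function of the `x`-derivative of the symbol. -/
def lamWeight (s q κ : ℝ) (h : {h : ℝ // 1 ≤ h}) (x ξ : ℝ) : ℝ :=
  if jb x ≤ jbh h ξ ^ q then jbh h ξ ^ (-κ) * jb x ^ (-s) else 0

namespace SymbolData

variable {ω ψ : ℝ → ℝ} {R s q κ : ℝ}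

theorem q_pos (d : SymbolData ω ψ R s q κ) : 0 < q := by linarith [d.one_le, d.lt]

theorem s_pos (d : SymbolData ω ψ R s q κ) : 0 < s := by
  have h1 : 0 < q * s := by linarith [d.exponents, d.lt]
  exact pos_of_mul_pos_right h1 d.q_pos.le

theorem s_lt_one (d : SymbolData ω ψ R s q κ) : s < 1 := by
  have h1 := d.exponents
  have h2 := d.q_pos
  have h3 := d.one_le
  by_contra hs
  nlinarith

section Weights

theorem lamWeight_nonneg (h : {h : ℝ // 1 ≤ h}) (x ξ : ℝ) : 0 ≤ lamWeight s q κ h x ξ := by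
  rw [lamWeight]
  split_ifs
  · exact mul_nonneg (Real.rpow_nonneg (jbh_pos h.2 ξ).le _) (Real.rpow_nonneg (jb_pos x).le _)
  · exact le_rfl

theorem jb_eq_rpow (d : SymbolData ω ψ R s q κ) (x : ℝ) : jb x = (jb x ^ q⁻¹) ^ q := by
  rw [← Real.rpow_mul (jb_pos x).le, inv_mul_cancel₀ d.q_pos.ne', Real.rpow_one]

/-- The basic bound for the weight: with `X = ⟨x⟩^(1/q)` it is at most `X^(-q) (X / ⟨ξ⟩ₕ)`, and
it vanishes unless `X ≤ ⟨ξ⟩ₕ`. -/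
theorem lamWeight_le (d : SymbolData ω ψ R s q κ) (h : {h : ℝ // 1 ≤ h}) (x ξ : ℝ) :
    lamWeight s q κ h x ξ = 0 ∨ ∃ X : ℝ, 1 ≤ X ∧ X ≤ jbh h ξ ∧ jb x = X ^ q ∧
      lamWeight s q κ h x ξ ≤ X ^ (-q) * (X / jbh h ξ) := by
  rw [lamWeight]
  split_ifs with hle
  · refine Or.inr ⟨jb x ^ q⁻¹, Real.one_le_rpow (one_le_jb x) (inv_nonneg.2 d.q_pos.le), ?_,
      d.jb_eq_rpow x, ?_⟩
    · rw [Real.rpow_inv_le_iff_of_pos (jb_pos x).le (jbh_pos h.2 ξ).le d.q_pos]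
      exact hle
    · have hX : jb x ^ q⁻¹ ≤ jbh h ξ := by
        rw [Real.rpow_inv_le_iff_of_pos (jb_pos x).le (jbh_pos h.2 ξ).le d.q_pos]
        exact hle
      have hX0 : 0 < jb x ^ q⁻¹ := Real.rpow_pos_of_pos (jb_pos x) _
      have h1 : jb x ^ (-s) = (jb x ^ q⁻¹) ^ (-q) * (jb x ^ q⁻¹) ^ κ := by
        rw [← Real.rpow_add hX0, ← Real.rpow_mul (jb_pos x).le]
        congr 1
        rw [eq_inv_mul_iff_mul_eq₀ d.q_pos.ne']
        linarith [d.exponents]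
      have hp := jbh_pos h.2 ξ
      have h2 : ((jb x ^ q⁻¹) / jbh h ξ) ^ κ ≤ (jb x ^ q⁻¹) / jbh h ξ := by
        have := Real.rpow_le_rpow_of_exponent_ge (div_pos hX0 hp) ((div_le_one hp).2 hX) d.one_le
        rwa [Real.rpow_one] at this
      rw [h1, Real.rpow_neg hp.le]
      rw [Real.div_rpow hX0.le hp.le] at h2
      calc _ = (jb x ^ q⁻¹) ^ (-q) * ((jb x ^ q⁻¹) ^ κ / jbh h ξ ^ κ) := by
            rw [div_eq_mul_inv]
            ring
        _ ≤ _ := mul_le_mul_of_nonneg_left h2 (Real.rpow_nonneg hX0.le _)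
  · exact Or.inl rfl

theorem lamWeight_le_inv_jb (d : SymbolData ω ψ R s q κ) (h : {h : ℝ // 1 ≤ h}) (x ξ : ℝ) :
    lamWeight s q κ h x ξ ≤ (jb x)⁻¹ := by
  have hj := jb_pos x
  rcases d.lamWeight_le h x ξ with h0 | ⟨X, hX1, hXle, hX, hle⟩
  · rw [h0]
    positivity
  · have hX0 : 0 < X := by linarith
    refine hle.trans ?_
    rw [hX, ← Real.rpow_neg hX0.le]
    exact mul_le_of_le_one_right (Real.rpow_nonneg hX0.le _) ((div_le_one (jbh_pos h.2 ξ)).2 hXle)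

theorem lamWeight_le_recip (d : SymbolData ω ψ R s q κ) (h : {h : ℝ // 1 ≤ h}) (x ξ : ℝ) :
    lamWeight s q κ h x ξ ≤ recip h ξ := by
  rcases d.lamWeight_le h x ξ with h0 | ⟨X, hX1, hXle, hX, hle⟩
  · rw [h0]
    exact recip_nonneg h ξ
  · have hX0 : 0 < X := by linarith
    refine hle.trans ?_
    rw [div_eq_mul_inv, ← mul_assoc, recip]
    refine mul_le_of_le_one_left (inv_nonneg.2 (jbh_pos h.2 ξ).le) ?_
    rw [← Real.rpow_add_one hX0.ne']
    exact Real.rpow_le_one_of_one_le_of_nonpos hX1 (by linarith [d.one_le, d.lt])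

theorem recip_le (h : {h : ℝ // 1 ≤ h}) (ξ : ℝ) :
    recip h ξ ≤ (h : ℝ) ^ (-(1 / 4) : ℝ) * jb ξ ^ (-(3 / 4) : ℝ) := by
  have h0 : (0 : ℝ) < h := zero_lt_one.trans_le h.2
  have hp := jbh_pos h.2 ξ
  have h1 : recip h ξ = jbh h ξ ^ (-(1 / 4) : ℝ) * jbh h ξ ^ (-(3 / 4) : ℝ) := by
    rw [← Real.rpow_add hp, recip, ← Real.rpow_neg_one]
    norm_num
  rw [h1]
  exact mul_le_mul (Real.rpow_le_rpow_of_nonpos h0 (le_jbh _ _) (by norm_num))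
    (Real.rpow_le_rpow_of_nonpos (jb_pos ξ) (jb_le_jbh h.2 ξ) (by norm_num))
    (Real.rpow_nonneg hp.le _) (Real.rpow_nonneg h0.le _)

theorem sqrt_jb_rpow (r x : ℝ) : √(jb x ^ r) = jb x ^ (r / 2) := by
  rw [Real.sqrt_eq_rpow, ← Real.rpow_mul (jb_pos x).le]
  congr 1
  ring

/-- On the support of the weight it gains a negative power of `h`. -/
theorem lamWeight_le_rpow (d : SymbolData ω ψ R s q κ) (h : {h : ℝ // 1 ≤ h}) (x ξ : ℝ) {r : ℝ}
    (hr : r * q ≤ q - 1 / 4) :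
    lamWeight s q κ h x ξ ≤ (h : ℝ) ^ (-(1 / 4) : ℝ) * jb x ^ (-r) := by
  have h0 : (0 : ℝ) < h := zero_lt_one.trans_le h.2
  have hp := jbh_pos h.2 ξ
  rcases d.lamWeight_le h x ξ with hw | ⟨X, hX1, hXle, hX, hle⟩
  · rw [hw]
    exact mul_nonneg (Real.rpow_nonneg h0.le _) (Real.rpow_nonneg (jb_pos x).le _)
  · have hX0 : 0 < X := by linarith
    refine hle.trans ?_
    have h1 : X / jbh h ξ ≤ X ^ (1 / 4 : ℝ) * jbh h ξ ^ (-(1 / 4) : ℝ) := by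
      have := Real.rpow_le_rpow_of_exponent_ge (div_pos hX0 hp) ((div_le_one hp).2 hXle)
        (show (1 / 4 : ℝ) ≤ 1 by norm_num)
      rw [Real.rpow_one, Real.div_rpow hX0.le hp.le] at this
      rwa [Real.rpow_neg hp.le, ← div_eq_mul_inv]
    have h2 : jbh h ξ ^ (-(1 / 4) : ℝ) ≤ (h : ℝ) ^ (-(1 / 4) : ℝ) :=
      Real.rpow_le_rpow_of_nonpos h0 (le_jbh _ _) (by norm_num)
    have h3 : X ^ (-q) * X ^ (1 / 4 : ℝ) ≤ jb x ^ (-r) := by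
      rw [hX, ← Real.rpow_mul hX0.le, ← Real.rpow_add hX0]
      exact Real.rpow_le_rpow_of_exponent_le hX1 (by linarith)
    calc _ ≤ X ^ (-q) * (X ^ (1 / 4 : ℝ) * (h : ℝ) ^ (-(1 / 4) : ℝ)) :=
          mul_le_mul_of_nonneg_left (h1.trans (mul_le_mul_of_nonneg_left h2
            (Real.rpow_nonneg hX0.le _))) (Real.rpow_nonneg hX0.le _)
      _ = (h : ℝ) ^ (-(1 / 4) : ℝ) * (X ^ (-q) * X ^ (1 / 4 : ℝ)) := by ring
      _ ≤ _ := mul_le_mul_of_nonneg_left h3 (Real.rpow_nonneg h0.le _)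

theorem lamWeight_mul_recip_le (d : SymbolData ω ψ R s q κ) (h : {h : ℝ // 1 ≤ h}) (x ξ : ℝ) :
    lamWeight s q κ h x ξ * recip h ξ ≤
      (h : ℝ) ^ (-(1 / 4) : ℝ) * jb x ^ (-(1 + 1 / (2 * q))) := by
  have h0 : (0 : ℝ) < h := zero_lt_one.trans_le h.2
  have hp := jbh_pos h.2 ξ
  have hq := d.q_pos
  rcases d.lamWeight_le h x ξ with hw | ⟨X, hX1, hXle, hX, -⟩
  · rw [hw, zero_mul]
    exact mul_nonneg (Real.rpow_nonneg h0.le _) (Real.rpow_nonneg (jb_pos x).le _)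
  · have hX0 : 0 < X := by linarith
    have h1 : recip h ξ = jbh h ξ ^ (-(1 / 2) : ℝ) * jbh h ξ ^ (-(1 / 2) : ℝ) := by
      rw [← Real.rpow_add hp, recip, ← Real.rpow_neg_one]
      norm_num
    have h2 : jbh h ξ ^ (-(1 / 2) : ℝ) ≤ (h : ℝ) ^ (-(1 / 4) : ℝ) :=
      (Real.rpow_le_rpow_of_exponent_le (one_le_jbh h.2 ξ) (by norm_num)).trans
        (Real.rpow_le_rpow_of_nonpos h0 (le_jbh _ _) (by norm_num))
    have h3 : jbh h ξ ^ (-(1 / 2) : ℝ) ≤ X ^ (-(1 / 2) : ℝ) :=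
      Real.rpow_le_rpow_of_nonpos hX0 hXle (by norm_num)
    have h4 : jb x ^ (-(1 + 1 / (2 * q))) = (jb x)⁻¹ * X ^ (-(1 / 2) : ℝ) := by
      rw [hX, ← Real.rpow_neg hX0.le, ← Real.rpow_mul hX0.le, ← Real.rpow_add hX0]
      congr 1
      field_simp
      ring
    rw [h4, h1]
    calc _ ≤ (jb x)⁻¹ * ((h : ℝ) ^ (-(1 / 4) : ℝ) * X ^ (-(1 / 2) : ℝ)) :=
          mul_le_mul (d.lamWeight_le_inv_jb h x ξ) (mul_le_mul h2 h3 (Real.rpow_nonneg hp.le _)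
            (Real.rpow_nonneg h0.le _)) (mul_nonneg (Real.rpow_nonneg hp.le _)
            (Real.rpow_nonneg hp.le _)) (inv_nonneg.2 (jb_pos x).le)
      _ = _ := by ring

end Weights

theorem hasDerivAt_lam_left (d : SymbolData ω ψ R s q κ) (M : ℝ) (h : {h : ℝ // 1 ≤ h}) (x ξ : ℝ) :
    HasDerivAt (fun x => lam M ω ψ s q κ h x ξ) (lamDx M ω ψ s q κ h x ξ) x :=
  (hasDerivAt_truncInt_left d.ψ_smooth 0 h x ξ).const_mul _

theorem symEst_factor (d : SymbolData ω ψ R s q κ) (M : ℝ) :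
    SymEst recip (fun h ξ => 1 * jbh h ξ ^ (-κ)) (fun h ξ => M * ω (ξ / h) * jbh h ξ ^ (-κ)) :=
  ((symEst_freq_cutoff d.ω_smooth d.ω_le d.ω_right d.ω_left).const_mul M).mul (symEst_jbh_rpow (-κ))

theorem symEst_lam (d : SymbolData ω ψ R s q κ) (M : ℝ) :
    SymEst (fun i : {h : ℝ // 1 ≤ h} × ℝ => recip i.1) (fun _ _ => 1)
      (fun i => lam M ω ψ s q κ i.1 i.2) := by
  choose C hC0 hC using abs_truncInt_le d.s_pos d.s_lt_one d.ψ_smooth d.ψ_eq_zero (q := q)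
  have h1 : SymEst (fun i : {h : ℝ // 1 ≤ h} × ℝ => recip i.1)
      (fun i ξ => jbh i.1 ξ ^ (q * (1 - s))) (fun i => truncInt ψ s q 0 i.1 i.2) :=
    sym_of_chain (f := fun j (i : {h : ℝ // 1 ≤ h} × ℝ) => truncInt ψ s q j i.1 i.2)
      hC0 (fun j i x => hC j i.1 i.2 x)
      (fun j i x => hasDerivAt_truncInt d.s_pos.le d.ψ_smooth d.ψ_eq_zero j i.1 i.2 x)
      (fun _ => (symEst_slope_mul_recip (-q)).reindex Prod.fst) 0
  refine (((d.symEst_factor M).reindex Prod.fst).mul h1).mono_weight zero_le_one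
    (fun i x => recip_nonneg i.1 x) fun i x => le_of_eq ?_
  rw [one_mul, ← Real.rpow_add (jbh_pos i.1.2 x), show -κ + q * (1 - s) = 0 by
    linarith [d.exponents], Real.rpow_zero, one_mul]

theorem abs_truncWeight_le_indicator (d : SymbolData ω ψ R s q κ) {C : ℝ} {j : ℕ}
    (hC : ∀ y, |eulerIter ψ j y| ≤ C) (h : {h : ℝ // 1 ≤ h}) (y ξ : ℝ) :
    |truncWeight ψ s q j h y ξ| ≤ C * (if jb y ≤ jbh h ξ ^ q then jb y ^ (-s) else 0) := by
  split_ifs with hle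
  · exact abs_truncWeight_le hC h y ξ
  · rw [truncWeight_eq_zero d.ψ_smooth d.ψ_eq_zero j h (not_le.1 hle).le, abs_zero, mul_zero]

/-- Frequency regularity of the `x`-derivative. -/
theorem symEst_lamDx (d : SymbolData ω ψ R s q κ) (M : ℝ) :
    SymEst (fun i : {h : ℝ // 1 ≤ h} × ℝ => recip i.1) (fun i => lamWeight s q κ i.1 i.2)
      (fun i => lamDx M ω ψ s q κ i.1 i.2) := by
  choose C hC0 hC using exists_bound_eulerIter d.ψ_smooth d.ψ_eq_zero
  have h1 : SymEst (fun i : {h : ℝ // 1 ≤ h} × ℝ => recip i.1)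
      (fun i ξ => if jb i.2 ≤ jbh i.1 ξ ^ q then jb i.2 ^ (-s) else 0)
      (fun i => truncWeight ψ s q 0 i.1 i.2) :=
    sym_of_chain (f := fun j (i : {h : ℝ // 1 ≤ h} × ℝ) => truncWeight ψ s q j i.1 i.2)
      hC0 (fun j i x => d.abs_truncWeight_le_indicator (hC j) i.1 i.2 x)
      (fun j i x => hasDerivAt_truncWeight d.ψ_smooth j i.1 i.2 x)
      (fun _ => (symEst_slope_mul_recip (-q)).reindex Prod.fst) 0
  refine (((d.symEst_factor M).reindex Prod.fst).mul h1).mono_weight zero_le_one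
    (fun i x => recip_nonneg i.1 x) fun i x => le_of_eq ?_
  rw [one_mul, one_mul, lamWeight, mul_ite, mul_zero]

/-- Spatial regularity of the `x`-derivative. -/
theorem symEst_lamDx_left (d : SymbolData ω ψ R s q κ) (M : ℝ) :
    SymEst (fun (_ : {h : ℝ // 1 ≤ h} × ℝ) x => (jb x)⁻¹)
      (fun i x => lamWeight s q κ i.1 x i.2) (fun i x => lamDx M ω ψ s q κ i.1 x i.2) := by
  choose C hC0 hC using exists_bound_eulerIter d.ψ_smooth d.ψ_eq_zero
  have hr : recip ⟨1, le_rfl⟩ = fun x => (jb x)⁻¹ := funext fun x => by rw [recip, jb_eq_jbh]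
  have hvg : SymEst (fun (_ : {h : ℝ // 1 ≤ h} × ℝ) x => (jb x)⁻¹) (fun _ x => (jb x)⁻¹)
      (fun _ x => 1 * (unitSlope ⟨1, le_rfl⟩ x * recip ⟨1, le_rfl⟩ x)) := by
    have := (symEst_slope_mul_recip 1).reindex
      (fun _ : {h : ℝ // 1 ≤ h} × ℝ => (⟨1, le_rfl⟩ : {h : ℝ // 1 ≤ h}))
    simpa only [hr] using this
  have hpow : SymEst (fun (_ : {h : ℝ // 1 ≤ h} × ℝ) x => (jb x)⁻¹) (fun _ x => jb x ^ (-s))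
      (fun _ x => jb x ^ (-s)) := by
    have := (symEst_jbh_rpow (-s)).reindex
      (fun _ : {h : ℝ // 1 ≤ h} × ℝ => (⟨1, le_rfl⟩ : {h : ℝ // 1 ≤ h}))
    simpa only [hr, ← jb_eq_jbh] using this
  have hcut : SymEst (fun (_ : {h : ℝ // 1 ≤ h} × ℝ) x => (jb x)⁻¹)
      (fun i x => if jb x ≤ jbh i.1 i.2 ^ q then 1 else 0)
      (fun i x => eulerIter ψ 0 (jb x / jbh i.1 i.2 ^ q)) := by
    refine sym_of_chain
      (f := fun j (i : {h : ℝ // 1 ≤ h} × ℝ) x => eulerIter ψ j (jb x / jbh i.1 i.2 ^ q)) hC0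
      (fun j i x => ?_) (fun j i x => ?_) (fun _ => hvg) 0
    · have hp := Real.rpow_pos_of_pos (jbh_pos i.1.2 i.2) q
      split_ifs with hle
      · rw [mul_one]
        exact hC j _
      · rw [eulerIter_eq_zero d.ψ_smooth d.ψ_eq_zero, norm_zero, mul_zero]
        rw [abs_of_pos (div_pos (jb_pos x) hp), one_le_div hp]
        exact (not_le.1 hle).le
    · refine hasDerivAt_eulerIter_comp d.ψ_smooth j
        (((hasDerivAt_jb x).div_const (jbh i.1 i.2 ^ q)).congr_deriv ?_)
      rw [unitSlope, hr]
      have := (jb_pos x).ne'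
      field_simp
  have hfac : SymEst (fun (_ : {h : ℝ // 1 ≤ h} × ℝ) x => (jb x)⁻¹)
      (fun i _ => |M| * jbh i.1 i.2 ^ (-κ)) (fun i _ => M * ω (i.2 / i.1) * jbh i.1 i.2 ^ (-κ)) := by
    refine symEst_of_index (fun _ x => inv_nonneg.2 (jb_pos x).le)
      (c := fun i : {h : ℝ // 1 ≤ h} × ℝ => M * ω (i.2 / i.1) * jbh i.1 i.2 ^ (-κ))
      (w := fun i => |M| * jbh i.1 i.2 ^ (-κ)) fun i => ?_
    have hp := Real.rpow_nonneg (jbh_pos i.1.2 i.2).le (-κ)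
    rw [abs_mul, abs_mul, abs_of_nonneg hp]
    exact mul_le_mul_of_nonneg_right (mul_le_of_le_one_right (abs_nonneg M) (d.ω_le _)) hp
  refine (hfac.mul (hpow.mul hcut)).mono_weight (abs_nonneg M)
    (fun _ x => inv_nonneg.2 (jb_pos x).le) fun i x => le_of_eq ?_
  rw [lamWeight]
  split_ifs
  · ring
  · ring

/-- Spatial regularity of the symbol. -/
theorem symEst_lam_left (d : SymbolData ω ψ R s q κ) (M : ℝ) :
    SymEst (fun (_ : {h : ℝ // 1 ≤ h} × ℝ) x => (jb x)⁻¹) (fun _ _ => 1)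
      (fun i x => lam M ω ψ s q κ i.1 x i.2) := by
  obtain ⟨C, hC0, hC⟩ := (d.symEst_lam M).bound
  have hb : ∀ (i : {h : ℝ // 1 ≤ h} × ℝ) (x : ℝ), ‖lam M ω ψ s q κ i.1 x i.2‖ ≤ C * 1 :=
    fun i x => hC (i.1, x) i.2
  have hd : ∀ (i : {h : ℝ // 1 ≤ h} × ℝ) (x : ℝ), HasDerivAt (fun x => lam M ω ψ s q κ i.1 x i.2)
      (lamDx M ω ψ s q κ i.1 x i.2) x := fun i x => d.hasDerivAt_lam_left M i.1 x i.2
  intro n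
  rcases n with _ | n
  · exact symUpTo_zero (fun i => continuous_iff_continuousAt.2 fun x => (hd i x).continuousAt) hC0 hb
  · refine symUpTo_succ hC0 hb hd ?_
    refine ((d.symEst_lamDx_left M) n).mono_weight zero_le_one
      (fun _ x => inv_nonneg.2 (jb_pos x).le) fun i x => ?_
    rw [one_mul, one_mul]
    exact d.lamWeight_le_inv_jb _ _ _

/-- Equality of the mixed derivatives. -/
theorem hasDerivAt_deriv_lam (d : SymbolData ω ψ R s q κ) (M : ℝ) (h : {h : ℝ // 1 ≤ h}) (x ξ : ℝ) :
    HasDerivAt (fun x => deriv (lam M ω ψ s q κ h x) ξ) (deriv (lamDx M ω ψ s q κ h x) ξ) x := by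
  have hA := (d.symEst_factor M).hasDerivAt h ξ
  have h1 : ∀ x, deriv (lam M ω ψ s q κ h x) ξ =
      deriv (fun ξ => M * ω (ξ / h) * jbh h ξ ^ (-κ)) ξ * truncInt ψ s q 0 h x ξ +
      M * ω (ξ / h) * jbh h ξ ^ (-κ) *
        (truncInt ψ s q 1 h x ξ * (-q * (unitSlope h ξ * recip h ξ))) := fun x =>
    (hA.mul (hasDerivAt_truncInt d.s_pos.le d.ψ_smooth d.ψ_eq_zero 0 h x ξ)).deriv
  have h2 : deriv (lamDx M ω ψ s q κ h x) ξ =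
      deriv (fun ξ => M * ω (ξ / h) * jbh h ξ ^ (-κ)) ξ * truncWeight ψ s q 0 h x ξ +
      M * ω (ξ / h) * jbh h ξ ^ (-κ) *
        (truncWeight ψ s q 1 h x ξ * (-q * (unitSlope h ξ * recip h ξ))) :=
    (hA.mul (hasDerivAt_truncWeight d.ψ_smooth 0 h x ξ)).deriv
  rw [h2, funext h1]
  exact ((hasDerivAt_truncInt_left d.ψ_smooth 0 h x ξ).const_mul _).add
    (((hasDerivAt_truncInt_left d.ψ_smooth 1 h x ξ).mul_const _).const_mul _)

theorem hasDerivAt_lamDx (d : SymbolData ω ψ R s q κ) (M : ℝ) (h : {h : ℝ // 1 ≤ h}) (x ξ : ℝ) :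
    HasDerivAt (lamDx M ω ψ s q κ h x) (deriv (lamDx M ω ψ s q κ h x) ξ) ξ :=
  (d.symEst_lamDx M).hasDerivAt (h, x) ξ

end SymbolData

theorem abs_sub_le_of_hasDerivAt {f f' : ℝ → ℝ} {C : ℝ} (hd : ∀ x, HasDerivAt f (f' x) x)
    (hC : ∀ x, |f' x| ≤ C) (x y : ℝ) : |f x - f y| ≤ C * |x - y| :=
  convex_univ.norm_image_sub_le_of_norm_hasDerivWithin_le (fun z _ => (hd z).hasDerivWithinAt)
    (fun z _ => hC z) (mem_univ y) (mem_univ x)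

theorem isAmplitude_exp {κ : Type*} {σ : κ → ℝ → ℝ → ℝ}
    (hl : SymEst (fun _ _ => 1) (fun _ _ => 1) (fun (i : κ × ℝ) a => σ i.1 a i.2))
    (hr : SymEst (fun _ _ => 1) (fun _ _ => 1) (fun (i : κ × ℝ) => σ i.1 i.2)) (h : κ) :
    IsAmplitude (fun a b => (Real.exp (σ h a b) : ℂ)) :=
  ⟨(hl.exp.ofReal).reindex (fun b => (h, b)), (hr.exp.ofReal).reindex (fun a => (h, a))⟩

/-- A family of phases whose derivatives are uniformly controlled by a small factor `δ`. -/
theorem exists_smallPhase {κ : Type*} {σ : κ → ℝ → ℝ → ℝ} {D : κ → ℝ → ℝ → ℝ} {δ : κ → ℝ}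
    {m : ℝ → ℝ} {K₁ : ℝ}
    (hl : SymEst (fun _ _ => 1) (fun _ _ => 1) (fun (i : κ × ℝ) a => σ i.1 a i.2))
    (hr : SymEst (fun _ _ => 1) (fun _ _ => 1) (fun (i : κ × ℝ) => σ i.1 i.2))
    (hm : ∀ b, 0 ≤ m b) (hmi : Integrable m) (hδ : ∀ h, 0 ≤ δ h)
    (h1 : SymEst (fun _ _ => 1) (fun (i : κ × ℝ) b => δ i.1 * √(m b)) (fun i => deriv (σ i.1 i.2)))
    (h2 : SymEst (fun _ _ => 1) (fun (i : κ × ℝ) b => δ i.1 * m b)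
      (fun i => deriv (deriv (σ i.1 i.2))))
    (hD : ∀ h a b, HasDerivAt (fun a => deriv (σ h a) b) (D h a b) a)
    (hDb : ∀ h a b, |D h a b| ≤ K₁ * (δ h * m b)) :
    ∃ C₀ K L : ℝ, ∀ h, K * δ h ≤ 1 → SmallPhase m C₀ (K * δ h) L (σ h) := by
  obtain ⟨C₀, -, hC₀⟩ := hr.bound
  obtain ⟨L, hL0, hL⟩ := hl.deriv.bound
  obtain ⟨K₂, hK₂, hb1⟩ := h1.bound
  obtain ⟨K₃, hK₃, hb2⟩ := h2.bound
  have hneg : ∀ {ι : Type _} {f : ι → ℝ → ℝ}, SymEst (fun _ _ => 1) (fun _ _ => 1) f →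
      SymEst (fun _ _ => 1) (fun _ _ => 1) (fun i x => -f i x) := by
    intro ι f hf
    simpa only [neg_one_mul] using hf.const_mul (-1)
  refine ⟨C₀, max K₁ (max K₂ K₃), L, fun h hh => ?_⟩
  have k1 : K₁ ≤ max K₁ (max K₂ K₃) := le_max_left _ _
  have k2 : K₂ ≤ max K₁ (max K₂ K₃) := (le_max_left _ _).trans (le_max_right _ _)
  have k3 : K₃ ≤ max K₁ (max K₂ K₃) := (le_max_right _ _).trans (le_max_right _ _)
  set K := max K₁ (max K₂ K₃)
  have hlip : ∀ a a' b, |σ h a b - σ h a' b| ≤ L * |a - a'| := fun a a' b =>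
    abs_sub_le_of_hasDerivAt (f := fun a => σ h a b) (fun x => hl.hasDerivAt (h, b) x)
      (fun x => by simpa using hL (h, b) x) a a'
  refine
    { cont := ?_
      amp := isAmplitude_exp hl hr h
      ampNeg := isAmplitude_exp (σ := fun h a b => -σ h a b) (hneg hl) (hneg hr) h
      bdd := fun a b => by simpa using hC₀ (h, a) b
      smooth := fun a => hr.contDiff (h, a)
      m_nonneg := hm
      m_int := hmi
      ε_nonneg := mul_nonneg (hK₂.trans k2) (hδ h)
      ε_le := hh
      L_nonneg := hL0
      d1_sym := (h1.reindex fun a => (h, a)).mono_weight (hδ h) (fun _ _ => zero_le_one)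
        fun _ _ => le_rfl
      d2_sym := (h2.reindex fun a => (h, a)).mono_weight (hδ h) (fun _ _ => zero_le_one)
        fun _ _ => le_rfl
      d1 := fun a b => (hb1 (h, a) b).trans ?_
      d2 := fun a b => (hb2 (h, a) b).trans ?_
      lip0 := hlip
      lip1 := fun a a' b => ?_ }
  · refine continuous_prod_of_continuous_lipschitzWith _ L.toNNReal
      (fun a => (hr.contDiff (h, a)).continuous) fun b => ?_
    refine LipschitzWith.of_dist_le_mul fun a a' => ?_
    rw [Real.coe_toNNReal L hL0, Real.dist_eq, Real.dist_eq]
    exact hlip a a' b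
  · rw [← mul_assoc]
    exact mul_le_mul_of_nonneg_right (mul_le_mul_of_nonneg_right k2 (hδ h)) (Real.sqrt_nonneg _)
  · rw [← mul_assoc]
    exact mul_le_mul_of_nonneg_right (mul_le_mul_of_nonneg_right k3 (hδ h)) (hm b)
  · refine (abs_sub_le_of_hasDerivAt (f := fun a => deriv (σ h a) b) (fun x => hD h x b)
      (fun x => hDb h x b) a a').trans ?_
    have := mul_le_mul_of_nonneg_right (mul_le_mul_of_nonneg_right k1
      (mul_nonneg (hδ h) (hm b))) (abs_nonneg (a - a'))
    linarith

theorem integrable_jb_rpow {r : ℝ} (hr : 1 < r) : Integrable fun x => jb x ^ (-r) := by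
  have := integrable_rpow_neg_one_add_norm_sq (E := ℝ) (μ := volume) (r := r) (by simpa using hr)
  refine this.congr (Eventually.of_forall fun x => ?_)
  dsimp only
  rw [jb, Real.sqrt_eq_rpow, ← Real.rpow_mul (by positivity), Real.norm_eq_abs, sq_abs]
  congr 1
  ring

namespace SymbolData

variable {ω ψ : ℝ → ℝ} {R s q κ : ℝ}

theorem rpow_nonneg_of_index (h : {h : ℝ // 1 ≤ h}) (r : ℝ) : 0 ≤ (h : ℝ) ^ r :=
  Real.rpow_nonneg (zero_le_one.trans h.2) r

theorem inv_jb_le_one (x : ℝ) : (jb x)⁻¹ ≤ 1 := inv_le_one_of_one_le₀ (one_le_jb x)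

theorem symEst_lam_one (d : SymbolData ω ψ R s q κ) (M : ℝ) :
    SymEst (fun _ _ => 1) (fun _ _ => 1)
      (fun i : {h : ℝ // 1 ≤ h} × ℝ => lam M ω ψ s q κ i.1 i.2) :=
  (d.symEst_lam M).mono_gain (fun i x => recip_nonneg i.1 x) (fun _ _ => zero_le_one)
    fun i x => recip_le_one i.1 x

theorem symEst_lam_left_one (d : SymbolData ω ψ R s q κ) (M : ℝ) :
    SymEst (fun _ _ => 1) (fun _ _ => 1)
      (fun (i : {h : ℝ // 1 ≤ h} × ℝ) x => lam M ω ψ s q κ i.1 x i.2) :=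
  (d.symEst_lam_left M).mono_gain (fun _ x => inv_nonneg.2 (jb_pos x).le) (fun _ _ => zero_le_one)
    fun _ x => inv_jb_le_one x

theorem exists_smallPhase_lam (d : SymbolData ω ψ R s q κ) (M : ℝ) :
    ∃ (m : ℝ → ℝ) (C₀ K L : ℝ), ∀ h : {h : ℝ // 1 ≤ h}, K * (h : ℝ) ^ (-(1 / 4) : ℝ) ≤ 1 →
      SmallPhase m C₀ (K * (h : ℝ) ^ (-(1 / 4) : ℝ)) L (lam M ω ψ s q κ h) := by
  have hsq : ∀ x, √(jb x ^ (-(3 / 2) : ℝ)) = jb x ^ (-(3 / 4) : ℝ) := fun x => by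
    rw [sqrt_jb_rpow]
    norm_num
  have hm : ∀ x, jb x ^ (-(3 / 2) : ℝ) = jb x ^ (-(3 / 4) : ℝ) * jb x ^ (-(3 / 4) : ℝ) := fun x => by
    rw [← Real.rpow_add (jb_pos x)]
    norm_num
  have hrr : ∀ (h : {h : ℝ // 1 ≤ h}) x, recip h x * recip h x ≤
      (h : ℝ) ^ (-(1 / 4) : ℝ) * jb x ^ (-(3 / 2) : ℝ) := by
    intro h x
    have h1 := recip_le h x
    have h2 : (h : ℝ) ^ (-(1 / 4) : ℝ) ≤ 1 :=
      Real.rpow_le_one_of_one_le_of_nonpos h.2 (by norm_num)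
    have h3 := Real.rpow_nonneg (jb_pos x).le (-(3 / 4) : ℝ)
    rw [hm, ← mul_assoc]
    exact mul_le_mul h1 (h1.trans (mul_le_of_le_one_left h3 h2)) (recip_nonneg h x)
      (mul_nonneg (rpow_nonneg_of_index h _) h3)
  obtain ⟨K₁, hK₁, hb⟩ := (d.symEst_lamDx M).deriv.bound
  refine ⟨fun x => jb x ^ (-(3 / 2) : ℝ), ?_⟩
  refine exists_smallPhase (D := fun h x ξ => deriv (lamDx M ω ψ s q κ h x) ξ) (K₁ := K₁)
    (δ := fun h : {h : ℝ // 1 ≤ h} => (h : ℝ) ^ (-(1 / 4) : ℝ))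
    (d.symEst_lam_left_one M) (d.symEst_lam_one M)
    (fun x => Real.rpow_nonneg (jb_pos x).le _) (integrable_jb_rpow (by norm_num))
    (fun h => rpow_nonneg_of_index h _) ?_ ?_ (d.hasDerivAt_deriv_lam M) ?_
  · refine (((d.symEst_lam M).deriv).mono_gain (fun i x => recip_nonneg i.1 x)
      (fun i x => mul_nonneg zero_le_one (recip_nonneg i.1 x))
      fun i x => recip_le_one i.1 x).mono_weight zero_le_one (fun _ _ => zero_le_one) fun i x => ?_
    rw [one_mul, one_mul, hsq]
    exact recip_le i.1 x
  · refine (((d.symEst_lam M).deriv.deriv).mono_gain (fun i x => recip_nonneg i.1 x)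
      (fun i x => mul_nonneg (mul_nonneg zero_le_one (recip_nonneg i.1 x)) (recip_nonneg i.1 x))
      fun i x => recip_le_one i.1 x).mono_weight zero_le_one (fun _ _ => zero_le_one) fun i x => ?_
    rw [one_mul, one_mul]
    exact hrr i.1 x
  · intro h x ξ
    refine (hb (h, x) ξ).trans (mul_le_mul_of_nonneg_left ?_ hK₁)
    exact (mul_le_mul_of_nonneg_right (d.lamWeight_le_recip h x ξ) (recip_nonneg h ξ)).trans
      (hrr h ξ)

theorem exists_smallPhase_lam_swap (d : SymbolData ω ψ R s q κ) (M : ℝ) (hq : 2 ≤ q) :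
    ∃ (m : ℝ → ℝ) (C₀ K L : ℝ), ∀ h : {h : ℝ // 1 ≤ h}, K * (h : ℝ) ^ (-(1 / 4) : ℝ) ≤ 1 →
      SmallPhase m C₀ (K * (h : ℝ) ^ (-(1 / 4) : ℝ)) L (fun ξ x => -lam M ω ψ s q κ h x ξ) := by
  have hneg : ∀ {ι : Type} {g w f : ι → ℝ → ℝ}, SymEst g w f → SymEst g w (fun i x => -f i x) := by
    intro ι g w f hf
    simpa only [neg_one_mul] using hf.const_mul (-1)
  have hq0 := d.q_pos
  have hd1 : ∀ (i : {h : ℝ // 1 ≤ h} × ℝ), deriv (fun x => -lam M ω ψ s q κ i.1 x i.2) =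
      fun x => -lamDx M ω ψ s q κ i.1 x i.2 := fun i => funext fun x =>
    (d.hasDerivAt_lam_left M i.1 x i.2).neg.deriv
  have hs1 := (hneg (d.symEst_lamDx_left M))
  have hj : ∀ x, 0 ≤ (jb x)⁻¹ := fun x => inv_nonneg.2 (jb_pos x).le
  obtain ⟨K₁, hK₁, hb⟩ := (d.symEst_lamDx M).deriv.bound
  refine ⟨fun x => jb x ^ (-(1 + 1 / (2 * q))), ?_⟩
  refine exists_smallPhase (D := fun h ξ x => -deriv (lamDx M ω ψ s q κ h x) ξ) (K₁ := K₁)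
    (δ := fun h : {h : ℝ // 1 ≤ h} => (h : ℝ) ^ (-(1 / 4) : ℝ))
    (σ := fun h ξ x => -lam M ω ψ s q κ h x ξ)
    (hneg (d.symEst_lam_one M)) (hneg (d.symEst_lam_left_one M))
    (fun x => Real.rpow_nonneg (jb_pos x).le _)
    (integrable_jb_rpow (lt_add_of_pos_right 1 (by positivity)))
    (fun h => rpow_nonneg_of_index h _) ?_ ?_ (fun h ξ x => ?_) fun h ξ x => ?_
  · simp only [hd1]
    refine (hs1.mono_gain (fun _ x => hj x) (fun i x => lamWeight_nonneg _ _ _)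
      fun _ x => inv_jb_le_one x).mono_weight zero_le_one (fun _ _ => zero_le_one) fun i x => ?_
    rw [one_mul, sqrt_jb_rpow, neg_div]
    refine d.lamWeight_le_rpow i.1 x i.2 ?_
    have : (1 + 1 / (2 * q)) / 2 * q = q / 2 + 1 / 4 := by
      field_simp
      ring
    linarith
  · simp only [hd1]
    refine (hs1.deriv.mono_gain (fun _ x => hj x)
      (fun i x => mul_nonneg (lamWeight_nonneg _ _ _) (hj x))
      fun _ x => inv_jb_le_one x).mono_weight zero_le_one (fun _ _ => zero_le_one) fun i x => ?_
    have h1 := d.lamWeight_le_rpow i.1 x i.2 (r := 1 / (2 * q)) (by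
      have : 1 / (2 * q) * q = 1 / 2 := by field_simp
      linarith)
    have h2 : jb x ^ (-(1 + 1 / (2 * q))) = jb x ^ (-(1 / (2 * q))) * (jb x)⁻¹ := by
      rw [← Real.rpow_neg_one, ← Real.rpow_add (jb_pos x)]
      congr 1
      ring
    rw [one_mul, h2, ← mul_assoc]
    exact mul_le_mul_of_nonneg_right h1 (hj x)
  · simp only [fun ξ => hd1 (h, ξ)]
    exact (d.hasDerivAt_lamDx M h x ξ).neg
  · rw [abs_neg]
    exact (hb (h, x) ξ).trans (mul_le_mul_of_nonneg_left (d.lamWeight_mul_recip_le h x ξ) hK₁)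

end SymbolData

theorem smallKer_mono {θ θ' C : ℝ} (hθ : θ ≤ θ') (N : ℕ) (z : ℝ) :
    smallKer θ C N z ≤ smallKer θ' C N z :=
  min_le_min_right _ (mul_le_mul_of_nonneg_right hθ (by positivity))

theorem SmallPhase.smallDefect {m : ℝ → ℝ} {C₀ ε L θ s : ℝ} {σ : ℝ → ℝ → ℝ}
    (h : SmallPhase m C₀ ε L σ) (hθ : 2 * Real.exp (2 * C₀) * (∫ b, m b) * ε ≤ θ) (hs : |s| = 1)
    {P : SchwartzMap ℝ ℂ →ₗ[ℂ] SchwartzMap ℝ ℂ}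
    (hP : ∀ v a, P v a = osc s (fun a b => (Real.exp (σ a b) : ℂ))
      (fun b => (((2 * π)⁻¹ : ℝ) : ℂ) * osc (-s) (fun b a => (Real.exp (-σ a b) : ℂ)) v b) a) :
    SmallDefect θ P := by
  intro N
  obtain ⟨C, hC0, hC⟩ := h.norm_defect_le N
  have hθ₀ : 0 ≤ 2 * Real.exp (2 * C₀) * (∫ b, m b) * ε :=
    mul_nonneg (mul_nonneg (by positivity) (integral_nonneg h.m_nonneg)) h.ε_nonneg
  refine ⟨C, hC0, fun v a => ?_⟩
  rw [hP]
  refine (hC s hs v a).trans (integral_mono_of_nonneg (Eventually.of_forall fun a' =>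
    mul_nonneg (smallKer_nonneg (N := N) hθ₀ hC0 (a - a')) (norm_nonneg _)) ?_
    (Eventually.of_forall fun a' =>
      mul_le_mul_of_nonneg_right (smallKer_mono hθ N (a - a')) (norm_nonneg _)))
  refine v.integrable.norm.bdd_mul (c := θ)
    (((continuous_smallKer θ C N).comp (continuous_const.sub continuous_id)).aestronglyMeasurable)
    (Eventually.of_forall fun a' => ?_)
  rw [Real.norm_eq_abs, abs_of_nonneg (smallKer_nonneg (hθ₀.trans hθ) hC0 _)]
  refine (min_le_left _ _).trans (mul_le_of_le_one_right (hθ₀.trans hθ) ?_)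
  exact inv_le_one_of_one_le₀ (by nlinarith [sq_nonneg (a - a')])

theorem osc_const_mul (s : ℝ) (c : ℝ → ℝ → ℂ) (z : ℂ) (w : ℝ → ℂ) (a : ℝ) :
    osc s c (fun b => z * w b) a = z * osc s c w a := by
  rw [osc, osc, ← integral_const_mul]
  congr 1
  ext b
  ring

/-- The normalised Fourier transform. -/
def fourierS : SchwartzMap ℝ ℂ →ₗ[ℂ] SchwartzMap ℝ ℂ :=
  (((2 * π)⁻¹ : ℝ) : ℂ) • oscS (-1) (by simp) (fun _ _ => 1) isAmplitude_one

theorem fourierS_apply (v : SchwartzMap ℝ ℂ) (a : ℝ) :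
    fourierS v a = (((2 * π)⁻¹ : ℝ) : ℂ) * osc (-1) (fun _ _ => 1) v a := rfl

theorem bijective_fourierS : Function.Bijective fourierS := by
  refine Function.bijective_iff_has_inverse.2
    ⟨oscS 1 (by simp) (fun _ _ => 1) isAmplitude_one, fun v => ?_, fun v => ?_⟩
  · ext a
    rw [oscS_apply, ← integral_phase_mul_osc_one (s := 1) (by simp) v a, osc]
    simp only [one_mul, fourierS_apply]
  · ext a
    rw [fourierS_apply, ← osc_const_mul, ← integral_phase_mul_osc_one (s := -1) (by simp) v a, osc]
    simp only [one_mul, oscS_apply, neg_neg]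

/-- If the phases `σ(x,ξ)` and `-σ(x,ξ)`, the latter with the roles of the variables exchanged,
vary little, then the operator with amplitude `exp σ` is bijective. -/
theorem bijective_oscS {m m' : ℝ → ℝ} {C₀ C₀' ε ε' L L' : ℝ} {σ : ℝ → ℝ → ℝ}
    (h : SmallPhase m C₀ ε L σ) (h' : SmallPhase m' C₀' ε' L' (fun b a => -σ a b))
    (hθ : 2 * Real.exp (2 * C₀) * (∫ b, m b) * ε ≤ (4 * π)⁻¹)
    (hθ' : 2 * Real.exp (2 * C₀') * (∫ b, m' b) * ε' ≤ (4 * π)⁻¹) :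
    Function.Bijective (oscS 1 (by simp) (fun a b => (Real.exp (σ a b) : ℂ)) h.amp) := by
  have hpi := Real.pi_pos
  refine bijective_of_smallDefect (θ := (4 * π)⁻¹) (by positivity) (by field_simp; norm_num)
    (T' := (((2 * π)⁻¹ : ℝ) : ℂ) • oscS (-1) (by simp) (fun b a => (Real.exp (-σ a b) : ℂ))
      h.ampNeg.swap) (c := fun b a => (Real.exp (-σ a b) : ℂ)) h.ampNeg.swap
    (z := (((2 * π)⁻¹ : ℝ) : ℂ)) (t := -1) (fun v a => rfl)
    (h.smallDefect hθ (s := 1) (by simp) fun v a => rfl)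
    (h'.smallDefect hθ' (s := -1) (by simp) fun v a => ?_)
  rw [osc_const_mul]
  simp only [neg_neg]
  rfl

/-- For large `h` the phase factors are as small as desired. -/
theorem eventually_small (K A : ℝ) : ∀ᶠ h : ℝ in atTop,
    K * h ^ (-(1 / 4) : ℝ) ≤ 1 ∧ A * (K * h ^ (-(1 / 4) : ℝ)) ≤ (4 * π)⁻¹ := by
  have h0 := tendsto_rpow_neg_atTop (show (0 : ℝ) < 1 / 4 by norm_num)
  have h1 := h0.const_mul K
  have h2 := h1.const_mul A
  rw [mul_zero] at h1 h2
  rw [mul_zero] at h2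
  have hpi := Real.pi_pos
  exact (h1.eventually_le_const zero_lt_one).and (h2.eventually_le_const (by positivity))

theorem SymbolData.exists_bijective {ω ψ : ℝ → ℝ} {R s q κ : ℝ} (d : SymbolData ω ψ R s q κ) (M : ℝ)
    (hq : 2 ≤ q) : ∃ h₀ : ℝ, 1 ≤ h₀ ∧ ∀ h : {h : ℝ // 1 ≤ h}, h₀ ≤ h →
      ∃ hc : IsAmplitude (fun x ξ => (Real.exp (lam M ω ψ s q κ h x ξ) : ℂ)),
        Function.Bijective (oscS 1 (by simp) _ hc) := by
  obtain ⟨m, C₀, K, L, hA⟩ := d.exists_smallPhase_lam M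
  obtain ⟨m', C₀', K', L', hB⟩ := d.exists_smallPhase_lam_swap M hq
  obtain ⟨h₀, hh⟩ := eventually_atTop.1 ((eventually_small K (2 * Real.exp (2 * C₀) * ∫ b, m b)).and
    (eventually_small K' (2 * Real.exp (2 * C₀') * ∫ b, m' b)))
  refine ⟨max 1 h₀, le_max_left _ _, fun h hle => ?_⟩
  obtain ⟨⟨a1, a2⟩, b1, b2⟩ := hh h ((le_max_right _ _).trans hle)
  exact ⟨(hA h a1).amp, bijective_oscS (hA h a1) (hB h b1) a2 b2⟩

/-- The oscillatory integral operator preceded by the Fourier transform is a pseudo-differential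
operator. -/
theorem oscS_fourierS_eq_psdo1 {c : ℝ → ℝ → ℂ} (hc : IsAmplitude c) (u : SchwartzMap ℝ ℂ) (x : ℝ) :
    oscS 1 (by simp) c hc (fourierS u) x = psdo1 c (fun y => u y) x := by
  rw [oscS_apply, psdo1, funext (fourierS_apply u), osc_const_mul, osc]
  congr 1
  refine integral_congr_ae (Eventually.of_forall fun ξ => ?_)
  have e1 : phase (1 * x * ξ) = Complex.exp (Complex.I * x * ξ) := by
    rw [phase]
    congr 1
    push_cast
    ring
  have e2 : ∀ y, phase (-1 * ξ * y) = Complex.exp (-Complex.I * y * ξ) := fun y => by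
    rw [phase]
    congr 1
    push_cast
    ring
  dsimp only
  rw [e1, osc]
  simp only [e2, one_mul]
  ring

end

/-- invertibility on `𝒮(ℝ)` of the operator `e^{λ_{p-k}}(x,D)` with
`λ_{p-k}(x,ξ) = M·ω(ξ/h)·⟨ξ⟩ₕ^{-k+1}·∫₀ˣ ⟨y⟩^{-(p-k)/(p-1)} ψ(⟨y⟩/⟨ξ⟩ₕ^{p-1}) dy`
for `h` large enough. -/
theorem stmt18 (p k : ℕ) (hp : 2 ≤ p) (hk2 : 2 ≤ k) (hkp : k ≤ p - 1)
    (M R : ℝ) (hM : 0 < M) (hR : 1 < R)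
    (ω : ℝ → ℝ) (hω : ContDiff ℝ (⊤ : ℕ∞) ω) (hωb : ∀ ξ : ℝ, |ω ξ| ≤ 1)
    (hω0 : ∀ ξ : ℝ, |ξ| ≤ 1 → ω ξ = 0)
    (hωcp : ∀ ξ₁ ξ₂ : ℝ, R ≤ ξ₁ → R ≤ ξ₂ → ω ξ₁ = ω ξ₂)
    (hωcm : ∀ ξ₁ ξ₂ : ℝ, ξ₁ ≤ -R → ξ₂ ≤ -R → ω ξ₁ = ω ξ₂)
    (ψ : ℝ → ℝ) (hψ : ContDiff ℝ (⊤ : ℕ∞) ψ) (hψc : HasCompactSupport ψ)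
    (hψ01 : ∀ y : ℝ, 0 ≤ ψ y ∧ ψ y ≤ 1)
    (hψ1 : ∀ y : ℝ, |y| ≤ 1 / 2 → ψ y = 1)
    (hψ0 : ∀ y : ℝ, 1 ≤ |y| → ψ y = 0) :
    ∃ hk : ℝ, 1 ≤ hk ∧ ∀ h : ℝ, hk ≤ h →
      ∃ E : SchwartzMap ℝ ℂ →ₗ[ℂ] SchwartzMap ℝ ℂ,
        (∀ u : SchwartzMap ℝ ℂ, ∀ x : ℝ,
          E u x = psdo1
            (fun x' ξ' =>
              ((Real.exp (M * ω (ξ' / h) * jbh h ξ' ^ (-(k : ℝ) + 1) *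
                ∫ y in (0:ℝ)..x',
                  jb y ^ (-(((p : ℝ) - k) / ((p : ℝ) - 1))) *
                    ψ (jb y / jbh h ξ' ^ ((p : ℝ) - 1))) : ℝ) : ℂ))
            (fun y => u y) x) ∧
        Function.Bijective E := by
  have hk1 : (k : ℝ) + 1 ≤ p := by
    have : k + 1 ≤ p := by omega
    exact_mod_cast this
  have hk2' : (2 : ℝ) ≤ k := by exact_mod_cast hk2
  have hp1 : (p : ℝ) - 1 ≠ 0 := by linarith
  have d : SymbolData ω ψ R (((p : ℝ) - k) / ((p : ℝ) - 1)) ((p : ℝ) - 1) ((k : ℝ) - 1) :=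
    { ω_smooth := hω
      ω_le := hωb
      ω_right := hωcp
      ω_left := hωcm
      ψ_smooth := hψ
      ψ_eq_zero := hψ0
      one_le := by linarith
      lt := by linarith
      exponents := by
        field_simp
        ring }
  obtain ⟨h₀, hh₀, hbij⟩ := d.exists_bijective M (by linarith)
  refine ⟨h₀, hh₀, fun h hle => ?_⟩
  obtain ⟨hc, hb⟩ := hbij ⟨h, hh₀.trans hle⟩ hle
  refine ⟨oscS 1 (by simp) _ hc ∘ₗ fourierS, fun u x => ?_, hb.comp bijective_fourierS⟩
  rw [LinearMap.comp_apply, oscS_fourierS_eq_psdo1, show -(k : ℝ) + 1 = -((k : ℝ) - 1) by ring]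
  rfl
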